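/- Let B₁, B₂ be open balls in ℝⁿ of radius r₁, r₂ respectively, and let K₁ ⊆ B₁ and K₂ ⊆ B₂ be compact. Then there exists C₀ > 0 as follows. Suppose T : C¹_c(B₁) → L²(B₂) is linear, has a formal adjoint T* : C¹_c(B₂) → L²(B₁), and A > 0 is such that: (a) if f ∈ C¹_c(B₁) then Tf = 0 almost everywhere on the complement of K₂, and Tf ≡ 0 whenever supp f is disjoint from K₁; (i) ‖Tω‖_{L²} ≤ A r^{n/2} for every r-bump function ω with r ≤ r₁ supported in B₁, and ‖T*ω‖_{L²} ≤ A r^{n/2} for every r-bump function ω with r ≤ r₂ supported in B₂; (ii) there is a kernel K(x,y), C¹ off the diagonal, such that for every F ∈ C¹_c(B₁) and every x outside supp F one has (TF)(x) = ∫ K(x,y)F(y) dy; (iii) |K(x,y)| ≤ A|x−y|^{−n} for all x ∈ B₂, y ∈ B₁ with x ≠ y, and |∂_{x_i}K(x,y)| ≤ A|x−y|^{−(n+1)} and |∂_{y_i}K(x,y)| ≤ A|x−y|^{−(n+1)} for every i and all such x ≠ y. Then T extends to a bounded operator from L²(B₁) to L²(B₂) with operator norm ‖T‖ ≤ C₀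 A. -/

import Mathlib

open MeasureTheory Metric

noncomputable section

/-- An `r`-bump function on `ℝⁿ`: a `C¹` function supported in some ball of radius `r`,
with `‖ω‖_∞ ≤ 1` and `‖∂_jω‖_∞ ≤ 1/r` for each partial derivative. -/
def IsBump (n : ℕ) (r : ℝ) (ω : EuclideanSpace ℝ (Fin n) → ℂ) : Prop :=
  ContDiff ℝ 1 ω ∧
  (∃ c : EuclideanSpace ℝ (Fin n), tsupport ω ⊆ closedBall c r) ∧
  (∀ x, ‖ω x‖ ≤ 1) ∧
  (∀ i : Fin n, ∀ x, ‖fderiv ℝ ω x (EuclideanSpace.single i 1)‖ ≤ 1 / r)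

namespace T1

variable {n : ℕ}

/-- sup norm of an integer vector -/
def nv (v : Fin n → ℤ) : ℕ := Finset.univ.sup fun t => (v t).natAbs

lemma nv_le {v : Fin n → ℤ} {r : ℕ} : nv v ≤ r ↔ ∀ t, (v t).natAbs ≤ r := by
  simp [nv, Finset.sup_le_iff]

lemma natAbs_le_nv (v : Fin n → ℤ) (t : Fin n) : (v t).natAbs ≤ nv v :=
  nv_le.1 le_rfl t

lemma nv_zero : nv (0 : Fin n → ℤ) = 0 := by
  have : nv (0 : Fin n → ℤ) ≤ 0 := nv_le.2 (by simp)
  omega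

lemma nv_eq_zero {v : Fin n → ℤ} : nv v = 0 ↔ v = 0 := by
  constructor
  · intro h
    ext t
    have := natAbs_le_nv v t
    simp; omega
  · rintro rfl; exact nv_zero

lemma nv_pos {v : Fin n → ℤ} (h : v ≠ 0) : 0 < nv v := by
  rcases Nat.eq_zero_or_pos (nv v) with h' | h'
  · exact absurd (nv_eq_zero.1 h') h
  · exact h'

lemma nv_neg (v : Fin n → ℤ) : nv (-v) = nv v := by simp [nv]

lemma nv_sub_comm (v w : Fin n → ℤ) : nv (v - w) = nv (w - v) := by
  rw [← nv_neg, neg_sub]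

lemma nv_add_le (v w : Fin n → ℤ) : nv (v + w) ≤ nv v + nv w := by
  rw [nv_le]; intro t
  have h1 := natAbs_le_nv v t
  have h2 := natAbs_le_nv w t
  simp only [Pi.add_apply]
  omega

lemma nv_sub_le (u v w : Fin n → ℤ) : nv (u - w) ≤ nv (u - v) + nv (v - w) := by
  have := nv_add_le (u - v) (v - w)
  simpa using this

def par (q : Fin n → ℤ) : Fin n → ℤ := fun t => q t / 2
def child (q : Fin n → ℤ) (e : Fin n → Fin 2) : Fin n → ℤ := fun t => 2 * q t + ((e t).val : ℤ)
def bit (q : Fin n → ℤ) : Fin n → Fin 2 := fun t => ⟨(q t % 2).toNat, by omega⟩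

lemma fin2_lt (e : Fin 2) : ((e.val : ℕ) : ℤ) < 2 := by have := e.2; omega

@[simp] lemma par_child (q : Fin n → ℤ) (e : Fin n → Fin 2) : par (child q e) = q := by
  ext t; simp only [par, child]; have := (e t).2; omega

@[simp] lemma bit_child (q : Fin n → ℤ) (e : Fin n → Fin 2) : bit (child q e) = e := by
  ext t; simp only [bit, child]; have := (e t).2; omega

@[simp] lemma child_par_bit (q : Fin n → ℤ) : child (par q) (bit q) = q := by
  ext t; simp only [bit, child, par]; omega

def Bx (n m : ℕ) : Finset (Fin n → ℤ) := Fintype.piFinset fun _ => Finset.Ico (-2 ^ m) (2 ^ m)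

lemma mem_Bx {m : ℕ} {q : Fin n → ℤ} : q ∈ Bx n m ↔ ∀ t, -2 ^ m ≤ q t ∧ q t < 2 ^ m := by
  simp [Bx]

lemma child_mem {m : ℕ} {q : Fin n → ℤ} {e : Fin n → Fin 2} :
    child q e ∈ Bx n (m + 1) ↔ q ∈ Bx n m := by
  simp only [mem_Bx, child]
  refine forall_congr' fun t => ?_
  have := (e t).2
  rw [pow_succ]
  omega

lemma par_mem {m : ℕ} {q : Fin n → ℤ} : par q ∈ Bx n m ↔ q ∈ Bx n (m + 1) := by
  conv_rhs => rw [← child_par_bit q]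
  exact child_mem.symm

lemma sum_children {M : Type*} [AddCommMonoid M] (m : ℕ) (F : (Fin n → ℤ) → M) :
    ∑ q ∈ Bx n (m + 1), F q = ∑ p ∈ Bx n m, ∑ e, F (child p e) := by
  rw [← Finset.sum_product']
  refine Finset.sum_nbij' (fun q => (par q, bit q)) (fun x => child x.1 x.2) ?_ ?_ ?_ ?_ ?_
  · intro q hq; simp [par_mem, hq]
  · rintro ⟨p, e⟩ h; simp at h; exact child_mem.2 h
  · intro q _; simp
  · rintro ⟨p, e⟩ _; simp
  · intro q _; simp

def Cube (k : ℕ) (q : Fin n → ℤ) : Finset (Fin n → ℤ) :=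
  Fintype.piFinset fun t => Finset.Ico (2 ^ k * q t) (2 ^ k * q t + 2 ^ k)

lemma mem_Cube {k : ℕ} {q i : Fin n → ℤ} :
    i ∈ Cube k q ↔ ∀ t, 2 ^ k * q t ≤ i t ∧ i t < 2 ^ k * q t + 2 ^ k := by
  simp [Cube]

lemma card_Cube (k : ℕ) (q : Fin n → ℤ) : (Cube k q).card = 2 ^ (k * n) := by
  simp [Cube, Fintype.card_piFinset, pow_mul]
  norm_cast

lemma Cube_zero (q : Fin n → ℤ) : Cube 0 q = {q} := by
  ext i
  simp only [mem_Cube, Finset.mem_singleton]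
  constructor
  · intro h; ext t; have := h t; simp at this; omega
  · rintro rfl t; simp

lemma sum_Cube {M : Type*} [AddCommMonoid M] (k : ℕ) (q : Fin n → ℤ) (F : (Fin n → ℤ) → M) :
    ∑ i ∈ Cube (k + 1) q, F i = ∑ e, ∑ i ∈ Cube k (child q e), F i := by
  classical
  rw [← Finset.sum_fiberwise (s := Cube (k + 1) q)
    (g := fun i t => (if i t < 2 ^ (k + 1) * q t + 2 ^ k then 0 else 1 : Fin 2))]
  refine Finset.sum_congr rfl fun e _ => Finset.sum_congr ?_ fun _ _ => rfl
  ext i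
  simp only [Finset.mem_filter, mem_Cube, child, funext_iff]
  rw [← forall_and]
  refine forall_congr' fun t => ?_
  have h1 : (2 : ℤ) ^ (k + 1) * q t = 2 * (2 ^ k * q t) := by ring
  have h2 : (2 : ℤ) ^ k * (2 * q t + ((e t).val : ℤ)) = 2 * (2 ^ k * q t) + 2 ^ k * ((e t).val : ℤ) := by
    ring
  have h3 : (2 : ℤ) ^ (k + 1) = 2 * 2 ^ k := by ring
  rw [h1, h2, h3]
  have hp : (0 : ℤ) < 2 ^ k := by positivity
  generalize (2 : ℤ) ^ k = L at *
  generalize L * q t = y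
  rcases Fin.exists_fin_two.1 ⟨e t, rfl⟩ with h | h <;> rw [h] <;> split_ifs <;> simp <;> omega

lemma sum_Bx_Cube {M : Type*} [AddCommMonoid M] (k : ℕ) : ∀ (m : ℕ) (F : (Fin n → ℤ) → M),
    ∑ q ∈ Bx n m, ∑ i ∈ Cube k q, F i = ∑ i ∈ Bx n (m + k), F i := by
  induction k with
  | zero => intro m F; simp [Cube_zero]
  | succ k ih =>
    intro m F
    simp_rw [sum_Cube]
    rw [← sum_children m (fun q => ∑ i ∈ Cube k q, F i), ih]
    congr 2; omega

lemma Cube_subset {m k : ℕ} {q : Fin n → ℤ} (hq : q ∈ Bx n m) : Cube k q ⊆ Bx n (m + k) := by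
  intro i hi
  rw [mem_Cube] at hi; rw [mem_Bx] at hq ⊢
  intro t
  have h1 := hi t; have h2 := hq t
  have hp : (0 : ℤ) < 2 ^ k := by positivity
  rw [pow_add]
  constructor <;> nlinarith

lemma Cube_disj {m k : ℕ} {q : Fin n → ℤ} (hq : q ∉ Bx n m) {i} (hi : i ∈ Cube k q) :
    i ∉ Bx n (m + k) := by
  rw [mem_Cube] at hi
  intro hB
  apply hq
  rw [mem_Bx] at hB ⊢
  intro t
  have h1 := hi t; have h2 := hB t
  have hp : (0 : ℤ) < 2 ^ k := by positivity
  rw [pow_add] at h2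
  constructor <;> by_contra h <;> push Not at h <;> nlinarith

/-- averages over dyadic cubes -/
def av (k : ℕ) (f : (Fin n → ℤ) → ℂ) (q : Fin n → ℤ) : ℂ :=
  ((2 : ℂ) ^ (k * n))⁻¹ * ∑ i ∈ Cube k q, f i

lemma av_zero (f : (Fin n → ℤ) → ℂ) (q : Fin n → ℤ) : av 0 f q = f q := by
  simp [av, Cube_zero]

lemma av_succ (k : ℕ) (f : (Fin n → ℤ) → ℂ) (q : Fin n → ℤ) :
    av (k + 1) f q = ((2 : ℂ) ^ n)⁻¹ * ∑ e, av k f (child q e) := by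
  simp only [av, sum_Cube, ← Finset.mul_sum]
  rw [← mul_assoc]; congr 1
  rw [add_mul, pow_add, mul_inv, one_mul, mul_comm]

lemma sum_child_av (k : ℕ) (f : (Fin n → ℤ) → ℂ) (q : Fin n → ℤ) :
    ∑ e, av k f (child q e) = (2 : ℂ) ^ n * av (k + 1) f q := by
  rw [av_succ, mul_inv_cancel_left₀ (pow_ne_zero _ two_ne_zero)]

lemma av_outside {m k : ℕ} {f : (Fin n → ℤ) → ℂ} (hf : ∀ i, i ∉ Bx n (m + k) → f i = 0)
    {q : Fin n → ℤ} (hq : q ∉ Bx n m) : av k f q = 0 := by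
  rw [av, Finset.sum_eq_zero, mul_zero]
  intro i hi; exact hf i (Cube_disj hq hi)

/-- martingale difference -/
def dd (k : ℕ) (f : (Fin n → ℤ) → ℂ) (q : Fin n → ℤ) : ℂ := av k f q - av (k + 1) f (par q)

lemma sum_child_dd (k : ℕ) (f : (Fin n → ℤ) → ℂ) (q : Fin n → ℤ) :
    ∑ e, dd k f (child q e) = 0 := by
  simp [dd, sum_child_av]

lemma pythag {ι : Type*} (s : Finset ι) (x : ι → ℂ) (m : ℂ) (c : ℝ) (hc : (s.card : ℝ) = c)
    (hm : ∑ e ∈ s, x e = (c : ℂ) * m) :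
    ∑ e ∈ s, ‖x e - m‖ ^ 2 = ∑ e ∈ s, ‖x e‖ ^ 2 - c * ‖m‖ ^ 2 := by
  have h1 : ∀ e, ‖x e - m‖ ^ 2 = ‖x e‖ ^ 2 - 2 * (x e * (starRingEnd ℂ) m).re + ‖m‖ ^ 2 := by
    intro e
    rw [← Complex.normSq_eq_norm_sq, ← Complex.normSq_eq_norm_sq, ← Complex.normSq_eq_norm_sq,
      Complex.normSq_sub]; ring
  simp_rw [h1]
  rw [Finset.sum_add_distrib, Finset.sum_sub_distrib, ← Finset.mul_sum, ← Complex.re_sum,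
    ← Finset.sum_mul, hm, mul_assoc, Complex.mul_conj, Complex.normSq_eq_norm_sq]
  simp only [Finset.sum_const, nsmul_eq_mul, hc]
  rw [← Complex.ofReal_mul, Complex.ofReal_re]; ring

lemma card_bits : (Finset.univ : Finset (Fin n → Fin 2)).card = 2 ^ n := by simp

lemma pythag_child (k : ℕ) (f : (Fin n → ℤ) → ℂ) (q : Fin n → ℤ) :
    ∑ e, ‖dd k f (child q e)‖ ^ 2 =
      ∑ e, ‖av k f (child q e)‖ ^ 2 - 2 ^ n * ‖av (k + 1) f q‖ ^ 2 := by
  simp only [dd, par_child]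
  apply pythag
  · simp
  · rw [sum_child_av]; push_cast; rfl

/-- energy at level `k` in box of size `2^m` -/
def en (m k : ℕ) (f : (Fin n → ℤ) → ℂ) : ℝ := 2 ^ (k * n) * ∑ q ∈ Bx n m, ‖av k f q‖ ^ 2
def de (m k : ℕ) (f : (Fin n → ℤ) → ℂ) : ℝ := 2 ^ (k * n) * ∑ q ∈ Bx n m, ‖dd k f q‖ ^ 2

lemma en_nonneg (m k : ℕ) (f : (Fin n → ℤ) → ℂ) : 0 ≤ en m k f := by unfold en; positivity
lemma de_nonneg (m k : ℕ) (f : (Fin n → ℤ) → ℂ) : 0 ≤ de m k f := by unfold de; positivity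

lemma de_eq (m k : ℕ) (f : (Fin n → ℤ) → ℂ) :
    de (m + 1) k f = en (m + 1) k f - en m (k + 1) f := by
  unfold de en
  rw [sum_children, sum_children]
  simp_rw [pythag_child]
  rw [Finset.sum_sub_distrib, ← Finset.mul_sum]
  ring

lemma sum_de (N : ℕ) (f : (Fin n → ℤ) → ℂ) : ∀ K ≤ N,
    ∑ k ∈ Finset.range K, de (N - k) k f = en N 0 f - en (N - K) K f := by
  intro K
  induction K with
  | zero => simp
  | succ K ih =>
    intro h
    rw [Finset.sum_range_succ, ih (by omega)]
    obtain ⟨m, rfl⟩ : ∃ m, N = m + 1 + K := ⟨N - 1 - K, by omega⟩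
    have h1 : m + 1 + K - K = m + 1 := by omega
    have h2 : m + 1 + K - (K + 1) = m := by omega
    rw [h1, h2, de_eq]; ring

lemma en_zero (N : ℕ) (f : (Fin n → ℤ) → ℂ) : en N 0 f = ∑ i ∈ Bx n N, ‖f i‖ ^ 2 := by
  simp [en, av_zero]

lemma sum_de_le (N : ℕ) (f : (Fin n → ℤ) → ℂ) :
    ∑ k ∈ Finset.range N, de (N - k) k f ≤ ∑ i ∈ Bx n N, ‖f i‖ ^ 2 := by
  rw [sum_de N f N le_rfl, ← en_zero]
  linarith [en_nonneg (N - N) N f]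

lemma en_top_le (N : ℕ) (f : (Fin n → ℤ) → ℂ) :
    en 0 N f ≤ ∑ i ∈ Bx n N, ‖f i‖ ^ 2 := by
  have h := sum_de N f N le_rfl
  rw [← en_zero]
  have h2 : 0 ≤ ∑ k ∈ Finset.range N, de (N - k) k f := Finset.sum_nonneg fun _ _ => de_nonneg _ _ _
  simp at h
  linarith

end T1

namespace T1

variable {n : ℕ}

lemma shift_sum (m : ℕ) (g : (Fin n → ℤ) → ℝ) (hg : ∀ q, 0 ≤ g q)
    (h0 : ∀ q, q ∉ Bx n m → g q = 0) (v : Fin n → ℤ) :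
    ∑ q ∈ Bx n m, g (q + v) ≤ ∑ q ∈ Bx n m, g q := by
  classical
  have h1 : ∑ q ∈ Bx n m, g (q + v) = ∑ q ∈ (Bx n m).map (addRightEmbedding v), g q := by
    simp
  rw [h1, ← Finset.sum_filter_add_sum_filter_not _ (fun q => q ∈ Bx n m)]
  rw [Finset.sum_eq_zero (s := Finset.filter (fun q => ¬ q ∈ Bx n m) _), add_zero]
  · apply Finset.sum_le_sum_of_subset_of_nonneg
    · intro q hq; exact (Finset.mem_filter.1 hq).2
    · intro q _ _; exact hg q
  · intro q hq; exact h0 q (Finset.mem_filter.1 hq).2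

def X (m k : ℕ) (v : Fin n → ℤ) (f : (Fin n → ℤ) → ℂ) : ℝ :=
  2 ^ (k * n) * ∑ q ∈ Bx n m, ‖av k f (q + v) - av k f q‖ ^ 2

lemma X_nonneg (m k : ℕ) (v : Fin n → ℤ) (f : (Fin n → ℤ) → ℂ) : 0 ≤ X m k v f := by
  unfold X; positivity

def mv (v : Fin n → ℤ) (e : Fin n → Fin 2) : Fin n → ℤ := fun t => (((e t).val : ℤ) + v t) / 2

lemma par_child_add (p v : Fin n → ℤ) (e : Fin n → Fin 2) : par (child p e + v) = p + mv v e := by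
  ext t; simp only [par, child, mv, Pi.add_apply]; omega

lemma norm_add_sq_le' (a b : ℂ) (θ : ℝ) (hθ : 0 < θ) :
    ‖a + b‖ ^ 2 ≤ (1 + θ) * ‖a‖ ^ 2 + (1 + 1 / θ) * ‖b‖ ^ 2 := by
  have h := norm_add_le a b
  have h2 : ‖a + b‖ ^ 2 ≤ (‖a‖ + ‖b‖) ^ 2 := by gcongr
  have h3 : 2 * ‖a‖ * ‖b‖ ≤ θ * ‖a‖ ^ 2 + 1 / θ * ‖b‖ ^ 2 := by
    have : θ * ‖a‖ ^ 2 + 1 / θ * ‖b‖ ^ 2 - 2 * ‖a‖ * ‖b‖ = (1 / θ) * (θ * ‖a‖ - ‖b‖) ^ 2 := by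
      field_simp; ring
    have h4 : 0 ≤ (1 / θ) * (θ * ‖a‖ - ‖b‖) ^ 2 := by positivity
    linarith
  nlinarith

lemma norm_sub_sq_le2 (a b : ℂ) : ‖a - b‖ ^ 2 ≤ 2 * ‖a‖ ^ 2 + 2 * ‖b‖ ^ 2 := by
  have := norm_add_sq_le' a (-b) 1 one_pos
  rw [norm_neg] at this
  rw [sub_eq_add_neg]; linarith

lemma X_le_en (m k : ℕ) (v : Fin n → ℤ) (f : (Fin n → ℤ) → ℂ)
    (hf : ∀ i, i ∉ Bx n (m + k) → f i = 0) : X m k v f ≤ 4 * en m k f := by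
  unfold X en
  have h1 : ∑ q ∈ Bx n m, ‖av k f (q + v) - av k f q‖ ^ 2 ≤
      ∑ q ∈ Bx n m, (2 * ‖av k f (q + v)‖ ^ 2 + 2 * ‖av k f q‖ ^ 2) :=
    Finset.sum_le_sum fun q _ => norm_sub_sq_le2 _ _
  have h2 := shift_sum m (fun q => ‖av k f q‖ ^ 2) (fun q => by positivity)
    (fun q hq => by simp [av_outside hf hq]) v
  rw [Finset.sum_add_distrib, ← Finset.mul_sum, ← Finset.mul_sum] at h1
  have h3 : ∑ q ∈ Bx n m, ‖av k f (q + v) - av k f q‖ ^ 2 ≤ 4 * ∑ q ∈ Bx n m, ‖av k f q‖ ^ 2 := by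
    linarith
  have : (0:ℝ) < 2 ^ (k * n) := by positivity
  nlinarith

lemma dd_outside {m k : ℕ} {f : (Fin n → ℤ) → ℂ} (hf : ∀ i, i ∉ Bx n (m + 1 + k) → f i = 0)
    {q : Fin n → ℤ} (hq : q ∉ Bx n (m + 1)) : dd k f q = 0 := by
  rw [dd, av_outside hf hq, av_outside (m := m), sub_zero]
  · intro i hi; exact hf i (by rwa [show m + 1 + k = m + (k + 1) by omega])
  · rwa [par_mem]

lemma X_step (m k : ℕ) (v : Fin n → ℤ) (f : (Fin n → ℤ) → ℂ)
    (hf : ∀ i, i ∉ Bx n (m + 1 + k) → f i = 0) (θ : ℝ) (hθ : 0 < θ) :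
    X (m + 1) k v f ≤ (1 + θ) * (((2 : ℝ) ^ n)⁻¹ * ∑ e, X m (k + 1) (mv v e) f)
      + (1 + 1 / θ) * 4 * de (m + 1) k f := by
  have hsplit : ∀ q, ‖av k f (q + v) - av k f q‖ ^ 2 ≤
      (1 + θ) * ‖av (k + 1) f (par (q + v)) - av (k + 1) f (par q)‖ ^ 2 +
      (1 + 1 / θ) * (2 * ‖dd k f (q + v)‖ ^ 2 + 2 * ‖dd k f q‖ ^ 2) := by
    intro q
    have h1 : av k f (q + v) - av k f q = (av (k + 1) f (par (q + v)) - av (k + 1) f (par q)) +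
        (dd k f (q + v) - dd k f q) := by simp only [dd]; ring
    rw [h1]
    refine (norm_add_sq_le' _ _ θ hθ).trans ?_
    gcongr
    exact norm_sub_sq_le2 _ _
  have h1 := Finset.sum_le_sum fun q (_ : q ∈ Bx n (m + 1)) => hsplit q
  rw [Finset.sum_add_distrib, ← Finset.mul_sum, ← Finset.mul_sum, Finset.sum_add_distrib,
    ← Finset.mul_sum, ← Finset.mul_sum] at h1
  have h2 := shift_sum (m + 1) (fun q => ‖dd k f q‖ ^ 2) (fun q => by positivity)
    (fun q hq => by simp [dd_outside hf hq]) v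
  rw [sum_children (F := fun q => ‖av (k + 1) f (par (q + v)) - av (k + 1) f (par q)‖ ^ 2)] at h1
  simp only [par_child, par_child_add] at h1
  rw [Finset.sum_comm] at h1
  unfold X de
  simp only [← Finset.mul_sum]
  set P := ∑ e, ∑ p ∈ Bx n m, ‖av (k + 1) f (p + mv v e) - av (k + 1) f p‖ ^ 2
  have hp : ((2 : ℝ) ^ n)⁻¹ * (2 ^ ((k + 1) * n) * P) = 2 ^ (k * n) * P := by
    rw [add_mul, pow_add, one_mul]; field_simp
  rw [hp]
  have hpos : (0:ℝ) < 2 ^ (k * n) := by positivity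
  have hθ' : 0 < 1 + 1 / θ := by positivity
  set D := ∑ q ∈ Bx n (m + 1), ‖dd k f q‖ ^ 2
  calc _ ≤ 2 ^ (k * n) * ((1 + θ) * P + (1 + 1 / θ) * (4 * D)) := by
        gcongr
        refine h1.trans ?_
        gcongr
        linarith
    _ = _ := by ring

lemma mv_le {v : Fin n → ℤ} {s : ℕ} (hv : nv v ≤ 2 ^ (s + 1)) (e : Fin n → Fin 2) :
    nv (mv v e) ≤ 2 ^ s := by
  rw [nv_le] at hv ⊢
  intro t; have := hv t; have := (e t).2
  rw [pow_succ] at *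
  have : 0 < 2 ^ s := by positivity
  simp only [mv]
  generalize 2 ^ s = L at *
  omega

lemma mv_le_one {v : Fin n → ℤ} (hv : nv v ≤ 1) (e : Fin n → Fin 2) : nv (mv v e) ≤ 1 := by
  rw [nv_le] at hv ⊢
  intro t; have := hv t; have := (e t).2
  simp only [mv]
  omega

lemma mv_exists_zero {v : Fin n → ℤ} (hv : nv v ≤ 1) : ∃ e, mv v e = 0 := by
  rw [nv_le] at hv
  refine ⟨fun t => if v t < 0 then 1 else 0, ?_⟩
  ext t
  have := hv t
  simp only [mv]
  split_ifs <;> simp <;> omega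

lemma X_zero (m k : ℕ) (f : (Fin n → ℤ) → ℂ) : X m k 0 f = 0 := by simp [X]

def zz (ρ C E : ℝ) (δ : ℕ → ℝ) : ℕ → ℕ → ℝ
  | _, 0 => 4 * E
  | 0, m + 1 => ρ * zz ρ C E δ 0 m + C * δ m
  | s + 1, m + 1 => 3 / 2 * zz ρ C E δ s m + 12 * δ m

lemma zz_nonneg {ρ C E : ℝ} {δ : ℕ → ℝ} (hρ : 0 ≤ ρ) (hC : 0 ≤ C) (hE : 0 ≤ E)
    (hδ : ∀ m, 0 ≤ δ m) : ∀ s m, 0 ≤ zz ρ C E δ s m := by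
  intro s
  induction s with
  | zero =>
    intro m
    induction m with
    | zero => simp [zz, hE]
    | succ m ih => have := hδ m; simp only [zz]; positivity
  | succ s ih =>
    intro m
    cases m with
    | zero => simp [zz, hE]
    | succ m => have := hδ m; have := ih m; simp only [zz]; positivity

lemma zz_sum {ρ C E : ℝ} {δ : ℕ → ℝ} (hρ : 0 ≤ ρ) (hρ1 : ρ < 1) (hC : 0 ≤ C) (hE : 0 ≤ E)
    (hδ : ∀ m, 0 ≤ δ m) (N : ℕ) (hsum : ∑ m ∈ Finset.range N, δ m ≤ E) :
    ∀ s, ∑ m ∈ Finset.range (N + 1), zz ρ C E δ s m ≤ ((4 + C) / (1 - ρ) + 32) * (3 / 2) ^ s * E - 32 * E := by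
  have hz := zz_nonneg hρ hC hE hδ
  intro s
  induction s with
  | zero =>
    have h1 := Finset.sum_range_succ' (zz ρ C E δ 0) N
    have h2 := Finset.sum_range_succ (zz ρ C E δ 0) N
    simp only [zz, Finset.sum_add_distrib, ← Finset.mul_sum] at h1
    set Z := ∑ m ∈ Finset.range (N + 1), zz ρ C E δ 0 m
    set Z' := ∑ m ∈ Finset.range N, zz ρ C E δ 0 m
    have h3 : Z' ≤ Z := by rw [h2]; linarith [hz 0 N]
    have h4 : Z * (1 - ρ) ≤ (4 + C) * E := by nlinarith
    have h5 : Z ≤ (4 + C) * E / (1 - ρ) := by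
      rw [le_div_iff₀ (by linarith)]; exact h4
    calc Z ≤ (4 + C) * E / (1 - ρ) := h5
      _ = _ := by ring
  | succ s ih =>
    have h1 := Finset.sum_range_succ' (zz ρ C E δ (s + 1)) N
    have h2 := Finset.sum_range_succ (zz ρ C E δ s) N
    simp only [zz, Finset.sum_add_distrib, ← Finset.mul_sum] at h1
    rw [h1, pow_succ]
    have := hz s N
    nlinarith

lemma X_le_zz (n N : ℕ) (f : (Fin n → ℤ) → ℂ) (hf : ∀ i, i ∉ Bx n N → f i = 0) :
    ∀ s m k, m + k = N → ∀ v : Fin n → ℤ, nv v ≤ 2 ^ s →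
    X m k v f ≤ zz (1 - (4 ^ n : ℝ)⁻¹) ((1 + 2 ^ n) * 4) (∑ i ∈ Bx n N, ‖f i‖ ^ 2)
      (fun m => de (m + 1) (N - (m + 1)) f) s m := by
  intro s
  have h4 : (1:ℝ) ≤ 4 ^ n := one_le_pow₀ (by norm_num)
  have h4' : (4 ^ n : ℝ)⁻¹ ≤ 1 := inv_le_one_of_one_le₀ h4
  have hbase : ∀ k, 0 + k = N → ∀ v : Fin n → ℤ, X 0 k v f ≤ 4 * ∑ i ∈ Bx n N, ‖f i‖ ^ 2 := by
    intro k hk v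
    simp only [zero_add] at hk
    subst hk
    refine (X_le_en 0 k v f (by simpa using hf)).trans ?_
    linarith [en_top_le k f]
  induction s with
  | zero =>
    intro m
    induction m with
    | zero =>
      intro k hk v _
      simpa [zz] using hbase k hk v
    | succ m ih =>
      intro k hk v hv
      simp only [pow_zero] at hv ih
      subst hk
      have hst := X_step m k v f hf ((2 ^ n : ℝ)⁻¹) (by positivity)
      have hk' : m + 1 + k - (m + 1) = k := by omega
      simp only [zz]
      rw [hk']
      set z := zz (1 - (4 ^ n : ℝ)⁻¹) ((1 + 2 ^ n) * 4) (∑ i ∈ Bx n (m + 1 + k), ‖f i‖ ^ 2)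
        (fun m_1 => de (m_1 + 1) (m + 1 + k - (m_1 + 1)) f) 0 m with hzdef
      have hb : ∀ e, X m (k + 1) (mv v e) f ≤ z := fun e =>
        ih (k + 1) (by omega) _ (mv_le_one hv e)
      obtain ⟨e0, he0⟩ := mv_exists_zero hv
      have hsum : ∑ e, X m (k + 1) (mv v e) f ≤ (2 ^ n - 1) * z := by
        rw [← Finset.add_sum_erase _ _ (Finset.mem_univ e0), he0, X_zero, zero_add]
        refine (Finset.sum_le_card_nsmul _ _ z fun e _ => hb e).trans ?_
        rw [Finset.card_erase_of_mem (Finset.mem_univ e0), card_bits, nsmul_eq_mul,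
          Nat.cast_sub Nat.one_le_two_pow]
        simp
      refine hst.trans ?_
      have e1 : (1 : ℝ) + 1 / (2 ^ n)⁻¹ = 1 + 2 ^ n := by simp
      rw [e1]
      have hp : (0:ℝ) < 2 ^ n := by positivity
      have h42 : (4:ℝ) ^ n = 2 ^ n * 2 ^ n := by rw [← mul_pow]; norm_num
      have : (1 + (2 ^ n : ℝ)⁻¹) * ((2 ^ n)⁻¹ * ∑ e, X m (k + 1) (mv v e) f) ≤
          (1 - (4 ^ n : ℝ)⁻¹) * z := by
        calc _ ≤ (1 + (2 ^ n : ℝ)⁻¹) * ((2 ^ n)⁻¹ * ((2 ^ n - 1) * z)) := by gcongr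
          _ = _ := by rw [h42]; field_simp; ring
      linarith
  | succ s ihs =>
    intro m k hk v hv
    cases m with
    | zero => simpa [zz] using hbase k hk v
    | succ m =>
      subst hk
      have hst := X_step m k v f hf (1 / 2) (by positivity)
      have hk' : m + 1 + k - (m + 1) = k := by omega
      simp only [zz]
      rw [hk']
      set z := zz (1 - (4 ^ n : ℝ)⁻¹) ((1 + 2 ^ n) * 4) (∑ i ∈ Bx n (m + 1 + k), ‖f i‖ ^ 2)
        (fun m_1 => de (m_1 + 1) (m + 1 + k - (m_1 + 1)) f) s m with hzdef
      have hb : ∀ e, X m (k + 1) (mv v e) f ≤ z := fun e =>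
        ihs m (k + 1) (by omega) _ (mv_le hv e)
      have hsum : ∑ e, X m (k + 1) (mv v e) f ≤ 2 ^ n * z := by
        refine (Finset.sum_le_card_nsmul _ _ z fun e _ => hb e).trans ?_
        simp
      have hp : (0:ℝ) < 2 ^ n := by positivity
      have : (2 ^ n : ℝ)⁻¹ * ∑ e, X m (k + 1) (mv v e) f ≤ z := by
        rw [inv_mul_le_iff₀ hp]; exact hsum
      norm_num at hst
      linarith

/-- square function estimate for differences of shifted averages -/
lemma shift_bound (n : ℕ) : ∃ C : ℝ, 0 < C ∧ ∀ (N : ℕ) (f : (Fin n → ℤ) → ℂ),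
    (∀ i, i ∉ Bx n N → f i = 0) → ∀ s (v : Fin n → ℤ), nv v ≤ 2 ^ s →
    ∑ k ∈ Finset.range N, X (N - k) k v f ≤ C * (3 / 2) ^ s * ∑ i ∈ Bx n N, ‖f i‖ ^ 2 := by
  have h4 : (1:ℝ) ≤ 4 ^ n := one_le_pow₀ (by norm_num)
  have h4' : (4 ^ n : ℝ)⁻¹ ≤ 1 := inv_le_one_of_one_le₀ h4
  have h4'' : 0 < (4 ^ n : ℝ)⁻¹ := by positivity
  refine ⟨(4 + (1 + 2 ^ n) * 4) / (1 - (1 - (4 ^ n : ℝ)⁻¹)) + 32, ?_, ?_⟩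
  · have : 0 < (1 - (1 - (4 ^ n : ℝ)⁻¹)) := by linarith
    positivity
  intro N f hf s v hv
  set E := ∑ i ∈ Bx n N, ‖f i‖ ^ 2 with hE
  have hE0 : 0 ≤ E := by positivity
  have hd : ∑ m ∈ Finset.range N, de (m + 1) (N - (m + 1)) f ≤ E := by
    refine le_trans (le_of_eq ?_) (sum_de_le N f)
    rw [← Finset.sum_range_reflect]
    refine Finset.sum_congr rfl fun k hk => ?_
    have := Finset.mem_range.1 hk
    rw [show N - 1 - k + 1 = N - k by omega, show N - (N - k) = k by omega]
  have hz := zz_sum (ρ := 1 - (4 ^ n : ℝ)⁻¹) (C := (1 + 2 ^ n) * 4) (E := E)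
    (δ := fun m => de (m + 1) (N - (m + 1)) f)
    (by linarith) (by linarith) (by positivity) hE0 (fun m => de_nonneg _ _ _) N hd s
  have hzn := zz_nonneg (ρ := 1 - (4 ^ n : ℝ)⁻¹) (C := (1 + 2 ^ n) * 4) (E := E)
    (δ := fun m => de (m + 1) (N - (m + 1)) f)
    (by linarith) (by positivity) hE0 (fun m => de_nonneg _ _ _) s 0
  rw [Finset.sum_range_succ'] at hz
  have : ∑ k ∈ Finset.range N, X (N - k) k v f ≤ ∑ m ∈ Finset.range N,
      zz (1 - (4 ^ n : ℝ)⁻¹) ((1 + 2 ^ n) * 4) E (fun m => de (m + 1) (N - (m + 1)) f) s (m + 1) := by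
    rw [← Finset.sum_range_reflect]
    refine Finset.sum_le_sum fun m hm => ?_
    have := Finset.mem_range.1 hm
    rw [show N - (N - 1 - m) = m + 1 by omega]
    exact X_le_zz n N f hf s (m + 1) (N - 1 - m) (by omega) v hv
  linarith

/-! dyadic shells -/
def sh (v : Fin n → ℤ) : ℕ := Nat.log 2 (nv v)

lemma nv_lt_sh (v : Fin n → ℤ) : nv v < 2 ^ (sh v + 1) := Nat.lt_pow_succ_log_self (by norm_num) _

lemma sh_le_nv {v : Fin n → ℤ} (hv : v ≠ 0) : 2 ^ sh v ≤ nv v :=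
  Nat.pow_log_le_self 2 (nv_pos hv).ne'

lemma shell_sum (V : Finset (Fin n → ℤ)) (H : ℕ → ℝ) (hH : ∀ s, 0 ≤ H s) (S : ℕ)
    (hS : ∀ v ∈ V, sh v < S) :
    ∑ v ∈ V, H (sh v) ≤ ∑ s ∈ Finset.range S, H s * (5 * 2 ^ s) ^ n := by
  classical
  rw [← Finset.sum_fiberwise_of_maps_to (g := sh) (t := Finset.range S)
    (fun v hv => Finset.mem_range.2 (hS v hv))]
  refine Finset.sum_le_sum fun s _ => ?_
  have h1 : ∑ v ∈ V with sh v = s, H (sh v) = ∑ v ∈ V with sh v = s, H s :=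
    Finset.sum_congr rfl fun v hv => by rw [(Finset.mem_filter.1 hv).2]
  rw [h1, Finset.sum_const, nsmul_eq_mul, mul_comm]
  refine mul_le_mul_of_nonneg_left ?_ (hH s)
  have hsub : (V.filter fun v => sh v = s) ⊆
      Fintype.piFinset fun _ : Fin n => Finset.Icc (-(2 * 2 ^ s : ℤ)) (2 * 2 ^ s) := by
    intro v hv
    have hv2 := (Finset.mem_filter.1 hv).2
    have := nv_lt_sh v
    rw [hv2, pow_succ] at this
    rw [Fintype.mem_piFinset]
    intro t
    have ht := natAbs_le_nv v t
    rw [Finset.mem_Icc]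
    have e : ((2 ^ s : ℕ) : ℤ) = 2 ^ s := by push_cast; rfl
    rw [← e]
    omega
  have hc := Finset.card_le_card hsub
  rw [Fintype.card_piFinset] at hc
  simp only [Int.card_Icc, Finset.prod_const, Finset.card_univ, Fintype.card_fin] at hc
  have h2 : ((2 * 2 ^ s + 1 - -(2 * 2 ^ s) : ℤ)).toNat ≤ 5 * 2 ^ s := by
    have e : ((2 ^ s : ℕ) : ℤ) = 2 ^ s := by push_cast; rfl
    have : 0 < 2 ^ s := by positivity
    rw [← e]; omega
  have h3 := hc.trans (Nat.pow_le_pow_left h2 n)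
  exact_mod_cast h3

lemma exists_sh_bound (V : Finset (Fin n → ℤ)) : ∃ S, ∀ v ∈ V, sh v < S :=
  ⟨V.sup sh + 1, fun v hv => Nat.lt_succ_of_le (Finset.le_sup hv)⟩

/-- the decay weight -/
def wt (v : Fin n → ℤ) : ℝ := (((2:ℝ) ^ sh v) ^ (n + 1))⁻¹

lemma wt_pos (v : Fin n → ℤ) : 0 < wt v := by unfold wt; positivity

lemma geom_le {r : ℝ} (h0 : 0 ≤ r) (h1 : r < 1) (S : ℕ) :
    ∑ s ∈ Finset.range S, r ^ s ≤ 1 / (1 - r) := by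
  rw [one_div, ← tsum_geometric_of_lt_one h0 h1]
  exact (summable_geometric_of_lt_one h0 h1).sum_le_tsum _ (fun _ _ => by positivity)

lemma wt_sum (V : Finset (Fin n → ℤ)) :
    ∑ v ∈ V, wt v * (3 / 2) ^ (sh v + 1) ≤ 6 * 5 ^ n := by
  obtain ⟨S, hS⟩ := exists_sh_bound V
  have h := shell_sum V (fun s => (((2:ℝ) ^ s) ^ (n + 1))⁻¹ * (3 / 2) ^ (s + 1))
    (fun s => by positivity) S hS
  refine h.trans ?_
  have : ∀ s : ℕ, (((2:ℝ) ^ s) ^ (n + 1))⁻¹ * (3 / 2) ^ (s + 1) * (5 * 2 ^ s) ^ n =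
      (3 / 2) * 5 ^ n * (3 / 4) ^ s := by
    intro s
    rw [mul_pow, pow_succ, pow_succ, div_pow, div_pow, show (4:ℝ) = 2 * 2 by norm_num, mul_pow]
    field_simp
  simp_rw [this]
  rw [← Finset.mul_sum]
  have := geom_le (r := 3 / 4) (by norm_num) (by norm_num) S
  norm_num at this
  have h5 : (0:ℝ) < 5 ^ n := by positivity
  nlinarith

lemma wt_sum' (V : Finset (Fin n → ℤ)) : ∑ v ∈ V, wt v ≤ 6 * 5 ^ n := by
  refine (Finset.sum_le_sum fun v _ => ?_).trans (wt_sum V)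
  have := wt_pos v
  have h : (1:ℝ) ≤ (3 / 2) ^ (sh v + 1) := one_le_pow₀ (by norm_num)
  nlinarith

lemma tail_sum (V : Finset (Fin n → ℤ)) (R : ℕ) (hR : 0 < R) (hV : ∀ v ∈ V, R ≤ nv v) :
    ∑ v ∈ V, ((nv v : ℝ) ^ (n + 1))⁻¹ ≤ 4 * 5 ^ n / R := by
  obtain ⟨S, hS⟩ := exists_sh_bound V
  set s0 := Nat.log 2 R with hs0
  have h := shell_sum V (fun s => if s < s0 then 0 else (((2:ℝ) ^ s) ^ (n + 1))⁻¹)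
    (fun s => by split_ifs <;> positivity) S hS
  have h1 : ∑ v ∈ V, ((nv v : ℝ) ^ (n + 1))⁻¹ ≤
      ∑ v ∈ V, (fun s => if s < s0 then 0 else (((2:ℝ) ^ s) ^ (n + 1))⁻¹) (sh v) := by
    refine Finset.sum_le_sum fun v hv => ?_
    have hle : s0 ≤ sh v := Nat.log_mono_right (hV v hv)
    simp only [not_lt.2 hle, if_false]
    have hv0 : v ≠ 0 := by
      rintro rfl; have := hV _ hv; rw [nv_zero] at this; omega
    have : (2:ℝ) ^ sh v ≤ nv v := by exact_mod_cast sh_le_nv hv0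
    gcongr
  refine h1.trans (h.trans ?_)
  have h2 : ∀ s ∈ Finset.range S, (if s < s0 then 0 else (((2:ℝ) ^ s) ^ (n + 1))⁻¹) * (5 * 2 ^ s) ^ n ≤
      if s0 ≤ s then 5 ^ n * (1 / 2) ^ s else 0 := by
    intro s _
    split_ifs with h h' h'
    · omega
    · simp
    · apply le_of_eq
      rw [mul_pow, pow_succ, div_pow, one_pow]
      field_simp
    · omega
  refine (Finset.sum_le_sum h2).trans ?_
  rw [← Finset.sum_filter]
  have h3 : ∑ s ∈ Finset.range S with s0 ≤ s, (5:ℝ) ^ n * (1 / 2) ^ s ≤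
      ∑ s ∈ Finset.range S, (5:ℝ) ^ n * (1 / 2) ^ (s0 + s) := by
    classical
    have : ∑ s ∈ Finset.range S, (5:ℝ) ^ n * (1 / 2) ^ (s0 + s) =
      ∑ s ∈ (Finset.range S).map (addLeftEmbedding s0), (5:ℝ) ^ n * (1 / 2) ^ s := by simp
    rw [this]
    apply Finset.sum_le_sum_of_subset_of_nonneg
    · intro s hs
      simp only [Finset.mem_filter, Finset.mem_range, Finset.mem_map, addLeftEmbedding_apply] at hs ⊢
      exact ⟨s - s0, by omega, by omega⟩
    · intros; positivity
  refine h3.trans ?_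
  simp_rw [pow_add]
  rw [← Finset.mul_sum, ← Finset.mul_sum]
  have hg := geom_le (r := 1 / 2) (by norm_num) (by norm_num) S
  norm_num at hg
  have hRs : (R : ℝ) ≤ 2 * 2 ^ s0 := by
    have : R < 2 ^ (s0 + 1) := Nat.lt_pow_succ_log_self (by norm_num) _
    have h' : (R : ℝ) < 2 ^ (s0 + 1) := by exact_mod_cast this
    rw [pow_succ] at h'; linarith
  have hR' : (0:ℝ) < R := by exact_mod_cast hR
  calc _ ≤ (5:ℝ) ^ n * ((1 / 2) ^ s0 * 2) := by gcongr
    _ = 4 * 5 ^ n / (2 * 2 ^ s0) := by rw [div_pow, one_pow]; field_simp; norm_num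
    _ ≤ _ := by gcongr

lemma near_sum (V : Finset (Fin n → ℤ)) (R : ℕ) (hR : 0 < R) (hV : ∀ v ∈ V, nv v ≤ R)
    (hV0 : ∀ v ∈ V, v ≠ 0) :
    ∑ v ∈ V, (nv v : ℝ) * ((nv v : ℝ) ^ n)⁻¹ ≤ 4 * 5 ^ n * R := by
  set s0 := Nat.log 2 R with hs0
  have h := shell_sum V (fun s => 2 ^ (s + 1) * (((2:ℝ) ^ s) ^ n)⁻¹)
    (fun s => by positivity) (s0 + 1)
    (fun v hv => Nat.lt_succ_of_le (Nat.log_mono_right (hV v hv)))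
  have h1 : ∑ v ∈ V, (nv v : ℝ) * ((nv v : ℝ) ^ n)⁻¹ ≤
      ∑ v ∈ V, (fun s => 2 ^ (s + 1) * (((2:ℝ) ^ s) ^ n)⁻¹) (sh v) := by
    refine Finset.sum_le_sum fun v hv => ?_
    have : (2:ℝ) ^ sh v ≤ nv v := by exact_mod_cast sh_le_nv (hV0 v hv)
    have h2 : (nv v : ℝ) ≤ 2 ^ (sh v + 1) := by exact_mod_cast (nv_lt_sh v).le
    simp only
    gcongr
  refine h1.trans (h.trans ?_)
  have : ∀ s : ℕ, (2:ℝ) ^ (s + 1) * (((2:ℝ) ^ s) ^ n)⁻¹ * (5 * 2 ^ s) ^ n = 2 * 5 ^ n * 2 ^ s := by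
    intro s; rw [mul_pow, pow_succ]; field_simp
  simp_rw [this]
  rw [← Finset.mul_sum, geom_sum_eq (by norm_num)]
  have h3 : (2:ℝ) ^ s0 ≤ R := by exact_mod_cast Nat.pow_log_le_self 2 hR.ne'
  rw [pow_succ]
  have h5 : (0:ℝ) < 5 ^ n := by positivity
  nlinarith

end T1

namespace T1

variable {n : ℕ}

structure CZ (n N : ℕ) (a : (Fin n → ℤ) → (Fin n → ℤ) → ℂ) : Prop where
  supp : ∀ i j, i ∉ Bx n N ∨ j ∉ Bx n N → a i j = 0
  size : ∀ i j, i ≠ j → ‖a i j‖ ≤ ((nv (i - j) : ℝ) ^ n)⁻¹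
  smooth : ∀ i i' j, 0 < nv (i - j) → 4 * n * nv (i - i') ≤ nv (i - j) →
    ‖a i j - a i' j‖ ≤ nv (i - i') * ((nv (i - j) : ℝ) ^ (n + 1))⁻¹
  test : ∀ (L : ℕ), 0 < L → ∀ (i0 : Fin n → ℤ) (c : (Fin n → ℤ) → ℝ), (∀ j, 0 ≤ c j) → (∀ j, c j ≤ 1) →
    (∀ j j', |c j - c j'| ≤ nv (j - j') / L) → (∀ j, 2 * L ≤ nv (j - i0) → c j = 0) →
    ∀ I : Finset (Fin n → ℤ), ∑ i ∈ I, ‖∑ j ∈ Bx n N, a i j * (c j : ℂ)‖ ^ 2 ≤ (L : ℝ) ^ n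

lemma card_1d (y L c : ℤ) :
    ((Finset.Ico y (y + L)).filter fun x => x + c ∉ Finset.Ico y (y + L)).card ≤ c.natAbs := by
  rcases le_or_gt 0 c with h | h
  · have : ((Finset.Ico y (y + L)).filter fun x => x + c ∉ Finset.Ico y (y + L)) ⊆
        Finset.Ico (y + L - c) (y + L) := by
      intro x hx
      simp only [Finset.mem_filter, Finset.mem_Ico] at hx ⊢
      omega
    refine (Finset.card_le_card this).trans ?_
    rw [Int.card_Ico]; omega
  · have : ((Finset.Ico y (y + L)).filter fun x => x + c ∉ Finset.Ico y (y + L)) ⊆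
        Finset.Ico y (y - c) := by
      intro x hx
      simp only [Finset.mem_filter, Finset.mem_Ico] at hx ⊢
      omega
    refine (Finset.card_le_card this).trans ?_
    rw [Int.card_Ico]; omega

lemma card_bdry (k : ℕ) (q v : Fin n → ℤ) :
    (((Cube k q).filter fun i => i + v ∉ Cube k q).card : ℝ) * 2 ^ k ≤ n * nv v * 2 ^ (k * n) := by
  classical
  set S : Fin n → Finset (Fin n → ℤ) := fun t =>
    Fintype.piFinset (Function.update (fun s => Finset.Ico (2 ^ k * q s) (2 ^ k * q s + 2 ^ k)) t
      ((Finset.Ico (2 ^ k * q t) (2 ^ k * q t + 2 ^ k)).filter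
        fun x => x + v t ∉ Finset.Ico (2 ^ k * q t) (2 ^ k * q t + 2 ^ k))) with hS
  have hsub : ((Cube k q).filter fun i => i + v ∉ Cube k q) ⊆ Finset.univ.biUnion S := by
    intro i hi
    obtain ⟨h1, h2⟩ := Finset.mem_filter.1 hi
    have h1' := mem_Cube.1 h1
    rw [mem_Cube] at h2
    push Not at h2
    obtain ⟨t, ht⟩ := h2
    simp only [Finset.mem_biUnion, Finset.mem_univ, true_and]
    refine ⟨t, ?_⟩
    rw [hS]
    simp only [Fintype.mem_piFinset]
    intro s
    by_cases hs : s = t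
    · subst hs
      simp only [Function.update_self, Finset.mem_filter, Finset.mem_Ico]
      refine ⟨h1' s, fun h => ?_⟩
      have := ht h.1
      simp only [Pi.add_apply] at this
      omega
    · rw [Function.update_of_ne hs]
      exact Finset.mem_Ico.2 (h1' s)
  have hcard : ∀ t, ((S t).card : ℝ) * 2 ^ k ≤ nv v * 2 ^ (k * n) := by
    intro t
    have h1 : (S t).card * 2 ^ k ≤ nv v * 2 ^ (k * n) := by
      rw [hS]
      simp only [Fintype.card_piFinset]
      rw [← Finset.mul_prod_erase _ _ (Finset.mem_univ t), Function.update_self]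
      have h2 : ∏ s ∈ Finset.univ.erase t, (Function.update (fun s => Finset.Ico (2 ^ k * q s) (2 ^ k * q s + 2 ^ k)) t
      ((Finset.Ico (2 ^ k * q t) (2 ^ k * q t + 2 ^ k)).filter
        fun x => x + v t ∉ Finset.Ico (2 ^ k * q t) (2 ^ k * q t + 2 ^ k)) s).card =
          ∏ s ∈ Finset.univ.erase t, 2 ^ k := by
        refine Finset.prod_congr rfl fun s hs => ?_
        rw [Function.update_of_ne (Finset.ne_of_mem_erase hs)]
        simp
        norm_cast
      rw [h2]
      have h3 : (∏ s ∈ Finset.univ.erase t, 2 ^ k) * 2 ^ k = 2 ^ (k * n) := by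
        rw [mul_comm, Finset.mul_prod_erase Finset.univ (fun _ => 2 ^ k) (Finset.mem_univ t)]
        simp [pow_mul]
      rw [mul_assoc, h3]
      gcongr
      exact (card_1d _ _ _).trans (natAbs_le_nv v t)
    exact_mod_cast h1
  calc (((Cube k q).filter fun i => i + v ∉ Cube k q).card : ℝ) * 2 ^ k
      ≤ (∑ t, ((S t).card : ℝ)) * 2 ^ k := by
        gcongr
        have := (Finset.card_le_card hsub).trans Finset.card_biUnion_le
        exact_mod_cast this
    _ = ∑ t, ((S t).card : ℝ) * 2 ^ k := by rw [Finset.sum_mul]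
    _ ≤ ∑ _t : Fin n, (nv v : ℝ) * 2 ^ (k * n) := Finset.sum_le_sum fun t _ => hcard t
    _ = _ := by simp; ring

lemma near_pairs {N : ℕ} {a : (Fin n → ℤ) → (Fin n → ℤ) → ℂ} (ha : CZ n N a) (k : ℕ)
    (q : Fin n → ℤ) (J : Finset (Fin n → ℤ)) (D : ℕ) (hD : 0 < D) (hJ : ∀ j ∈ J, j ∉ Cube k q)
    (hJD : ∀ j ∈ J, ∀ i ∈ Cube k q, nv (j - i) ≤ D * 2 ^ k) :
    ∑ i ∈ Cube k q, ∑ j ∈ J, ‖a i j‖ ≤ n * (4 * 5 ^ n * D) * 2 ^ (k * n) := by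
  classical
  set V := (Cube k q ×ˢ J).image (fun x => x.2 - x.1) with hV
  have h1 : ∑ i ∈ Cube k q, ∑ j ∈ J, ‖a i j‖ ≤
      ∑ x ∈ Cube k q ×ˢ J, ((nv (x.2 - x.1) : ℝ) ^ n)⁻¹ := by
    rw [Finset.sum_product]
    refine Finset.sum_le_sum fun i hi => Finset.sum_le_sum fun j hj => ?_
    have hij : i ≠ j := by rintro rfl; exact hJ _ hj hi
    have := ha.size i j hij
    rwa [nv_sub_comm] at this
  refine h1.trans ?_
  rw [← Finset.sum_fiberwise_of_maps_to (g := fun x => x.2 - x.1) (t := V)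
    (fun x hx => Finset.mem_image_of_mem _ hx)]
  have hVprop : ∀ v ∈ V, nv v ≤ D * 2 ^ k ∧ v ≠ 0 := by
    intro v hv
    obtain ⟨x, hx, rfl⟩ := Finset.mem_image.1 hv
    obtain ⟨hx1, hx2⟩ := Finset.mem_product.1 hx
    refine ⟨hJD _ hx2 _ hx1, fun h => ?_⟩
    have : x.2 = x.1 := sub_eq_zero.1 h
    exact hJ _ hx2 (this ▸ hx1)
  have h2 : ∀ v ∈ V, ∑ x ∈ Cube k q ×ˢ J with x.2 - x.1 = v, ((nv (x.2 - x.1) : ℝ) ^ n)⁻¹ ≤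
      (n * 2 ^ (k * n) / 2 ^ k) * (nv v * ((nv v : ℝ) ^ n)⁻¹) := by
    intro v hv
    have e1 : ∑ x ∈ Cube k q ×ˢ J with x.2 - x.1 = v, ((nv (x.2 - x.1) : ℝ) ^ n)⁻¹ =
      ∑ x ∈ Cube k q ×ˢ J with x.2 - x.1 = v, ((nv v : ℝ) ^ n)⁻¹ :=
      Finset.sum_congr rfl fun x hx => by rw [(Finset.mem_filter.1 hx).2]
    rw [e1, Finset.sum_const, nsmul_eq_mul]
    have e2 : (((Cube k q ×ˢ J).filter fun x => x.2 - x.1 = v).card) ≤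
        ((Cube k q).filter fun i => i + v ∉ Cube k q).card := by
      apply Finset.card_le_card_of_injOn (fun x => x.1)
      · intro x hx
        obtain ⟨hx0, hx3⟩ := Finset.mem_filter.1 hx
        obtain ⟨hx1, hx2⟩ := Finset.mem_product.1 hx0
        simp only [Finset.coe_filter, Set.mem_ofPred_eq]
        refine ⟨hx1, ?_⟩
        rw [← hx3, add_sub_cancel]
        exact hJ _ hx2
      · intro x hx y hy hxy
        have hx3 := (Finset.mem_filter.1 hx).2
        have hy3 := (Finset.mem_filter.1 hy).2
        simp only at hxy
        refine Prod.ext hxy ?_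
        have : x.2 - x.1 = y.2 - y.1 := by rw [hx3, hy3]
        rw [hxy] at this
        exact sub_left_injective this
    have e3 := card_bdry k q v
    rw [← le_div_iff₀ (by positivity)] at e3
    have e4 : ((((Cube k q ×ˢ J).filter fun x => x.2 - x.1 = v).card : ℕ) : ℝ) ≤
        n * nv v * 2 ^ (k * n) / 2 ^ k := le_trans (by exact_mod_cast e2) e3
    calc _ ≤ n * nv v * 2 ^ (k * n) / 2 ^ k * ((nv v : ℝ) ^ n)⁻¹ := by gcongr
      _ = _ := by ring
  refine (Finset.sum_le_sum h2).trans ?_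
  rw [← Finset.mul_sum]
  have h3 := near_sum V (D * 2 ^ k) (by positivity) (fun v hv => (hVprop v hv).1)
    (fun v hv => (hVprop v hv).2)
  calc _ ≤ (n * 2 ^ (k * n) / 2 ^ k) * (4 * 5 ^ n * ((D * 2 ^ k : ℕ) : ℝ)) := by gcongr
    _ = _ := by push_cast; field_simp

/-- cutoff -/
def cut (L : ℕ) (i0 j : Fin n → ℤ) : ℝ := max 0 (min 1 (2 - (nv (j - i0) : ℝ) / L))

lemma cut_nonneg (L : ℕ) (i0 j : Fin n → ℤ) : 0 ≤ cut L i0 j := le_max_left _ _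
lemma cut_le (L : ℕ) (i0 j : Fin n → ℤ) : cut L i0 j ≤ 1 :=
  max_le zero_le_one (min_le_left _ _)
lemma cut_one {L : ℕ} (hL : 0 < L) {i0 j : Fin n → ℤ} (h : nv (j - i0) ≤ L) : cut L i0 j = 1 := by
  have hL' : (0:ℝ) < L := by exact_mod_cast hL
  have : (nv (j - i0) : ℝ) / L ≤ 1 := by rw [div_le_one hL']; exact_mod_cast h
  rw [cut, min_eq_left (by linarith), max_eq_right zero_le_one]
lemma cut_zero {L : ℕ} (hL : 0 < L) {i0 j : Fin n → ℤ} (h : 2 * L ≤ nv (j - i0)) : cut L i0 j = 0 := by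
  have hL' : (0:ℝ) < L := by exact_mod_cast hL
  have : 2 ≤ (nv (j - i0) : ℝ) / L := by rw [le_div_iff₀ hL']; exact_mod_cast h
  rw [cut, max_eq_left]
  exact (min_le_right _ _).trans (by linarith)
lemma cut_lip (L : ℕ) (i0 j j' : Fin n → ℤ) : |cut L i0 j - cut L i0 j'| ≤ nv (j - j') / L := by
  have h1 : (nv (j - i0) : ℝ) ≤ nv (j - j') + nv (j' - i0) := by exact_mod_cast nv_sub_le j j' i0
  have h2 : (nv (j' - i0) : ℝ) ≤ nv (j - j') + nv (j - i0) := by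
    rw [nv_sub_comm j j']; exact_mod_cast nv_sub_le j' j i0
  unfold cut
  have h0 : ∀ x y : ℝ, |max 0 x - max 0 y| ≤ |x - y| := fun x y => by
    have := abs_max_sub_max_le_max (0:ℝ) x 0 y
    simpa using this
  refine (h0 _ _).trans ?_
  rw [abs_sub_comm]
  have h3 : |min 1 (2 - (nv (j' - i0) : ℝ) / L) - min 1 (2 - (nv (j - i0) : ℝ) / L)| ≤
    |(2 - (nv (j' - i0) : ℝ) / L) - (2 - (nv (j - i0) : ℝ) / L)| := by
    have := abs_min_sub_min_le_max (1:ℝ) (2 - (nv (j' - i0) : ℝ) / L) 1 (2 - (nv (j - i0) : ℝ) / L)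
    simpa using this
  refine h3.trans ?_
  rw [show (2 - (nv (j' - i0) : ℝ) / L) - (2 - (nv (j - i0) : ℝ) / L) = ((nv (j - i0) : ℝ) - nv (j' - i0)) / L by ring]
  rw [abs_div, abs_of_nonneg (by positivity : (0:ℝ) ≤ L)]
  gcongr
  rw [abs_le]; constructor <;> linarith

lemma CZ.test_cut {N : ℕ} {a : (Fin n → ℤ) → (Fin n → ℤ) → ℂ} (ha : CZ n N a) (L : ℕ) (hL : 0 < L)
    (i0 : Fin n → ℤ) (I : Finset (Fin n → ℤ)) :
    ∑ i ∈ I, ‖∑ j ∈ Bx n N, a i j * (cut L i0 j : ℂ)‖ ^ 2 ≤ (L : ℝ) ^ n :=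
  ha.test L hL i0 (cut L i0) (cut_nonneg _ _) (cut_le _ _) (cut_lip _ _) (fun _ h => cut_zero hL h) I

def corner (k : ℕ) (q : Fin n → ℤ) : Fin n → ℤ := fun t => 2 ^ k * q t

lemma nv_corner {k : ℕ} {q i : Fin n → ℤ} (hi : i ∈ Cube k q) : nv (i - corner k q) ≤ 2 ^ k := by
  rw [nv_le]; intro t
  have := mem_Cube.1 hi t
  simp only [Pi.sub_apply, corner]
  zify
  rw [abs_le]
  constructor <;> linarith [this.1, this.2]

lemma nv_cubes_le {k : ℕ} {q q' i j : Fin n → ℤ} (hi : i ∈ Cube k q) (hj : j ∈ Cube k q') :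
    nv (i - j) ≤ (nv (q - q') + 1) * 2 ^ k := by
  rw [nv_le]; intro t
  have h1 := mem_Cube.1 hi t
  have h2 := mem_Cube.1 hj t
  have h3 := natAbs_le_nv (q - q') t
  simp only [Pi.sub_apply] at *
  have hp : (0:ℤ) < 2 ^ k := by positivity
  zify at *
  rw [abs_le] at *
  constructor <;> nlinarith

lemma nv_cubes_ge {k : ℕ} {q q' i j : Fin n → ℤ} (hi : i ∈ Cube k q) (hj : j ∈ Cube k q') :
    nv (q - q') * 2 ^ k ≤ nv (i - j) + 2 ^ k := by
  rcases Nat.eq_zero_or_pos (nv (q - q')) with h0 | h0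
  · simp [h0]
  have hn : (Finset.univ : Finset (Fin n)).Nonempty := by
    by_contra hne
    rw [Finset.not_nonempty_iff_eq_empty] at hne
    simp [nv, hne] at h0
  obtain ⟨t, _, ht⟩ := Finset.exists_mem_eq_sup Finset.univ hn (fun t => ((q - q') t).natAbs)
  have ht' : nv (q - q') = ((q - q') t).natAbs := ht
  rw [ht']
  have h1 := mem_Cube.1 hi t
  have h2 := mem_Cube.1 hj t
  have h3 := natAbs_le_nv (i - j) t
  have hp : (0:ℤ) < 2 ^ k := by positivity
  suffices h : ((q - q') t).natAbs * 2 ^ k ≤ ((i - j) t).natAbs + 2 ^ k by omega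
  simp only [Pi.sub_apply] at *
  zify
  rcases le_total 0 (q t - q' t) with h | h
  · rw [abs_of_nonneg h]
    have := le_abs_self (i t - j t)
    nlinarith
  · rw [abs_of_nonpos h]
    have := neg_le_abs (i t - j t)
    nlinarith

lemma Cube_ne_disj {k : ℕ} {q q' j : Fin n → ℤ} (h : q ≠ q') (hj : j ∈ Cube k q') : j ∉ Cube k q := by
  intro hj'
  apply h
  ext t
  have h1 := mem_Cube.1 hj t
  have h2 := mem_Cube.1 hj' t
  have hp : (0:ℤ) < 2 ^ k := by positivity
  by_contra hne
  rcases lt_or_gt_of_ne hne with h' | h' <;> nlinarith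

lemma cs_norm (s : Finset (Fin n → ℤ)) (x : (Fin n → ℤ) → ℂ) :
    ‖∑ i ∈ s, x i‖ ^ 2 ≤ s.card * ∑ i ∈ s, ‖x i‖ ^ 2 := by
  refine le_trans ?_ (sq_sum_le_card_mul_sum_sq (s := s) (f := fun i => ‖x i‖))
  gcongr
  exact norm_sum_le _ _

/-- normalised coarse matrix -/
def MM (a : (Fin n → ℤ) → (Fin n → ℤ) → ℂ) (k : ℕ) (q q' : Fin n → ℤ) : ℂ :=
  ((2 : ℂ) ^ (k * n))⁻¹ * ∑ i ∈ Cube k q, ∑ j ∈ Cube k q', a i j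

lemma MM_near (n D : ℕ) : ∃ C : ℝ, 0 < C ∧ ∀ (N : ℕ) (a : (Fin n → ℤ) → (Fin n → ℤ) → ℂ), CZ n N a →
    ∀ k q q', nv (q - q') ≤ D → ‖MM a k q q'‖ ≤ C := by
  classical
  refine ⟨1 + n * (4 * 5 ^ n * ((D + 1 : ℕ) : ℝ)) + n * (4 * 5 ^ n * ((3 : ℕ) : ℝ)), by positivity, ?_⟩
  intro N a ha k q q' hqq
  suffices h : ‖∑ i ∈ Cube k q, ∑ j ∈ Cube k q', a i j‖ ≤
      (1 + n * (4 * 5 ^ n * ((D + 1 : ℕ) : ℝ)) + n * (4 * 5 ^ n * ((3 : ℕ) : ℝ))) * 2 ^ (k * n) by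
    rw [MM, norm_mul, norm_inv, norm_pow, Complex.norm_ofNat, inv_mul_le_iff₀ (by positivity)]
    linarith
  have hP : (0:ℝ) < 2 ^ (k * n) := by positivity
  have hA : (0:ℝ) ≤ n * (4 * 5 ^ n * ((D + 1 : ℕ) : ℝ)) := by positivity
  have hB : (0:ℝ) ≤ n * (4 * 5 ^ n * ((3 : ℕ) : ℝ)) := by positivity
  by_cases hq : q = q'
  · subst hq
    set i0 := corner k q
    set L := 2 ^ k with hL
    have hL0 : 0 < L := by positivity
    set J := (Bx n N).filter fun j => j ∉ Cube k q ∧ nv (j - i0) < 2 * L with hJ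
    have hJ1 := near_pairs ha k q J 3 (by norm_num) (fun j hj => (Finset.mem_filter.1 hj).2.1) (by
      intro j hj i hi
      have h1 := (Finset.mem_filter.1 hj).2.2
      have h2 := nv_corner hi
      have h3 := nv_sub_le j i0 i
      rw [nv_sub_comm i0 i] at h3
      show nv (j - i) ≤ 3 * L
      change nv (i - i0) ≤ L at h2
      omega)
    have hdec : ∀ i, ∑ j ∈ Cube k q, a i j =
        ∑ j ∈ Bx n N, a i j * (cut L i0 j : ℂ) - ∑ j ∈ J, a i j * (cut L i0 j : ℂ) := by
      intro i
      have e1 : ∑ j ∈ Cube k q, a i j = ∑ j ∈ (Bx n N).filter (fun j => j ∈ Cube k q), a i j * (cut L i0 j : ℂ) := by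
        rw [← Finset.sum_filter_add_sum_filter_not (Cube k q) (fun j => j ∈ Bx n N)]
        rw [Finset.sum_eq_zero (s := Finset.filter (fun j => ¬ j ∈ Bx n N) _), add_zero]
        · apply Finset.sum_congr
          · ext j; simp [and_comm]
          · intro j hj
            rw [cut_one hL0 (nv_corner (Finset.mem_filter.1 hj).2)]; simp
        · intro j hj; exact ha.supp i j (Or.inr (Finset.mem_filter.1 hj).2)
      rw [e1, ← Finset.sum_filter_add_sum_filter_not (Bx n N) (fun j => j ∈ Cube k q), eq_sub_iff_add_eq]
      congr 1
      apply Finset.sum_subset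
      · intro j hj
        simp only [hJ, Finset.mem_filter] at hj ⊢
        exact ⟨hj.1, hj.2.1⟩
      · intro j hj hj'
        simp only [hJ, Finset.mem_filter] at hj hj'
        have : 2 * L ≤ nv (j - i0) := by
          by_contra h; push Not at h; exact hj' ⟨hj.1, hj.2, h⟩
        rw [cut_zero hL0 this]; simp
    simp_rw [hdec]
    rw [Finset.sum_sub_distrib]
    have h1 : ‖∑ i ∈ Cube k q, ∑ j ∈ Bx n N, a i j * (cut L i0 j : ℂ)‖ ≤ 2 ^ (k * n) := by
      have h2 := cs_norm (Cube k q) (fun i => ∑ j ∈ Bx n N, a i j * (cut L i0 j : ℂ))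
      have h3 := ha.test_cut L hL0 i0 (Cube k q)
      rw [card_Cube] at h2
      have h4 : (L : ℝ) ^ n = 2 ^ (k * n) := by rw [hL]; push_cast; rw [← pow_mul]
      rw [h4] at h3
      push_cast at h2
      refine abs_le_of_sq_le_sq' ?_ hP.le |>.2
      nlinarith
    have h2 : ‖∑ i ∈ Cube k q, ∑ j ∈ J, a i j * (cut L i0 j : ℂ)‖ ≤ ∑ i ∈ Cube k q, ∑ j ∈ J, ‖a i j‖ := by
      refine (norm_sum_le _ _).trans (Finset.sum_le_sum fun i _ => ?_)
      refine (norm_sum_le _ _).trans (Finset.sum_le_sum fun j _ => ?_)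
      rw [norm_mul, Complex.norm_real, Real.norm_eq_abs, abs_of_nonneg (cut_nonneg _ _ _)]
      have := cut_le L i0 j
      nlinarith [norm_nonneg (a i j)]
    have h3 := norm_sub_le (∑ i ∈ Cube k q, ∑ j ∈ Bx n N, a i j * (cut L i0 j : ℂ))
      (∑ i ∈ Cube k q, ∑ j ∈ J, a i j * (cut L i0 j : ℂ))
    nlinarith
  · have h1 := near_pairs ha k q (Cube k q') (D + 1) (by omega) (fun j hj => Cube_ne_disj hq hj) (by
      intro j hj i hi
      rw [nv_sub_comm]
      refine (nv_cubes_le hi hj).trans ?_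
      gcongr)
    have h2 : ‖∑ i ∈ Cube k q, ∑ j ∈ Cube k q', a i j‖ ≤ ∑ i ∈ Cube k q, ∑ j ∈ Cube k q', ‖a i j‖ := by
      refine (norm_sum_le _ _).trans (Finset.sum_le_sum fun i _ => ?_)
      exact norm_sum_le _ _
    nlinarith

lemma sum_Cube_shift (k : ℕ) (q q'' : Fin n → ℤ) (F : (Fin n → ℤ) → ℂ) :
    ∑ i ∈ Cube k q'', F i = ∑ i ∈ Cube k q, F (i + corner k (q'' - q)) := by
  refine Finset.sum_nbij' (fun i => i - corner k (q'' - q)) (fun i => i + corner k (q'' - q)) ?_ ?_ ?_ ?_ ?_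
  · intro i hi
    rw [mem_Cube] at hi ⊢
    intro t; have := hi t
    simp only [Pi.sub_apply, corner, mul_sub]; omega
  · intro i hi
    rw [mem_Cube] at hi ⊢
    intro t; have := hi t
    simp only [Pi.add_apply, Pi.sub_apply, corner, mul_sub]; omega
  · intro i _; simp
  · intro i _; simp
  · intro i _; simp

lemma nv_par {q q'' : Fin n → ℤ} (h : par q = par q'') : nv (q'' - q) ≤ 1 := by
  rw [nv_le]; intro t
  have := congrFun h t
  simp only [par, Pi.sub_apply] at *
  omega

lemma nv_corner' (k : ℕ) {v : Fin n → ℤ} (h : nv v ≤ 1) : nv (corner k v) ≤ 2 ^ k := by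
  rw [nv_le] at h ⊢
  intro t; have := h t
  simp only [corner, Int.natAbs_mul, Int.natAbs_pow]
  calc _ ≤ 2 ^ k * 1 := by gcongr; norm_num
    _ = _ := by ring

lemma two_sh_le (v : Fin n → ℤ) (D : ℕ) (hD : 1 ≤ D) (h : nv v ≤ D) : 2 ^ sh v ≤ D := by
  by_cases hv : v = 0
  · subst hv; simp [sh, nv_zero]; exact hD
  · exact (sh_le_nv hv).trans h

lemma MM_diff (n : ℕ) : ∃ C : ℝ, 0 < C ∧ ∀ (N : ℕ) (a : (Fin n → ℤ) → (Fin n → ℤ) → ℂ), CZ n N a →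
    ∀ k q q'' q', par q = par q'' → ‖MM a k q q' - MM a k q'' q'‖ ≤ C * wt (q' - q) := by
  obtain ⟨C1, hC1, hnear⟩ := MM_near n (4 * n + 3)
  refine ⟨2 * C1 * (4 * n + 2) ^ (n + 1) + 2 ^ (n + 1), by positivity, ?_⟩
  intro N a ha k q q'' q' hpar
  have hw := wt_pos (q' - q)
  rcases le_or_gt (nv (q - q')) (4 * n + 2) with hd | hd
  · have h1 := hnear N a ha k q q' (by omega)
    have h2 := hnear N a ha k q'' q' (by
      have := nv_sub_le q'' q q'
      have := nv_par hpar
      omega)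
    have h3 : (1:ℝ) ≤ (4 * n + 2) ^ (n + 1) * wt (q' - q) := by
      rw [wt, ← div_eq_mul_inv, one_le_div (by positivity)]
      have := two_sh_le (q' - q) (4 * n + 2) (by omega) (by rw [nv_sub_comm]; exact hd)
      gcongr
      exact_mod_cast this
    have h4 := norm_sub_le (MM a k q q') (MM a k q'' q')
    have h5 : (0:ℝ) ≤ 2 ^ (n + 1) * wt (q' - q) := by positivity
    calc _ ≤ 2 * C1 * 1 := by linarith
      _ ≤ 2 * C1 * ((4 * n + 2) ^ (n + 1) * wt (q' - q)) := by gcongr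
      _ ≤ _ := by linarith
  · have e1 : MM a k q q' - MM a k q'' q' = ((2 : ℂ) ^ (k * n))⁻¹ *
        ∑ i ∈ Cube k q, ∑ j ∈ Cube k q', (a i j - a (i + corner k (q'' - q)) j) := by
      simp only [MM, Finset.sum_sub_distrib]
      rw [sum_Cube_shift k q q'' (fun i => ∑ j ∈ Cube k q', a i j)]
      ring
    have e2 : ∀ i ∈ Cube k q, ∀ j ∈ Cube k q', ‖a i j - a (i + corner k (q'' - q)) j‖ ≤
        2 ^ (n + 1) * wt (q' - q) * (2 ^ (k * n))⁻¹ := by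
      intro i hi j hj
      have h1 := nv_cubes_ge hi hj
      have h2 := nv_corner' k (nv_par hpar)
      have h3 : nv (i - (i + corner k (q'' - q))) = nv (corner k (q'' - q)) := by
        rw [← nv_neg]; congr 1; abel
      have hp : 0 < 2 ^ k := by positivity
      have h4 : (4 * n + 2) * 2 ^ k ≤ nv (i - j) := by
        have : (4 * n + 3) * 2 ^ k ≤ nv (q - q') * 2 ^ k := by gcongr; omega
        nlinarith
      have h5 := ha.smooth i (i + corner k (q'' - q)) j (by nlinarith) (by
        rw [h3]
        calc 4 * n * nv (corner k (q'' - q)) ≤ 4 * n * 2 ^ k := by gcongr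
          _ ≤ nv (i - j) := by nlinarith)
      refine h5.trans ?_
      rw [h3]
      have h6 : (2:ℝ) ^ k * 2 ^ sh (q' - q) / 2 ≤ nv (i - j) := by
        have hne : q' - q ≠ 0 := by
          intro h; rw [← neg_sub, ← nv_neg, neg_neg, h, nv_zero] at hd; omega
        have h7 := sh_le_nv hne
        rw [nv_sub_comm] at h7
        have h8 : 2 ^ k * 2 ^ sh (q' - q) ≤ 2 * nv (i - j) := by
          have : 2 * 2 ^ k ≤ nv (q - q') * 2 ^ k := by gcongr; omega
          nlinarith
        have : (2:ℝ) ^ k * 2 ^ sh (q' - q) ≤ 2 * nv (i - j) := by exact_mod_cast h8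
        linarith
      calc (nv (corner k (q'' - q)) : ℝ) * ((nv (i - j) : ℝ) ^ (n + 1))⁻¹
          ≤ 2 ^ k * (((2:ℝ) ^ k * 2 ^ sh (q' - q) / 2) ^ (n + 1))⁻¹ := by
            gcongr
            exact_mod_cast h2
        _ = _ := by
            rw [wt, div_pow, mul_pow, pow_mul, pow_succ ((2:ℝ) ^ k)]
            field_simp
    rw [e1, norm_mul, norm_inv, norm_pow, Complex.norm_ofNat, inv_mul_le_iff₀ (by positivity)]
    calc ‖∑ i ∈ Cube k q, ∑ j ∈ Cube k q', (a i j - a (i + corner k (q'' - q)) j)‖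
        ≤ ∑ i ∈ Cube k q, ∑ j ∈ Cube k q', 2 ^ (n + 1) * wt (q' - q) * (2 ^ (k * n))⁻¹ := by
          refine (norm_sum_le _ _).trans (Finset.sum_le_sum fun i hi => ?_)
          exact (norm_sum_le _ _).trans (Finset.sum_le_sum fun j hj => e2 i hi j hj)
      _ = 2 ^ (k * n) * (2 ^ (n + 1) * wt (q' - q)) := by
          simp only [Finset.sum_const, card_Cube, nsmul_eq_mul]
          push_cast
          field_simp
      _ ≤ _ := by
          gcongr
          have : 0 ≤ 2 * C1 * (4 * (n:ℝ) + 2) ^ (n + 1) := by positivity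
          linarith

def rowsum (N : ℕ) (a : (Fin n → ℤ) → (Fin n → ℤ) → ℂ) (i : Fin n → ℤ) : ℂ := ∑ j ∈ Bx n N, a i j

lemma sum_Cube_av (k : ℕ) (f : (Fin n → ℤ) → ℂ) (q : Fin n → ℤ) :
    ∑ i ∈ Cube k q, f i = (2 : ℂ) ^ (k * n) * av k f q := by
  rw [av, mul_inv_cancel_left₀ (pow_ne_zero _ two_ne_zero)]

lemma var_le (k : ℕ) (f : (Fin n → ℤ) → ℂ) (q : Fin n → ℤ) (c : ℂ) :
    ∑ i ∈ Cube k q, ‖f i - av k f q‖ ^ 2 ≤ ∑ i ∈ Cube k q, ‖f i - c‖ ^ 2 := by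
  have h := pythag (Cube k q) (fun i => f i - c) (av k f q - c) (2 ^ (k * n))
    (by rw [card_Cube]; push_cast; rfl) (by
      rw [Finset.sum_sub_distrib, sum_Cube_av, Finset.sum_const, card_Cube, nsmul_eq_mul]
      push_cast; ring)
  simp only [sub_sub_sub_cancel_right] at h
  rw [h]
  have : (0:ℝ) ≤ 2 ^ (k * n) * ‖av k f q - c‖ ^ 2 := by positivity
  linarith

lemma osc_bound (n : ℕ) (hn : 1 ≤ n) : ∃ C : ℝ, 0 < C ∧ ∀ (N : ℕ) (a : (Fin n → ℤ) → (Fin n → ℤ) → ℂ), CZ n N a →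
    ∀ k q, ∑ i ∈ Cube k q, ‖rowsum N a i - av k (rowsum N a) q‖ ^ 2 ≤ C * 2 ^ (k * n) := by
  classical
  refine ⟨2 * (4 * n) ^ n + 2 * (5 ^ n) ^ 2, by positivity, ?_⟩
  intro N a ha k q
  set i0 := corner k q with hi0
  set L := 4 * n * 2 ^ k with hL
  have hL0 : 0 < L := by positivity
  set u : (Fin n → ℤ) → ℂ := fun i => ∑ j ∈ Bx n N, a i j * ((1 - cut L i0 j : ℝ) : ℂ) with hu
  have hdec : ∀ i, rowsum N a i = ∑ j ∈ Bx n N, a i j * (cut L i0 j : ℂ) + u i := by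
    intro i
    rw [hu, rowsum]; simp only
    rw [← Finset.sum_add_distrib]
    refine Finset.sum_congr rfl fun j _ => ?_
    push_cast; ring
  have hud : ∀ i ∈ Cube k q, ‖u i - u i0‖ ≤ 5 ^ n := by
    intro i hi
    have h1 := nv_corner hi
    set J := (Bx n N).filter fun j => L ≤ nv (j - i0) with hJ
    have e1 : u i - u i0 = ∑ j ∈ J, (a i j - a i0 j) * ((1 - cut L i0 j : ℝ) : ℂ) := by
      rw [hu]; simp only
      rw [← Finset.sum_sub_distrib]
      symm
      have : ∀ j, a i j * ((1 - cut L i0 j : ℝ) : ℂ) - a i0 j * ((1 - cut L i0 j : ℝ) : ℂ) =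
        (a i j - a i0 j) * ((1 - cut L i0 j : ℝ) : ℂ) := fun j => by ring
      simp_rw [this]
      apply Finset.sum_subset (Finset.filter_subset _ _)
      intro j hj hj'
      have : nv (j - i0) ≤ L := by
        by_contra h; push Not at h
        exact hj' (Finset.mem_filter.2 ⟨hj, h.le⟩)
      rw [cut_one hL0 this]; simp
    rw [e1]
    have e2 : ∀ j ∈ J, ‖(a i j - a i0 j) * ((1 - cut L i0 j : ℝ) : ℂ)‖ ≤
        2 ^ k * ((nv (j - i0) : ℝ) ^ (n + 1))⁻¹ := by
      intro j hj
      have hj2 := (Finset.mem_filter.1 hj).2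
      have h3 := ha.smooth i0 i j (by rw [nv_sub_comm]; omega) (by
        rw [nv_sub_comm i0 i, nv_sub_comm i0 j]
        refine le_trans ?_ hj2
        rw [hL]; gcongr)
      rw [nv_sub_comm i0 i, nv_sub_comm i0 j, norm_sub_rev] at h3
      have h4 : ‖((1 - cut L i0 j : ℝ) : ℂ)‖ ≤ 1 := by
        rw [Complex.norm_real, Real.norm_eq_abs, abs_le]
        constructor <;> linarith [cut_nonneg L i0 j, cut_le L i0 j]
      rw [norm_mul]
      have h5 : (nv (i - i0) : ℝ) * ((nv (j - i0) : ℝ) ^ (n + 1))⁻¹ ≤ 2 ^ k * ((nv (j - i0) : ℝ) ^ (n + 1))⁻¹ := by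
        gcongr; exact_mod_cast h1
      calc _ ≤ ‖a i j - a i0 j‖ * 1 := by gcongr
        _ ≤ _ := by linarith
    refine (norm_sum_le _ _).trans ((Finset.sum_le_sum e2).trans ?_)
    rw [← Finset.mul_sum]
    have e3 := tail_sum (J.image fun j => j - i0) L hL0 (by
      intro v hv
      obtain ⟨j, hj, rfl⟩ := Finset.mem_image.1 hv
      exact (Finset.mem_filter.1 hj).2)
    rw [Finset.sum_image (by intro x _ y _ h; exact sub_left_injective h)] at e3
    calc _ ≤ 2 ^ k * (4 * 5 ^ n / (L : ℝ)) := by gcongr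
      _ = 5 ^ n / n := by rw [hL]; push_cast; field_simp
      _ ≤ 5 ^ n := by
        apply div_le_self (by positivity)
        exact_mod_cast hn
  refine (var_le k _ q (u i0)).trans ?_
  have e1 : ∀ i ∈ Cube k q, ‖rowsum N a i - u i0‖ ^ 2 ≤
      2 * ‖∑ j ∈ Bx n N, a i j * (cut L i0 j : ℂ)‖ ^ 2 + 2 * (5 ^ n) ^ 2 := by
    intro i hi
    have h := norm_add_sq_le' (∑ j ∈ Bx n N, a i j * (cut L i0 j : ℂ)) (u i - u i0) 1 one_pos
    rw [hdec i, add_sub_assoc]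
    have h2 : ‖u i - u i0‖ ^ 2 ≤ (5 ^ n) ^ 2 := by gcongr; exact hud i hi
    linarith
  refine (Finset.sum_le_sum e1).trans ?_
  rw [Finset.sum_add_distrib, ← Finset.mul_sum, Finset.sum_const, card_Cube, nsmul_eq_mul]
  have h3 := ha.test_cut L hL0 i0 (Cube k q)
  have h4 : (L : ℝ) ^ n = (4 * n) ^ n * 2 ^ (k * n) := by
    rw [hL]; push_cast; rw [mul_pow, ← pow_mul]
  rw [h4] at h3
  push_cast
  nlinarith

end T1

namespace T1

variable {n : ℕ}

def osc (k : ℕ) (v : (Fin n → ℤ) → ℂ) (q : Fin n → ℤ) : ℝ := ∑ i ∈ Cube k q, ‖v i - av k v q‖ ^ 2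

lemma osc_nonneg (k : ℕ) (v : (Fin n → ℤ) → ℂ) (q : Fin n → ℤ) : 0 ≤ osc k v q := by
  unfold osc; positivity

lemma osc_eq (k : ℕ) (v : (Fin n → ℤ) → ℂ) (q : Fin n → ℤ) :
    osc k v q = ∑ i ∈ Cube k q, ‖v i‖ ^ 2 - 2 ^ (k * n) * ‖av k v q‖ ^ 2 := by
  unfold osc
  apply pythag
  · rw [card_Cube]; push_cast; rfl
  · rw [sum_Cube_av]; push_cast; rfl

lemma osc_zero (v : (Fin n → ℤ) → ℂ) (q : Fin n → ℤ) : osc 0 v q = 0 := by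
  simp [osc, Cube_zero, av_zero]

lemma osc_succ (k : ℕ) (v : (Fin n → ℤ) → ℂ) (q : Fin n → ℤ) :
    osc (k + 1) v q = ∑ e, (osc k v (child q e) + 2 ^ (k * n) * ‖dd k v (child q e)‖ ^ 2) := by
  rw [Finset.sum_add_distrib, ← Finset.mul_sum, pythag_child]
  simp only [osc_eq]
  rw [sum_Cube, Finset.sum_sub_distrib, ← Finset.mul_sum]
  rw [show (k + 1) * n = k * n + n by ring, pow_add]
  ring

def EE (v f : (Fin n → ℤ) → ℂ) : ℕ → (Fin n → ℤ) → ℝ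
  | 0, _ => 0
  | k + 1, q => ∑ e, (EE v f k (child q e) +
      2 ^ (k * n) * ‖dd k v (child q e)‖ ^ 2 * ‖av k f (child q e)‖ ^ 2)

lemma EE_sum (v f : (Fin n → ℤ) → ℂ) : ∀ k m, ∑ q ∈ Bx n m, EE v f k q =
    ∑ k' ∈ Finset.range k, ∑ q ∈ Bx n (m + k - k'),
      2 ^ (k' * n) * ‖dd k' v q‖ ^ 2 * ‖av k' f q‖ ^ 2 := by
  intro k
  induction k with
  | zero => intro m; simp [EE]
  | succ k ih =>
    intro m
    simp only [EE]
    rw [← sum_children m (fun q => EE v f k q + 2 ^ (k * n) * ‖dd k v q‖ ^ 2 * ‖av k f q‖ ^ 2),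
      Finset.sum_add_distrib, ih, Finset.sum_range_succ]
    congr 1
    · refine Finset.sum_congr rfl fun x _ => ?_
      rw [show m + 1 + k - x = m + (k + 1) - x by omega]
    · rw [show m + (k + 1) - k = m + 1 by omega]

lemma bell {P μ γ S x : ℝ} (hP : 0 < P) (hμ : 0 ≤ μ) (hγ : 0 ≤ γ) (h : μ + γ ≤ P) (hx0 : 0 ≤ x)
    (hx : x * P ≤ S) : γ * x ^ 2 ≤ 4 * (S ^ 2 / (P + μ) - S ^ 2 / (P + μ + γ)) := by
  have e : S ^ 2 / (P + μ) - S ^ 2 / (P + μ + γ) = S ^ 2 * γ / ((P + μ) * (P + μ + γ)) := by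
    field_simp; ring
  rw [e, ← mul_div_assoc, le_div_iff₀ (by positivity)]
  have h1 : (P + μ) * (P + μ + γ) ≤ 4 * P ^ 2 := by nlinarith
  have h2 : (x * P) ^ 2 ≤ S ^ 2 := by gcongr
  calc γ * x ^ 2 * ((P + μ) * (P + μ + γ)) ≤ γ * x ^ 2 * (4 * P ^ 2) := by gcongr
    _ = 4 * ((x * P) ^ 2 * γ) := by ring
    _ ≤ _ := by gcongr

lemma carleson_ind (v f : (Fin n → ℤ) → ℂ) (B : ℝ) (hB : 0 < B)
    (h : ∀ k q, osc k v q ≤ B * 2 ^ (k * n)) : ∀ k q,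
    EE v f k q ≤ 4 * (B * 2 ^ n) * (∑ i ∈ Cube k q, ‖f i‖ ^ 2 -
      (∑ i ∈ Cube k q, ‖f i‖) ^ 2 / (2 ^ (k * n) + osc k v q / (B * 2 ^ n))) := by
  intro k
  induction k with
  | zero => intro q; simp [EE, Cube_zero, osc_zero]
  | succ k ih =>
    intro q
    have hP : (0:ℝ) < 2 ^ (k * n) := by positivity
    have hPk : (2:ℝ) ^ ((k + 1) * n) = 2 ^ (k * n) * 2 ^ n := by rw [← pow_add]; congr 1; ring
    have key : ∀ e, EE v f k (child q e) +
      2 ^ (k * n) * ‖dd k v (child q e)‖ ^ 2 * ‖av k f (child q e)‖ ^ 2 ≤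
      4 * (B * 2 ^ n) * (∑ i ∈ Cube k (child q e), ‖f i‖ ^ 2 -
      (∑ i ∈ Cube k (child q e), ‖f i‖) ^ 2 / (2 ^ (k * n) +
        (osc k v (child q e) + 2 ^ (k * n) * ‖dd k v (child q e)‖ ^ 2) / (B * 2 ^ n))) := by
      intro e
      have h1 : osc k v (child q e) + 2 ^ (k * n) * ‖dd k v (child q e)‖ ^ 2 ≤ B * 2 ^ n * 2 ^ (k * n) := by
        have h2 := h (k + 1) q
        rw [osc_succ, hPk] at h2
        have h3 := Finset.single_le_sum (f := fun e => osc k v (child q e) + 2 ^ (k * n) * ‖dd k v (child q e)‖ ^ 2)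
          (fun e _ => add_nonneg (osc_nonneg _ _ _) (by positivity)) (Finset.mem_univ e)
        nlinarith
      have hx : ‖av k f (child q e)‖ * 2 ^ (k * n) ≤ ∑ i ∈ Cube k (child q e), ‖f i‖ := by
        refine le_trans (le_of_eq ?_) (norm_sum_le _ _)
        rw [sum_Cube_av, norm_mul, norm_pow, Complex.norm_ofNat, mul_comm]
      have := bell (P := 2 ^ (k * n)) (μ := osc k v (child q e) / (B * 2 ^ n))
        (γ := 2 ^ (k * n) * ‖dd k v (child q e)‖ ^ 2 / (B * 2 ^ n)) hP
        (div_nonneg (osc_nonneg _ _ _) (by positivity)) (by positivity)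
        (by rw [← add_div, div_le_iff₀ (by positivity)]; linarith) (norm_nonneg _) hx
      have h5 := mul_le_mul_of_nonneg_left this (by positivity : 0 ≤ B * 2 ^ n)
      rw [show B * 2 ^ n * (2 ^ (k * n) * ‖dd k v (child q e)‖ ^ 2 / (B * 2 ^ n) * ‖av k f (child q e)‖ ^ 2)
        = 2 ^ (k * n) * ‖dd k v (child q e)‖ ^ 2 * ‖av k f (child q e)‖ ^ 2 by field_simp] at h5
      have h6 := ih (child q e)
      rw [add_div, ← add_assoc]
      linarith
    rw [EE]
    refine (Finset.sum_le_sum fun e _ => key e).trans ?_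
    rw [← Finset.mul_sum, Finset.sum_sub_distrib, sum_Cube, sum_Cube]
    gcongr
    refine le_trans (le_of_eq ?_) (Finset.sq_sum_div_le_sum_sq_div Finset.univ _ ?_)
    · congr 1
      rw [Finset.sum_add_distrib, osc_succ, ← Finset.sum_div, hPk, Finset.sum_const, card_bits]
      simp [mul_comm]
    · intro e _
      have := osc_nonneg k v (child q e)
      positivity

/-- Carleson embedding -/
lemma carleson (v f : (Fin n → ℤ) → ℂ) (B : ℝ) (hB : 0 < B)
    (h : ∀ k q, osc k v q ≤ B * 2 ^ (k * n)) (N : ℕ) :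
    ∑ k ∈ Finset.range N, ∑ q ∈ Bx n (N - k), 2 ^ (k * n) * ‖dd k v q‖ ^ 2 * ‖av k f q‖ ^ 2 ≤
      4 * (B * 2 ^ n) * ∑ i ∈ Bx n N, ‖f i‖ ^ 2 := by
  have h1 := EE_sum v f N 0
  rw [zero_add] at h1
  rw [← h1]
  have h2 : ∑ q ∈ Bx n 0, EE v f N q ≤ ∑ q ∈ Bx n 0, 4 * (B * 2 ^ n) * ∑ i ∈ Cube N q, ‖f i‖ ^ 2 := by
    refine Finset.sum_le_sum fun q _ => (carleson_ind v f B hB h N q).trans ?_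
    have := osc_nonneg N v q
    gcongr
    rw [sub_le_self_iff]; positivity
  rw [← Finset.mul_sum, sum_Bx_Cube, zero_add] at h2
  exact h2

/-- coarse matrix, differenced in the first variable -/
def NN (a : (Fin n → ℤ) → (Fin n → ℤ) → ℂ) (k : ℕ) (q q' : Fin n → ℤ) : ℂ :=
  MM a k q q' - ((2 : ℂ) ^ n)⁻¹ * ∑ e, MM a k (child (par q) e) q'

lemma NN_le (n : ℕ) : ∃ C : ℝ, 0 < C ∧ ∀ (N : ℕ) (a : (Fin n → ℤ) → (Fin n → ℤ) → ℂ), CZ n N a →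
    ∀ k q q', ‖NN a k q q'‖ ≤ C * wt (q' - q) := by
  obtain ⟨C, hC, h⟩ := MM_diff n
  refine ⟨C, hC, fun N a ha k q q' => ?_⟩
  have e1 : NN a k q q' = ((2 : ℂ) ^ n)⁻¹ * ∑ e : Fin n → Fin 2, (MM a k q q' - MM a k (child (par q) e) q') := by
    rw [NN, Finset.sum_sub_distrib, Finset.sum_const, card_bits, mul_sub]
    simp
  rw [e1, norm_mul, norm_inv, norm_pow, Complex.norm_ofNat, inv_mul_le_iff₀ (by positivity)]
  refine (norm_sum_le _ _).trans ?_
  refine (Finset.sum_le_sum fun e _ => h N a ha k q (child (par q) e) q' (by simp)).trans ?_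
  rw [Finset.sum_const, card_bits]; simp

lemma sum_MM (N : ℕ) (a : (Fin n → ℤ) → (Fin n → ℤ) → ℂ) (k m : ℕ) (h : m + k = N) (q : Fin n → ℤ) :
    ∑ q' ∈ Bx n m, MM a k q q' = av k (rowsum N a) q := by
  subst h
  simp only [MM, av, rowsum]
  rw [← Finset.mul_sum, Finset.sum_comm]
  congr 1
  refine Finset.sum_congr rfl fun i _ => ?_
  rw [sum_Bx_Cube]

lemma sum_NN (N : ℕ) (a : (Fin n → ℤ) → (Fin n → ℤ) → ℂ) (k m : ℕ) (h : m + k = N) (q : Fin n → ℤ) :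
    ∑ q' ∈ Bx n m, NN a k q q' = dd k (rowsum N a) q := by
  simp only [NN]
  rw [Finset.sum_sub_distrib, sum_MM N a k m h, ← Finset.mul_sum, Finset.sum_comm]
  simp_rw [sum_MM N a k m h]
  rw [← av_succ, dd]

lemma wcs (s : Finset (Fin n → ℤ)) (w x : (Fin n → ℤ) → ℝ) (hw : ∀ i, 0 ≤ w i) (W : ℝ)
    (hW : ∑ i ∈ s, w i ≤ W) : (∑ i ∈ s, w i * x i) ^ 2 ≤ W * ∑ i ∈ s, w i * x i ^ 2 := by
  have h := Finset.sum_sq_le_sum_mul_sum_of_sq_le_mul s (r := fun i => w i * x i) (f := w) (g := fun i => w i * x i ^ 2)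
    (fun i _ => hw i) (fun i _ => mul_nonneg (hw i) (sq_nonneg _)) (fun i _ => le_of_eq (by ring))
  refine h.trans ?_
  gcongr
  exact Finset.sum_nonneg fun i _ => mul_nonneg (hw i) (sq_nonneg _)

/-- the set of all differences -/
def DB (n N : ℕ) : Finset (Fin n → ℤ) := by
  classical exact (Bx n N ×ˢ Bx n N).image fun x => x.1 - x.2

lemma Bx_mono {m N : ℕ} (h : m ≤ N) : Bx n m ⊆ Bx n N := by
  intro i hi
  rw [mem_Bx] at hi ⊢
  intro t
  have h1 := hi t
  have : (2:ℤ) ^ m ≤ 2 ^ N := pow_le_pow_right₀ (by norm_num) h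
  constructor <;> linarith

lemma sum_DB {m N : ℕ} (h : m ≤ N) {q : Fin n → ℤ} (hq : q ∈ Bx n m) (F : (Fin n → ℤ) → ℝ)
    (hF : ∀ v, 0 ≤ F v) : ∑ q' ∈ Bx n m, F (q' - q) ≤ ∑ v ∈ DB n N, F v := by
  classical
  rw [← Finset.sum_image (s := Bx n m) (g := fun q' => q' - q) (f := F)
    (fun x _ y _ hxy => sub_left_injective hxy)]
  refine Finset.sum_le_sum_of_subset_of_nonneg ?_ (fun v _ _ => hF v)
  intro v hv
  obtain ⟨q', hq', rfl⟩ := Finset.mem_image.1 hv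
  unfold DB
  exact Finset.mem_image.2 ⟨(q', q), Finset.mem_product.2 ⟨Bx_mono h hq', Bx_mono h hq⟩, rfl⟩

lemma part_II (n : ℕ) : ∃ C : ℝ, 0 < C ∧ ∀ (N : ℕ) (a : (Fin n → ℤ) → (Fin n → ℤ) → ℂ), CZ n N a →
    ∀ f : (Fin n → ℤ) → ℂ, (∀ i, i ∉ Bx n N → f i = 0) →
    ∑ k ∈ Finset.range N, 2 ^ (k * n) * ∑ q ∈ Bx n (N - k),
      ‖∑ q' ∈ Bx n (N - k), NN a k q q' * (av k f q' - av k f q)‖ ^ 2 ≤ C * ∑ i ∈ Bx n N, ‖f i‖ ^ 2 := by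
  obtain ⟨C, hC, h⟩ := NN_le n
  obtain ⟨C', hC', h'⟩ := shift_bound n
  refine ⟨C ^ 2 * (6 * 5 ^ n) * (C' * (6 * 5 ^ n)), by positivity, fun N a ha f hf => ?_⟩
  have h1 : ∀ k ∈ Finset.range N, (2:ℝ) ^ (k * n) * ∑ q ∈ Bx n (N - k),
      ‖∑ q' ∈ Bx n (N - k), NN a k q q' * (av k f q' - av k f q)‖ ^ 2 ≤
      C ^ 2 * (6 * 5 ^ n) * ∑ v ∈ DB n N, wt v * X (N - k) k v f := by
    intro k _
    have e : C ^ 2 * (6 * 5 ^ n) * ∑ v ∈ DB n N, wt v * X (N - k) k v f =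
      2 ^ (k * n) * ∑ q ∈ Bx n (N - k), C ^ 2 * (6 * 5 ^ n) * ∑ v ∈ DB n N, wt v * ‖av k f (q + v) - av k f q‖ ^ 2 := by
      simp only [X]
      rw [← Finset.mul_sum, Finset.sum_comm]
      simp only [Finset.mul_sum]
      refine Finset.sum_congr rfl fun v _ => Finset.sum_congr rfl fun q _ => by ring
    rw [e]
    gcongr with q hq
    have h2 : ‖∑ q' ∈ Bx n (N - k), NN a k q q' * (av k f q' - av k f q)‖ ≤
        C * ∑ q' ∈ Bx n (N - k), wt (q' - q) * ‖av k f q' - av k f q‖ := by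
      refine (norm_sum_le _ _).trans ?_
      rw [Finset.mul_sum]
      refine Finset.sum_le_sum fun q' _ => ?_
      rw [norm_mul, ← mul_assoc]
      gcongr
      exact h N a ha k q q'
    have h3 : ∑ q' ∈ Bx n (N - k), wt (q' - q) ≤ 6 * 5 ^ n :=
      (sum_DB (Nat.sub_le N k) hq wt (fun v => (wt_pos v).le)).trans (wt_sum' _)
    have h4 := wcs (Bx n (N - k)) (fun q' => wt (q' - q)) (fun q' => ‖av k f q' - av k f q‖)
      (fun v => (wt_pos _).le) _ h3
    have h5 : ∑ q' ∈ Bx n (N - k), wt (q' - q) * ‖av k f q' - av k f q‖ ^ 2 ≤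
        ∑ v ∈ DB n N, wt v * ‖av k f (q + v) - av k f q‖ ^ 2 := by
      have := sum_DB (Nat.sub_le N k) hq (fun v => wt v * ‖av k f (q + v) - av k f q‖ ^ 2)
        (fun v => mul_nonneg (wt_pos _).le (sq_nonneg _))
      simpa using this
    calc _ ≤ (C * ∑ q' ∈ Bx n (N - k), wt (q' - q) * ‖av k f q' - av k f q‖) ^ 2 := by gcongr
      _ = C ^ 2 * (∑ q' ∈ Bx n (N - k), wt (q' - q) * ‖av k f q' - av k f q‖) ^ 2 := by ring
      _ ≤ C ^ 2 * (6 * 5 ^ n * ∑ v ∈ DB n N, wt v * ‖av k f (q + v) - av k f q‖ ^ 2) := by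
        gcongr
        exact h4.trans (by gcongr)
      _ = _ := by ring
  refine (Finset.sum_le_sum h1).trans ?_
  rw [← Finset.mul_sum, Finset.sum_comm]
  simp_rw [← Finset.mul_sum]
  rw [mul_assoc _ (C' * _)]
  gcongr
  calc _ ≤ ∑ v ∈ DB n N, wt v * (C' * (3 / 2) ^ (sh v + 1) * ∑ i ∈ Bx n N, ‖f i‖ ^ 2) := by
        gcongr with v _
        · exact (wt_pos v).le
        · exact h' N f hf _ v (nv_lt_sh v).le
    _ = C' * (∑ v ∈ DB n N, wt v * (3 / 2) ^ (sh v + 1)) * ∑ i ∈ Bx n N, ‖f i‖ ^ 2 := by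
        generalize (∑ i ∈ Bx n N, ‖f i‖ ^ 2) = Z
        rw [Finset.mul_sum, Finset.sum_mul]
        refine Finset.sum_congr rfl fun v _ => by ring
    _ ≤ _ := by
        gcongr
        exact wt_sum _

/-- the square function bound -/
lemma sq_bound (n : ℕ) (hn : 1 ≤ n) : ∃ C : ℝ, 0 < C ∧ ∀ (N : ℕ) (a : (Fin n → ℤ) → (Fin n → ℤ) → ℂ), CZ n N a →
    ∀ f : (Fin n → ℤ) → ℂ, (∀ i, i ∉ Bx n N → f i = 0) →
    ∑ k ∈ Finset.range N, 2 ^ (k * n) * ∑ q ∈ Bx n (N - k),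
      ‖∑ q' ∈ Bx n (N - k), NN a k q q' * av k f q'‖ ^ 2 ≤ C * ∑ i ∈ Bx n N, ‖f i‖ ^ 2 := by
  obtain ⟨C, hC, h⟩ := part_II n
  obtain ⟨B, hB, hB'⟩ := osc_bound n hn
  refine ⟨2 * C + 2 * (4 * (B * 2 ^ n)), by positivity, fun N a ha f hf => ?_⟩
  have h1 := h N a ha f hf
  have h2 := carleson (rowsum N a) f B hB (fun k q => hB' N a ha k q) N
  have h3 : ∀ k ∈ Finset.range N, (2:ℝ) ^ (k * n) * ∑ q ∈ Bx n (N - k),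
      ‖∑ q' ∈ Bx n (N - k), NN a k q q' * av k f q'‖ ^ 2 ≤
      2 * (2 ^ (k * n) * ∑ q ∈ Bx n (N - k),
      ‖∑ q' ∈ Bx n (N - k), NN a k q q' * (av k f q' - av k f q)‖ ^ 2) +
      2 * ∑ q ∈ Bx n (N - k), 2 ^ (k * n) * ‖dd k (rowsum N a) q‖ ^ 2 * ‖av k f q‖ ^ 2 := by
    intro k hk
    rw [Finset.mem_range] at hk
    simp only [Finset.mul_sum]
    rw [← Finset.sum_add_distrib]
    refine Finset.sum_le_sum fun q _ => ?_
    have e : ∑ q' ∈ Bx n (N - k), NN a k q q' * av k f q' =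
        ∑ q' ∈ Bx n (N - k), NN a k q q' * (av k f q' - av k f q) + dd k (rowsum N a) q * av k f q := by
      rw [← sum_NN N a k (N - k) (by omega), Finset.sum_mul, ← Finset.sum_add_distrib]
      refine Finset.sum_congr rfl fun q' _ => by ring
    rw [e]
    have := norm_add_sq_le' (∑ q' ∈ Bx n (N - k), NN a k q q' * (av k f q' - av k f q))
      (dd k (rowsum N a) q * av k f q) 1 one_pos
    rw [norm_mul, mul_pow] at this
    have hP : (0:ℝ) < 2 ^ (k * n) := by positivity
    nlinarith [mul_le_mul_of_nonneg_left this hP.le]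
  refine (Finset.sum_le_sum h3).trans ?_
  rw [Finset.sum_add_distrib, ← Finset.mul_sum, ← Finset.mul_sum]
  linarith

end T1

namespace T1

variable {n : ℕ}

def form (N : ℕ) (a : (Fin n → ℤ) → (Fin n → ℤ) → ℂ) (f g : (Fin n → ℤ) → ℂ) (k : ℕ) : ℂ :=
  2 ^ (k * n) * ∑ q ∈ Bx n (N - k), ∑ q' ∈ Bx n (N - k), MM a k q q' * av k f q' * av k g q

lemma MM_succ (a : (Fin n → ℤ) → (Fin n → ℤ) → ℂ) (k : ℕ) (p p' : Fin n → ℤ) :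
    MM a (k + 1) p p' = ((2:ℂ) ^ n)⁻¹ * ∑ e, ∑ e', MM a k (child p e) (child p' e') := by
  simp only [MM, sum_Cube, ← Finset.mul_sum]
  rw [← mul_assoc, add_mul, pow_add, mul_inv, one_mul, mul_comm (((2:ℂ) ^ n)⁻¹)]
  congr 1
  refine Finset.sum_congr rfl fun e _ => ?_
  rw [Finset.sum_comm]

lemma form_succ (N : ℕ) (a : (Fin n → ℤ) → (Fin n → ℤ) → ℂ) (f g : (Fin n → ℤ) → ℂ) (k : ℕ)
    (hk : k < N) : form N a f g (k + 1) = 2 ^ (k * n) * ∑ q ∈ Bx n (N - k), ∑ q' ∈ Bx n (N - k),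
      MM a k q q' * av (k + 1) f (par q') * av (k + 1) g (par q) := by
  obtain ⟨m, rfl⟩ : ∃ m, N = m + 1 + k := ⟨N - k - 1, by omega⟩
  rw [form, show m + 1 + k - (k + 1) = m by omega, show m + 1 + k - k = m + 1 by omega]
  simp only [sum_children, par_child]
  rw [show (k + 1) * n = k * n + n by ring, pow_add, mul_assoc]
  congr 1
  rw [Finset.mul_sum]
  refine Finset.sum_congr rfl fun p _ => ?_
  rw [Finset.sum_comm, Finset.mul_sum]
  refine Finset.sum_congr rfl fun p' _ => ?_
  rw [MM_succ]
  simp_rw [← Finset.sum_mul]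
  rw [mul_assoc, mul_assoc, ← mul_assoc ((2:ℂ) ^ n), mul_inv_cancel₀ (pow_ne_zero _ two_ne_zero),
    one_mul, mul_assoc]

lemma dd_cancel (m k : ℕ) (g F : (Fin n → ℤ) → ℂ) :
    ∑ q ∈ Bx n (m + 1), F q * dd k g q =
      ∑ q ∈ Bx n (m + 1), (F q - ((2:ℂ) ^ n)⁻¹ * ∑ e, F (child (par q) e)) * dd k g q := by
  rw [sum_children, sum_children]
  refine Finset.sum_congr rfl fun p _ => ?_
  simp only [par_child, sub_mul]
  rw [Finset.sum_sub_distrib, ← Finset.mul_sum _ _ (((2:ℂ) ^ n)⁻¹ * ∑ e, F (child p e)), sum_child_dd, mul_zero, sub_zero]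

lemma dd_NN (N k : ℕ) (hk : k < N) (a : (Fin n → ℤ) → (Fin n → ℤ) → ℂ) (g h : (Fin n → ℤ) → ℂ) :
    ∑ q ∈ Bx n (N - k), ∑ q' ∈ Bx n (N - k), MM a k q q' * h q' * dd k g q =
    ∑ q ∈ Bx n (N - k), (∑ q' ∈ Bx n (N - k), NN a k q q' * h q') * dd k g q := by
  obtain ⟨m, hm⟩ : ∃ m, N - k = m + 1 := ⟨N - k - 1, by omega⟩
  rw [hm]
  simp_rw [← Finset.sum_mul]
  rw [dd_cancel]
  refine Finset.sum_congr rfl fun q _ => ?_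
  congr 1
  simp only [NN, sub_mul]
  rw [Finset.sum_sub_distrib, Finset.sum_comm]
  simp only [Finset.mul_sum, Finset.sum_mul, mul_assoc]

lemma schur (n : ℕ) : ∃ C : ℝ, 0 < C ∧ ∀ (N : ℕ) (a : (Fin n → ℤ) → (Fin n → ℤ) → ℂ), CZ n N a →
    ∀ k m (h : (Fin n → ℤ) → ℂ), 
    ∑ q ∈ Bx n m, ‖∑ q' ∈ Bx n m, NN a k q q' * h q'‖ ^ 2 ≤ C * ∑ q ∈ Bx n m, ‖h q‖ ^ 2 := by
  classical
  obtain ⟨C, hC, hN⟩ := NN_le n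
  refine ⟨C ^ 2 * (6 * 5 ^ n) * (6 * 5 ^ n), by positivity, fun N a ha k m h => ?_⟩
  have hw1 : ∀ q, ∑ q' ∈ Bx n m, wt (q' - q) ≤ 6 * 5 ^ n := by
    intro q
    have := wt_sum' ((Bx n m).image fun q' => q' - q)
    rwa [Finset.sum_image (fun x _ y _ hxy => sub_left_injective hxy)] at this
  have hw2 : ∀ q', ∑ q ∈ Bx n m, wt (q' - q) ≤ 6 * 5 ^ n := by
    intro q'
    have := wt_sum' ((Bx n m).image fun q => q' - q)
    rwa [Finset.sum_image (fun x _ y _ hxy => sub_right_injective hxy)] at this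
  have h1 : ∀ q, ‖∑ q' ∈ Bx n m, NN a k q q' * h q'‖ ^ 2 ≤
      C ^ 2 * (6 * 5 ^ n) * ∑ q' ∈ Bx n m, wt (q' - q) * ‖h q'‖ ^ 2 := by
    intro q
    have h2 : ‖∑ q' ∈ Bx n m, NN a k q q' * h q'‖ ≤ C * ∑ q' ∈ Bx n m, wt (q' - q) * ‖h q'‖ := by
      refine (norm_sum_le _ _).trans ?_
      rw [Finset.mul_sum]
      refine Finset.sum_le_sum fun q' _ => ?_
      rw [norm_mul, ← mul_assoc]
      gcongr
      exact hN N a ha k q q'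
    have h4 := wcs (Bx n m) (fun q' => wt (q' - q)) (fun q' => ‖h q'‖) (fun v => (wt_pos _).le) _ (hw1 q)
    calc _ ≤ (C * ∑ q' ∈ Bx n m, wt (q' - q) * ‖h q'‖) ^ 2 := by gcongr
      _ = C ^ 2 * (∑ q' ∈ Bx n m, wt (q' - q) * ‖h q'‖) ^ 2 := by ring
      _ ≤ _ := by rw [mul_assoc]; gcongr
  refine (Finset.sum_le_sum fun q _ => h1 q).trans ?_
  rw [← Finset.mul_sum, Finset.sum_comm, mul_assoc (C ^ 2 * (6 * 5 ^ n))]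
  refine mul_le_mul_of_nonneg_left ?_ (by positivity)
  rw [Finset.mul_sum]
  refine Finset.sum_le_sum fun q' _ => ?_
  rw [← Finset.sum_mul]
  gcongr
  exact hw2 q'

lemma norm_sum_mul_le (s : Finset (Fin n → ℤ)) (x y : (Fin n → ℤ) → ℂ) :
    ‖∑ q ∈ s, x q * y q‖ ≤ (∑ q ∈ s, ‖x q‖ ^ 2 + ∑ q ∈ s, ‖y q‖ ^ 2) / 2 := by
  refine (norm_sum_le _ _).trans ?_
  rw [← Finset.sum_add_distrib, Finset.sum_div]
  refine Finset.sum_le_sum fun q _ => ?_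
  rw [norm_mul]
  nlinarith [sq_nonneg (‖x q‖ - ‖y q‖)]

lemma MM_swap (a : (Fin n → ℤ) → (Fin n → ℤ) → ℂ) (k : ℕ) (q q' : Fin n → ℤ) :
    MM a k q q' = MM (fun i j => a j i) k q' q := by
  simp only [MM]; rw [Finset.sum_comm]

lemma discT1 (n : ℕ) (hn : 1 ≤ n) : ∃ C : ℝ, 0 < C ∧ ∀ (N : ℕ) (a : (Fin n → ℤ) → (Fin n → ℤ) → ℂ),
    CZ n N a → CZ n N (fun i j => a j i) →
    ∀ f g : (Fin n → ℤ) → ℂ, (∀ i, i ∉ Bx n N → f i = 0) → (∀ i, i ∉ Bx n N → g i = 0) →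
    ‖∑ i ∈ Bx n N, ∑ j ∈ Bx n N, a i j * f j * g i‖ ≤
      C * (∑ i ∈ Bx n N, ‖f i‖ ^ 2 + ∑ i ∈ Bx n N, ‖g i‖ ^ 2) := by
  obtain ⟨C1, hC1, hsq⟩ := sq_bound n hn
  obtain ⟨C2, hC2, hsc⟩ := schur n
  obtain ⟨C3, hC3, hnear⟩ := MM_near n 1
  refine ⟨C1 + 1 + C2 + 1 + C3 * 2 ^ n, by positivity, fun N a ha ha' f g hf hg => ?_⟩
  set b : (Fin n → ℤ) → (Fin n → ℤ) → ℂ := fun i j => a j i with hb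
  set F := ∑ i ∈ Bx n N, ‖f i‖ ^ 2 with hF
  set G := ∑ i ∈ Bx n N, ‖g i‖ ^ 2 with hG
  have hF0 : 0 ≤ F := by positivity
  have hG0 : 0 ≤ G := by positivity
  have e0 : ∑ i ∈ Bx n N, ∑ j ∈ Bx n N, a i j * f j * g i = form N a f g 0 := by
    simp [form, MM, Cube_zero, av_zero]
  have tele : form N a f g 0 = form N a f g N + ∑ k ∈ Finset.range N, (form N a f g k - form N a f g (k + 1)) := by
    rw [Finset.sum_range_sub']; ring
  -- top level
  have top : ‖form N a f g N‖ ≤ C3 * 2 ^ n * (F + G) := by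
    have hfN := en_top_le N f
    have hgN := en_top_le N g
    unfold en at hfN hgN
    rw [form, Nat.sub_self, norm_mul, norm_pow, Complex.norm_ofNat]
    have hcard : ((Bx n 0).card : ℝ) = 2 ^ n := by simp [Bx]
    have hP : (0:ℝ) < 2 ^ (N * n) := by positivity
    have h1 : ‖∑ q ∈ Bx n 0, ∑ q' ∈ Bx n 0, MM a N q q' * av N f q' * av N g q‖ ≤
        ∑ q ∈ Bx n 0, ∑ q' ∈ Bx n 0, C3 * (‖av N f q'‖ ^ 2 + ‖av N g q‖ ^ 2) := by
      refine (norm_sum_le _ _).trans (Finset.sum_le_sum fun q hq => (norm_sum_le _ _).trans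
        (Finset.sum_le_sum fun q' hq' => ?_))
      rw [norm_mul, norm_mul, mul_assoc]
      have hd : nv (q - q') ≤ 1 := by
        rw [nv_le]; intro t
        have h1 := mem_Bx.1 hq t
        have h2 := mem_Bx.1 hq' t
        simp only [pow_zero, Pi.sub_apply] at *
        omega
      refine mul_le_mul (hnear N a ha N q q' hd) ?_ (by positivity) hC3.le
      nlinarith [sq_nonneg (‖av N f q'‖ - ‖av N g q‖), sq_nonneg (‖av N f q'‖), sq_nonneg ‖av N g q‖]
    have h2 : ∑ q ∈ Bx n 0, ∑ q' ∈ Bx n 0, C3 * (‖av N f q'‖ ^ 2 + ‖av N g q‖ ^ 2) =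
        C3 * 2 ^ n * (∑ q' ∈ Bx n 0, ‖av N f q'‖ ^ 2 + ∑ q' ∈ Bx n 0, ‖av N g q'‖ ^ 2) := by
      simp only [← Finset.mul_sum, Finset.sum_add_distrib, Finset.sum_const, nsmul_eq_mul]
      rw [hcard]; ring
    calc _ ≤ 2 ^ (N * n) * (C3 * 2 ^ n * (∑ q' ∈ Bx n 0, ‖av N f q'‖ ^ 2 + ∑ q' ∈ Bx n 0, ‖av N g q'‖ ^ 2)) := by
          rw [← h2]; gcongr
      _ = C3 * 2 ^ n * (2 ^ (N * n) * ∑ q' ∈ Bx n 0, ‖av N f q'‖ ^ 2 + 2 ^ (N * n) * ∑ q' ∈ Bx n 0, ‖av N g q'‖ ^ 2) := by ring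
      _ ≤ _ := by gcongr
  -- each level
  set SF : ℕ → ℝ := fun k => 2 ^ (k * n) * ∑ q ∈ Bx n (N - k),
      ‖∑ q' ∈ Bx n (N - k), NN a k q q' * av k f q'‖ ^ 2 with hSF
  set SG : ℕ → ℝ := fun k => 2 ^ (k * n) * ∑ q ∈ Bx n (N - k),
      ‖∑ q' ∈ Bx n (N - k), NN b k q q' * av k g q'‖ ^ 2 with hSG
  have lev : ∀ k ∈ Finset.range N, ‖form N a f g k - form N a f g (k + 1)‖ ≤
      (SF k + de (N - k) k g) / 2 + (SG k + de (N - k) k f) / 2 + (C2 * de (N - k) k f + de (N - k) k g) / 2 := by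
    intro k hk
    rw [Finset.mem_range] at hk
    have e1 : form N a f g k - form N a f g (k + 1) =
        2 ^ (k * n) * ∑ q ∈ Bx n (N - k), (∑ q' ∈ Bx n (N - k), NN a k q q' * av k f q') * dd k g q +
        2 ^ (k * n) * ∑ q ∈ Bx n (N - k), (∑ q' ∈ Bx n (N - k), NN b k q q' * av k g q') * dd k f q -
        2 ^ (k * n) * ∑ q ∈ Bx n (N - k), (∑ q' ∈ Bx n (N - k), NN a k q q' * dd k f q') * dd k g q := by
      rw [form_succ N a f g k hk, form, ← dd_NN N k hk, ← dd_NN N k hk, ← dd_NN N k hk]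
      have e2 : ∑ q ∈ Bx n (N - k), ∑ q' ∈ Bx n (N - k), MM b k q q' * av k g q' * dd k f q =
        ∑ q ∈ Bx n (N - k), ∑ q' ∈ Bx n (N - k), MM a k q q' * av k g q * dd k f q' := by
        rw [Finset.sum_comm]
        refine Finset.sum_congr rfl fun q _ => Finset.sum_congr rfl fun q' _ => ?_
        rw [MM_swap a]
      rw [e2, ← mul_sub, ← mul_add, ← mul_sub]
      congr 1
      simp only [← Finset.sum_sub_distrib, ← Finset.sum_add_distrib]
      refine Finset.sum_congr rfl fun q _ => Finset.sum_congr rfl fun q' _ => ?_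
      simp only [dd]; ring
    have gen : ∀ x y : (Fin n → ℤ) → ℂ, ‖(2:ℂ) ^ (k * n) * ∑ q ∈ Bx n (N - k), x q * y q‖ ≤
        (2 ^ (k * n) * ∑ q ∈ Bx n (N - k), ‖x q‖ ^ 2 + 2 ^ (k * n) * ∑ q ∈ Bx n (N - k), ‖y q‖ ^ 2) / 2 := by
      intro x y
      rw [norm_mul, norm_pow, Complex.norm_ofNat, ← mul_add, mul_div_assoc]
      gcongr
      exact norm_sum_mul_le _ _ _
    rw [e1]
    refine (norm_sub_le _ _).trans (add_le_add ((norm_add_le _ _).trans (add_le_add (gen _ _) (gen _ _))) ((gen _ _).trans ?_))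
    have h3 := hsc N a ha k (N - k) (dd k f)
    have h4 := mul_le_mul_of_nonneg_left h3 (by positivity : (0:ℝ) ≤ 2 ^ (k * n))
    simp only [de]
    linarith
  have s1 := hsq N a ha f hf
  have s2 := hsq N b ha' g hg
  have d1 := sum_de_le N f
  have d2 := sum_de_le N g
  have tot : ‖∑ k ∈ Finset.range N, (form N a f g k - form N a f g (k + 1))‖ ≤
      (C1 + 1 + C2 + 1) * (F + G) := by
    refine (norm_sum_le _ _).trans ((Finset.sum_le_sum lev).trans ?_)
    simp only [Finset.sum_add_distrib, ← Finset.sum_div, ← Finset.mul_sum]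
    have h1 : ∑ k ∈ Finset.range N, SF k ≤ C1 * F := s1
    have h2 : ∑ k ∈ Finset.range N, SG k ≤ C1 * G := s2
    have h3 := mul_le_mul_of_nonneg_left d1 hC2.le
    nlinarith [mul_nonneg hC1.le hF0, mul_nonneg hC1.le hG0, mul_nonneg hC2.le hF0, mul_nonneg hC2.le hG0]
  rw [e0, tele]
  refine (norm_add_le _ _).trans ?_
  nlinarith

end T1

namespace T1

variable {n : ℕ}

abbrev Es (n : ℕ) := EuclideanSpace ℝ (Fin n)

def io (j : Fin n → ℤ) : Es n := WithLp.toLp 2 fun t => (j t : ℝ)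

@[simp] lemma io_apply (j : Fin n → ℤ) (t : Fin n) : io j t = (j t : ℝ) := rfl

lemma io_sub (i j : Fin n → ℤ) : io (i - j) = io i - io j := by
  ext t; simp

lemma abs_coord_le (x : Es n) (t : Fin n) : |x t| ≤ ‖x‖ := by
  have := PiLp.norm_apply_le x t
  simpa using this

lemma norm_le_sum (x : Es n) : ‖x‖ ≤ ∑ t, |x t| := by
  rw [EuclideanSpace.norm_eq]
  refine Real.sqrt_le_iff.2 ⟨by positivity, ?_⟩
  simp only [Real.norm_eq_abs]
  exact Finset.sum_sq_le_sq_sum_of_nonneg (fun _ _ => abs_nonneg _)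

lemma norm_le_of_coord (x : Es n) {r : ℝ} (h : ∀ t, |x t| ≤ r) : ‖x‖ ≤ n * r := by
  refine (norm_le_sum x).trans ((Finset.sum_le_sum fun t _ => h t).trans ?_)
  simp

lemma natAbs_real (k : ℤ) : ((k.natAbs : ℕ) : ℝ) = |(k : ℝ)| := by
  rw [Nat.cast_natAbs, Int.cast_abs]

lemma norm_io_le (j : Fin n → ℤ) : ‖io j‖ ≤ n * nv j := by
  refine norm_le_of_coord _ fun t => ?_
  have := natAbs_le_nv j t
  rw [io_apply, ← natAbs_real]
  exact Nat.cast_le.2 this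

lemma nv_le_norm_io (j : Fin n → ℤ) : (nv j : ℝ) ≤ ‖io j‖ := by
  by_cases h0 : nv j = 0
  · rw [h0]; simp
  have hn : (Finset.univ : Finset (Fin n)).Nonempty := by
    by_contra hne
    rw [Finset.not_nonempty_iff_eq_empty] at hne
    simp [nv, hne] at h0
  obtain ⟨t, _, ht⟩ := Finset.exists_mem_eq_sup Finset.univ hn (fun t => (j t).natAbs)
  have ht' : nv j = (j t).natAbs := ht
  refine le_trans (le_of_eq ?_) (abs_coord_le (io j) t)
  rw [ht', io_apply, ← natAbs_real]

def be (x : ℝ) : ℝ := Real.smoothTransition (x + 1) - Real.smoothTransition x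

lemma be_nonneg (x : ℝ) : 0 ≤ be x :=
  sub_nonneg.2 (Real.smoothTransition.monotone (by linarith))

lemma be_zero {x : ℝ} (h : 1 ≤ |x|) : be x = 0 := by
  rcases le_abs'.1 h with h | h
  · rw [be, Real.smoothTransition.zero_of_nonpos (by linarith),
      Real.smoothTransition.zero_of_nonpos (by linarith), sub_zero]
  · rw [be, Real.smoothTransition.one_of_one_le (by linarith),
      Real.smoothTransition.one_of_one_le (by linarith), sub_self]

lemma be_contDiff : ContDiff ℝ 1 be := by
  unfold be
  have h := Real.smoothTransition.contDiff (n := 1)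
  exact (h.comp (contDiff_id.add contDiff_const)).sub h

lemma be_sum (x : ℝ) (a : ℤ) (L : ℕ) : ∑ k ∈ Finset.Ico a (a + L), be (x - k) =
    Real.smoothTransition (x - a + 1) - Real.smoothTransition (x - a - L + 1) := by
  induction L with
  | zero => simp
  | succ L ih =>
    have : Finset.Ico a (a + ((L + 1 : ℕ) : ℤ)) = insert (a + (L:ℤ)) (Finset.Ico a (a + (L:ℤ))) := by
      ext k; simp only [Finset.mem_insert, Finset.mem_Ico]; push_cast; omega
    rw [this, Finset.sum_insert (by simp), ih, be]
    push_cast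
    rw [show x - (a + (L:ℝ)) + 1 = x - a - L + 1 by ring, show x - a - (L + 1 : ℝ) + 1 = x - (a + L) by ring]
    ring

def ph (x : Es n) : ℝ := ∏ t, be (x t)

lemma ph_nonneg (x : Es n) : 0 ≤ ph x := Finset.prod_nonneg fun _ _ => be_nonneg _

lemma ph_zero {x : Es n} {t : Fin n} (h : 1 ≤ |x t|) : ph x = 0 :=
  Finset.prod_eq_zero (Finset.mem_univ t) (be_zero h)

lemma ph_contDiff : ContDiff ℝ 1 (ph : Es n → ℝ) := by
  unfold ph
  refine contDiff_prod fun t _ => be_contDiff.comp ?_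
  exact contDiff_piLp_apply (p := 2)

lemma ph_at_zero : ph (0 : Es n) = 1 := by
  simp [ph, be, Real.smoothTransition.one, Real.smoothTransition.zero]

def pj (j : Fin n → ℤ) (x : Es n) : ℝ := ph (x - io j)

lemma pj_nonneg (j : Fin n → ℤ) (x : Es n) : 0 ≤ pj j x := ph_nonneg _

lemma pj_contDiff (j : Fin n → ℤ) : ContDiff ℝ 1 (pj j) := by
  unfold pj
  exact ph_contDiff.comp (contDiff_id.sub contDiff_const)

lemma pj_zero {j : Fin n → ℤ} {x : Es n} {t : Fin n} (h : 1 ≤ |x t - j t|) : pj j x = 0 :=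
  ph_zero (t := t) (by simpa using h)

lemma ph_tsupport : tsupport (ph : Es n → ℝ) ⊆ {x | ∀ t, |x t| ≤ 1} := by
  have hc : IsClosed {x : Es n | ∀ t, |x t| ≤ 1} := by
    rw [Set.ofPred_forall]
    refine isClosed_iInter fun t => isClosed_le ?_ continuous_const
    exact (contDiff_piLp_apply (𝕜 := ℝ) (n := 0) (p := 2) (E := fun _ : Fin n => ℝ) (i := t)).continuous.abs
  refine closure_minimal ?_ hc
  intro x hx t
  by_contra h
  exact hx (ph_zero (t := t) (le_of_lt (not_le.1 h)))

lemma pj_tsupport (j : Fin n → ℤ) : tsupport (pj j) ⊆ {x | ∀ t, |x t - j t| ≤ 1} := by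
  intro x hx t
  have h1 : tsupport (pj j) ⊆ (fun x => x - io j) ⁻¹' tsupport (ph : Es n → ℝ) :=
    tsupport_comp_subset_preimage ph (by fun_prop)
  simpa using ph_tsupport (h1 hx) t

lemma pj_tsupport' (j : Fin n → ℤ) : tsupport (pj j) ⊆ closedBall (io j) n := by
  intro x hx
  rw [mem_closedBall, dist_eq_norm]
  have := norm_le_of_coord (x - io j) (r := 1) (fun t => by simpa using pj_tsupport j hx t)
  simpa using this

lemma pj_compact (j : Fin n → ℤ) : HasCompactSupport (pj j) :=
  (isCompact_closedBall (io j) n).of_isClosed_subset (isClosed_tsupport _) (pj_tsupport' j)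

lemma Bx_sum (m : ℕ) (x : Es n) : ∑ j ∈ Bx n m, pj j x =
    ∏ t, (Real.smoothTransition (x t + 2 ^ m + 1) - Real.smoothTransition (x t - 2 ^ m + 1)) := by
  have h : ∀ t, Real.smoothTransition (x t + 2 ^ m + 1) - Real.smoothTransition (x t - 2 ^ m + 1) =
      ∑ k ∈ Finset.Ico (-2 ^ m : ℤ) (2 ^ m), be (x t - k) := by
    intro t
    have := be_sum (x t) (-2 ^ m) (2 ^ m + 2 ^ m)
    push_cast at this
    rw [show (-2 ^ m + (2 ^ m + 2 ^ m) : ℤ) = 2 ^ m by ring] at this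
    rw [this]
    congr 2 <;> ring
  simp_rw [h]
  rw [Finset.prod_univ_sum]
  rfl

lemma Bx_sum_le (m : ℕ) (x : Es n) : ∑ j ∈ Bx n m, pj j x ≤ 1 := by
  rw [Bx_sum]
  have hm : (0:ℝ) < 2 ^ m := by positivity
  refine Finset.prod_le_one (fun t _ => sub_nonneg.2 (Real.smoothTransition.monotone (by linarith))) fun t _ => ?_
  linarith [Real.smoothTransition.le_one (x t + 2 ^ m + 1), Real.smoothTransition.nonneg (x t - 2 ^ m + 1)]

lemma Bx_sum_one {m : ℕ} {x : Es n} (h : ∀ t, |x t| ≤ 2 ^ m - 1) : ∑ j ∈ Bx n m, pj j x = 1 := by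
  rw [Bx_sum]
  refine Finset.prod_eq_one fun t _ => ?_
  have := abs_le.1 (h t)
  rw [Real.smoothTransition.one_of_one_le (by linarith), Real.smoothTransition.zero_of_nonpos (by linarith), sub_zero]

lemma exists_Bx (r : ℝ) : ∃ m : ℕ, r ≤ 2 ^ m - 1 ∧ ∀ j : Fin n → ℤ, (nv j : ℝ) ≤ r → j ∈ Bx n m := by
  obtain ⟨m, hm⟩ := pow_unbounded_of_one_lt (r + 1) (by norm_num : (1:ℝ) < 2)
  refine ⟨m, by linarith, fun j hj => mem_Bx.2 fun t => ?_⟩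
  have h1 := natAbs_le_nv j t
  have h2 : (((j t).natAbs : ℕ) : ℝ) < ((2 ^ m : ℕ) : ℝ) := by
    have : (((j t).natAbs : ℕ) : ℝ) ≤ nv j := Nat.cast_le.2 h1
    rw [Nat.cast_pow, Nat.cast_ofNat]
    linarith
  have h3 : (j t).natAbs < 2 ^ m := Nat.cast_lt.1 h2
  have h4 : ((2 ^ m : ℕ) : ℤ) = 2 ^ m := by push_cast; rfl
  constructor <;> omega

lemma exists_Bx_sub (J : Finset (Fin n → ℤ)) (r : ℝ) : ∃ m : ℕ, r ≤ 2 ^ m - 1 ∧ J ⊆ Bx n m := by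
  obtain ⟨m, h1, h2⟩ := exists_Bx (n := n) (max r (J.sup nv : ℕ))
  refine ⟨m, (le_max_left _ _).trans h1, fun j hj => h2 j ?_⟩
  refine le_trans ?_ (le_max_right _ _)
  exact_mod_cast Finset.le_sup (f := nv) hj

lemma pj_sum_le (J : Finset (Fin n → ℤ)) (x : Es n) : ∑ j ∈ J, pj j x ≤ 1 := by
  obtain ⟨m, _, h⟩ := exists_Bx_sub J 0
  exact (Finset.sum_le_sum_of_subset_of_nonneg h fun _ _ _ => pj_nonneg _ _).trans (Bx_sum_le m x)

/-- complex valued version -/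
def pc (j : Fin n → ℤ) (x : Es n) : ℂ := (pj j x : ℂ)

lemma pc_contDiff (j : Fin n → ℤ) : ContDiff ℝ 1 (pc j) :=
  Complex.ofRealCLM.contDiff.comp (pj_contDiff j)

lemma pc_tsupport (j : Fin n → ℤ) : tsupport (pc j) ⊆ tsupport (pj j) := by
  refine closure_mono fun x hx h => hx ?_
  simp [pc, h]

lemma pc_compact (j : Fin n → ℤ) : HasCompactSupport (pc j) :=
  (pj_compact j).of_isClosed_subset (isClosed_tsupport _) (pc_tsupport j)

lemma io_zero : io (0 : Fin n → ℤ) = 0 := by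
  ext t; simp

lemma pc_eq (j : Fin n → ℤ) : pc j = fun x => pc 0 (x - io j) := by
  ext x
  simp only [pc, pj, io_zero, sub_zero]

lemma pc_norm (j : Fin n → ℤ) (x : Es n) : ‖pc j x‖ = pj j x := by
  rw [pc, Complex.norm_real, Real.norm_eq_abs, abs_of_nonneg (pj_nonneg _ _)]

lemma pc_fderiv_bound (n : ℕ) : ∃ G : ℝ, 0 < G ∧ ∀ (j : Fin n → ℤ) x, ‖fderiv ℝ (pc j) x‖ ≤ G := by
  obtain ⟨G, hG⟩ := ((pc_contDiff (0 : Fin n → ℤ)).continuous_fderiv one_ne_zero).bounded_above_of_compact_support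
    ((pc_compact 0).fderiv ℝ)
  refine ⟨|G| + 1, by positivity, fun j x => ?_⟩
  rw [pc_eq, fderiv_comp_sub]
  exact (hG _).trans (by linarith [le_abs_self G])

lemma pc_fderiv_zero {j : Fin n → ℤ} {x : Es n} {t : Fin n} (h : 1 < |x t - j t|) :
    fderiv ℝ (pc j) x = 0 := by
  by_contra hne
  have h1 : x ∈ tsupport (pc j) := support_fderiv_subset ℝ hne
  have := pj_tsupport j (pc_tsupport j h1) t
  linarith

/-- the floor of a point -/
def fl (x : Es n) : Fin n → ℤ := fun t => ⌊x t⌋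

lemma nv_fl {j : Fin n → ℤ} {x : Es n} (h : ∀ t, |x t - j t| ≤ 1) : nv (j - fl x) ≤ 2 := by
  rw [nv_le]; intro t
  have h1 := abs_le.1 (h t)
  have h2 := Int.floor_le (x t)
  have h3 := Int.lt_floor_add_one (x t)
  simp only [Pi.sub_apply, fl]
  have h4 : ((j t - ⌊x t⌋ : ℤ) : ℝ) < 3 := by push_cast; linarith
  have h5 : (-2 : ℝ) < ((j t - ⌊x t⌋ : ℤ) : ℝ) := by push_cast; linarith
  have h6 : j t - ⌊x t⌋ < 3 := by exact_mod_cast h4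
  have h7 : -2 < j t - ⌊x t⌋ := by exact_mod_cast h5
  omega

/-- lattice points near a given one -/
def nb (j0 : Fin n → ℤ) (L : ℕ) : Finset (Fin n → ℤ) := Fintype.piFinset fun t => Finset.Icc (j0 t - L) (j0 t + L)

lemma mem_nb {j0 j : Fin n → ℤ} {L : ℕ} : j ∈ nb j0 L ↔ nv (j - j0) ≤ L := by
  simp only [nb, Fintype.mem_piFinset, Finset.mem_Icc, nv_le, Pi.sub_apply]
  refine forall_congr' fun t => ?_
  omega

lemma card_nb (j0 : Fin n → ℤ) (L : ℕ) : (nb j0 L).card = (2 * L + 1) ^ n := by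
  simp only [nb, Fintype.card_piFinset, Int.card_Icc]
  rw [Finset.prod_congr rfl (g := fun _ => 2 * L + 1) (fun t _ => by omega)]
  simp

/-- synthesis of lattice coefficients -/
def syn (J : Finset (Fin n → ℤ)) (c : (Fin n → ℤ) → ℂ) : Es n → ℂ := fun x => ∑ j ∈ J, c j * pc j x

lemma syn_contDiff (J : Finset (Fin n → ℤ)) (c : (Fin n → ℤ) → ℂ) : ContDiff ℝ 1 (syn J c) := by
  unfold syn
  exact ContDiff.sum fun j _ => contDiff_const.mul (pc_contDiff j)

lemma syn_le (J : Finset (Fin n → ℤ)) (c : (Fin n → ℤ) → ℂ) (M : ℝ) (hM : ∀ j ∈ J, ‖c j‖ ≤ M) (hM0 : 0 ≤ M) (x : Es n) :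
    ‖syn J c x‖ ≤ M := by
  refine (norm_sum_le _ _).trans ?_
  calc _ ≤ ∑ j ∈ J, M * pj j x := Finset.sum_le_sum fun j hj => by
        rw [norm_mul, pc_norm]; exact mul_le_mul_of_nonneg_right (hM j hj) (pj_nonneg _ _)
    _ = M * ∑ j ∈ J, pj j x := by rw [Finset.mul_sum]
    _ ≤ M * 1 := by gcongr; exact pj_sum_le _ _
    _ = M := mul_one M

lemma syn_subset {J J' : Finset (Fin n → ℤ)} (h : J ⊆ J') (c : (Fin n → ℤ) → ℂ)
    (hc : ∀ j ∈ J', j ∉ J → c j = 0) : syn J c = syn J' c := by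
  ext x
  exact Finset.sum_subset h fun j hj hj' => by rw [hc j hj hj', zero_mul]

lemma syn_fderiv (n : ℕ) : ∃ C : ℝ, 0 < C ∧ ∀ (J : Finset (Fin n → ℤ)) (c : (Fin n → ℤ) → ℂ) (D : ℝ), 0 ≤ D →
    (∀ j, j ∉ J → c j = 0) → (∀ j j', ‖c j - c j'‖ ≤ D * nv (j - j')) →
    ∀ x, ‖fderiv ℝ (syn J c) x‖ ≤ C * D := by
  obtain ⟨G, hG, hG'⟩ := pc_fderiv_bound n
  refine ⟨2 * 5 ^ n * G, by positivity, fun J c D hD0 hc hD x => ?_⟩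
  obtain ⟨m, hm, hJ⟩ := exists_Bx_sub J (‖x‖ + 1)
  rw [syn_subset hJ c (fun j _ h => hc j h)]
  have hdiff : ∀ j : Fin n → ℤ, DifferentiableAt ℝ (pc j) x := fun j =>
    (pc_contDiff j).differentiable one_ne_zero x
  have hz : ∑ j ∈ Bx n m, fderiv ℝ (pc j) x = 0 := by
    rw [← fderiv_fun_sum fun j _ => hdiff j]
    have : (fun y => ∑ j ∈ Bx n m, pc j y) =ᶠ[nhds x] fun _ => (1 : ℂ) := by
      filter_upwards [Metric.ball_mem_nhds x one_pos] with y hy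
      have h1 : ∑ j ∈ Bx n m, pj j y = 1 := by
        refine Bx_sum_one fun t => (abs_coord_le y t).trans ?_
        rw [mem_ball, dist_eq_norm] at hy
        have := norm_le_norm_add_norm_sub x y
        rw [norm_sub_rev] at this
        linarith
      simp only [pc]
      exact_mod_cast h1
    rw [this.fderiv_eq]; simp
  refine ContinuousLinearMap.opNorm_le_bound _ (by positivity) fun v => ?_
  have e1 : fderiv ℝ (syn (Bx n m) c) x v = ∑ j ∈ Bx n m, (c j - c (fl x)) * fderiv ℝ (pc j) x v := by
    unfold syn
    rw [fderiv_fun_sum fun j _ => (hdiff j).const_mul _]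
    have hz' : ∑ j ∈ Bx n m, fderiv ℝ (pc j) x v = 0 := by
      have := DFunLike.congr_fun hz v
      simpa using this
    simp only [sub_mul]
    rw [Finset.sum_sub_distrib, ← Finset.mul_sum, hz', mul_zero, sub_zero, ContinuousLinearMap.sum_apply]
    refine Finset.sum_congr rfl fun j _ => ?_
    rw [fderiv_const_mul (hdiff j)]
    rfl
  rw [e1]
  classical
  rw [← Finset.sum_subset (s₁ := (Bx n m).filter (· ∈ nb (fl x) 2)) (Finset.filter_subset _ _)]
  · refine (norm_sum_le _ _).trans ?_
    have hb : ∀ j ∈ (Bx n m).filter (· ∈ nb (fl x) 2),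
        ‖(c j - c (fl x)) * fderiv ℝ (pc j) x v‖ ≤ 2 * D * (G * ‖v‖) := by
      intro j hj
      rw [norm_mul]
      have h1 := mem_nb.1 (Finset.mem_filter.1 hj).2
      refine mul_le_mul ((hD j _).trans ?_) (ContinuousLinearMap.le_of_opNorm_le _ (hG' j x) v) (norm_nonneg _) (by positivity)
      have h2 : (nv (j - fl x) : ℝ) ≤ 2 := by exact_mod_cast h1
      nlinarith
    refine (Finset.sum_le_card_nsmul _ _ _ hb).trans ?_
    have hcard : ((Bx n m).filter (· ∈ nb (fl x) 2)).card ≤ 5 ^ n := by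
      refine (Finset.card_le_card (t := nb (fl x) 2) ?_).trans (le_of_eq (by rw [card_nb]))
      intro j hj; exact (Finset.mem_filter.1 hj).2
    rw [nsmul_eq_mul]
    have : ((((Bx n m).filter (· ∈ nb (fl x) 2)).card : ℕ) : ℝ) ≤ 5 ^ n := by exact_mod_cast hcard
    calc _ ≤ (5:ℝ) ^ n * (2 * D * (G * ‖v‖)) := by gcongr
      _ = _ := by ring
  · intro j hj hj'
    have : ¬ ∀ t, |x t - j t| ≤ 1 := by
      intro h
      exact hj' (Finset.mem_filter.2 ⟨hj, mem_nb.2 (nv_fl h)⟩)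
    push Not at this
    obtain ⟨t, ht⟩ := this
    rw [pc_fderiv_zero ht]
    simp

end T1

namespace T1

variable {n : ℕ}

/-- compactly supported `C¹` functions -/
def C1c (F : Es n → ℂ) : Prop := ContDiff ℝ 1 F ∧ HasCompactSupport F

lemma C1c.memLp {F : Es n → ℂ} (h : C1c F) (p : ENNReal) : MemLp F p volume :=
  h.1.continuous.memLp_of_hasCompactSupport h.2

lemma C1c.add {F G : Es n → ℂ} (h : C1c F) (h' : C1c G) : C1c (F + G) := ⟨h.1.add h'.1, h.2.add h'.2⟩

lemma C1c.smul {F : Es n → ℂ} (h : C1c F) (c : ℂ) : C1c (c • F) := by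
  refine ⟨contDiff_const.smul h.1, ?_⟩
  exact h.2.mono (Function.support_const_smul_subset c F)

lemma C1c.zero : C1c (0 : Es n → ℂ) := ⟨contDiff_const, HasCompactSupport.zero⟩

lemma C1c.neg {F : Es n → ℂ} (h : C1c F) : C1c (-F) := by
  have := h.smul (-1)
  simpa using this

lemma C1c.sub {F G : Es n → ℂ} (h : C1c F) (h' : C1c G) : C1c (F - G) := by
  rw [sub_eq_add_neg]; exact h.add h'.neg

lemma pc_C1c (j : Fin n → ℤ) : C1c (pc j) := ⟨pc_contDiff j, pc_compact j⟩

lemma sq_int {u : Es n → ℂ} (hu : MemLp u 2 volume) : Integrable (fun x => ‖u x‖ ^ 2) volume := by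
  have := hu.integrable_norm_pow (p := 2) (by norm_num)
  simpa using this

lemma amgm {u w : Es n → ℂ} (hu : MemLp u 2 volume) (hw : MemLp w 2 volume) {l : ℝ} (hl : 0 < l) :
    ‖∫ x, u x * w x‖ ≤ l * (∫ x, ‖u x‖ ^ 2) + l⁻¹ * (∫ x, ‖w x‖ ^ 2) := by
  rw [← integral_const_mul, ← integral_const_mul, ← integral_add ((sq_int hu).const_mul _) ((sq_int hw).const_mul _)]
  refine norm_integral_le_of_norm_le (((sq_int hu).const_mul _).add ((sq_int hw).const_mul _)) ?_
  refine Filter.Eventually.of_forall fun x => ?_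
  rw [norm_mul]
  have h1 : 0 ≤ l⁻¹ * (l * ‖u x‖ - ‖w x‖) ^ 2 := by positivity
  have h2 : l⁻¹ * (l * ‖u x‖ - ‖w x‖) ^ 2 = l * ‖u x‖ ^ 2 - 2 * (‖u x‖ * ‖w x‖) + l⁻¹ * ‖w x‖ ^ 2 := by
    field_simp; ring
  have h3 : 0 ≤ ‖u x‖ * ‖w x‖ := by positivity
  linarith

/-- the mass of the bump -/
def ms (n : ℕ) : ℝ := ∫ x : Es n, ph x

lemma ms_pos (n : ℕ) : 0 < ms n := by
  have hc : HasCompactSupport (ph : Es n → ℝ) := by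
    have := pj_compact (0 : Fin n → ℤ)
    have h2 : (pj (0 : Fin n → ℤ)) = ph := by ext x; simp [pj, io_zero]
    rwa [h2] at this
  exact ph_contDiff.continuous.integral_pos_of_hasCompactSupport_nonneg_nonzero hc ph_nonneg
    (x := 0) (by rw [ph_at_zero]; exact one_ne_zero)

lemma int_pj (j : Fin n → ℤ) : ∫ x, pj j x = ms n := by
  unfold pj ms
  exact integral_sub_right_eq_self (fun x => ph x) (io j)

lemma pj_int (j : Fin n → ℤ) : Integrable (pj j) volume :=
  (pj_contDiff j).continuous.integrable_of_hasCompactSupport (pj_compact j)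

lemma pj_le_one (j : Fin n → ℤ) (x : Es n) : pj j x ≤ 1 := by
  simpa using pj_sum_le {j} x

lemma usq_pj {u : Es n → ℂ} (hu : MemLp u 2 volume) (i : Fin n → ℤ) :
    Integrable (fun x => ‖u x‖ ^ 2 * pj i x) volume := by
  refine (sq_int hu).mul_bdd (c := 1) (pj_contDiff i).continuous.aestronglyMeasurable ?_
  refine Filter.Eventually.of_forall fun x => ?_
  rw [Real.norm_eq_abs, abs_of_nonneg (pj_nonneg _ _)]
  exact pj_le_one i x

lemma bessel_one {u : Es n → ℂ} (hu : MemLp u 2 volume) (i : Fin n → ℤ) :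
    ‖∫ x, u x * pc i x‖ ^ 2 ≤ ms n * ∫ x, ‖u x‖ ^ 2 * pj i x := by
  set Y := ∫ x, ‖u x‖ * pj i x
  have hI : Integrable (fun x => ‖u x‖ * pj i x) volume := by
    have := (hu.integrable_mul ((pc_C1c i).memLp 2)).norm
    refine this.congr (Filter.Eventually.of_forall fun x => ?_)
    simp [pc_norm]
  have h1 : ‖∫ x, u x * pc i x‖ ≤ Y := by
    refine (norm_integral_le_integral_norm _).trans (le_of_eq ?_)
    refine integral_congr_ae (Filter.Eventually.of_forall fun x => ?_)
    simp [pc_norm]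
  have hm := ms_pos n
  have h2 : ∀ s : ℝ, 0 ≤ (∫ x, ‖u x‖ ^ 2 * pj i x) - 2 * s * Y + s ^ 2 * ms n := by
    intro s
    have : (∫ x, ‖u x‖ ^ 2 * pj i x) - 2 * s * Y + s ^ 2 * ms n = ∫ x, (‖u x‖ - s) ^ 2 * pj i x := by
      have hsub : Integrable (fun x => ‖u x‖ ^ 2 * pj i x - 2 * s * (‖u x‖ * pj i x)) volume :=
        (usq_pj hu i).sub (hI.const_mul _)
      rw [← int_pj i, ← integral_const_mul, ← integral_const_mul, ← integral_sub (usq_pj hu i) (hI.const_mul _),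
        ← integral_add hsub ((pj_int i).const_mul _)]
      refine integral_congr_ae (Filter.Eventually.of_forall fun x => ?_)
      simp only []
      ring
    rw [this]
    exact integral_nonneg fun x => mul_nonneg (sq_nonneg _) (pj_nonneg _ _)
  have h3 := h2 (Y / ms n)
  have h4 : 0 ≤ ms n * ((∫ x, ‖u x‖ ^ 2 * pj i x) - 2 * (Y / ms n) * Y + (Y / ms n) ^ 2 * ms n) := mul_nonneg hm.le h3
  have h5 : ms n * ((∫ x, ‖u x‖ ^ 2 * pj i x) - 2 * (Y / ms n) * Y + (Y / ms n) ^ 2 * ms n) =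
    ms n * (∫ x, ‖u x‖ ^ 2 * pj i x) - Y ^ 2 := by
      field_simp; ring
  have h6 : ‖∫ x, u x * pc i x‖ ^ 2 ≤ Y ^ 2 := by gcongr
  linarith

lemma bessel {u : Es n → ℂ} (hu : MemLp u 2 volume) (I : Finset (Fin n → ℤ)) :
    ∑ i ∈ I, ‖∫ x, u x * pc i x‖ ^ 2 ≤ ms n * ∫ x, ‖u x‖ ^ 2 := by
  refine (Finset.sum_le_sum fun i _ => bessel_one hu i).trans ?_
  rw [← Finset.mul_sum, ← integral_finsetSum _ (fun i _ => usq_pj hu i)]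
  refine mul_le_mul_of_nonneg_left ?_ (ms_pos n).le
  refine integral_mono (integrable_finsetSum _ fun i _ => usq_pj hu i) (sq_int hu) fun x => ?_
  simp only []
  rw [← Finset.mul_sum]
  exact mul_le_of_le_one_right (by positivity) (pj_sum_le I x)

/-- abstract Calderon-Zygmund form -/
structure CZO (Ψ : (Es n → ℂ) → (Es n → ℂ) → ℂ) (H : Es n → Es n → ℂ) (D : ℝ) : Prop where
  add : ∀ F F' G, C1c F → C1c F' → C1c G → Ψ (F + F') G = Ψ F G + Ψ F' G
  smul : ∀ (c : ℂ) F G, C1c F → C1c G → Ψ (c • F) G = c * Ψ F G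
  kernel : ∀ F G, C1c F → C1c G → Disjoint (tsupport F) (tsupport G) →
    Ψ F G = ∫ p : Es n × Es n, H p.1 p.2 * F p.2 * G p.1
  cont : ContinuousOn (fun p : Es n × Es n => H p.1 p.2) {p | p.1 ≠ p.2}
  size : ∀ x y, x ≠ y → ‖H x y‖ ≤ D / ‖x - y‖ ^ n
  diff : ∀ x y, x ≠ y → DifferentiableAt ℝ (fun x' => H x' y) x ∧
    ‖fderiv ℝ (fun x' => H x' y) x‖ ≤ D / ‖x - y‖ ^ (n + 1)
  test : ∀ (h : Es n → ℂ) (c : Es n) (r : ℝ), 0 < r → ContDiff ℝ 1 h → tsupport h ⊆ closedBall c r →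
    (∀ x, ‖h x‖ ≤ 1) → (∀ x, ‖fderiv ℝ h x‖ ≤ 1 / r) →
    ∃ u : Es n → ℂ, MemLp u 2 volume ∧ ∫ x, ‖u x‖ ^ 2 ≤ D ^ 2 * r ^ n ∧
      ∀ G, C1c G → Ψ h G = ∫ x, u x * G x
  supp : ∃ R : ℝ, ∀ F G, C1c F → C1c G → (∀ x ∈ closedBall 0 R, F x = 0) → Ψ F G = 0

namespace CZO
variable {Ψ : (Es n → ℂ) → (Es n → ℂ) → ℂ} {H : Es n → Es n → ℂ} {D : ℝ}

lemma zero (h : CZO Ψ H D) {G} (hG : C1c G) : Ψ 0 G = 0 := by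
  have := h.smul 0 0 G C1c.zero hG
  simpa using this

lemma sub (h : CZO Ψ H D) {F F' G} (hF : C1c F) (hF' : C1c F') (hG : C1c G) :
    Ψ (F - F') G = Ψ F G - Ψ F' G := by
  have h1 := h.smul (-1) F' G hF' hG
  have h2 := h.add F ((-1 : ℂ) • F') G hF (hF'.smul _) hG
  rw [h1] at h2
  rw [sub_eq_add_neg, ← neg_one_smul ℂ F', h2]; ring

lemma syn_eq (J : Finset (Fin n → ℤ)) (c : (Fin n → ℤ) → ℂ) : syn J c = ∑ j ∈ J, c j • pc j := by
  ext x; simp [syn]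

lemma C1c_syn (J : Finset (Fin n → ℤ)) (c : (Fin n → ℤ) → ℂ) : C1c (syn J c) := by
  classical
  rw [syn_eq]
  induction J using Finset.induction_on with
  | empty => simpa using C1c.zero
  | insert j J hj ih => rw [Finset.sum_insert hj]; exact ((pc_C1c j).smul _).add ih

lemma syn (h : CZO Ψ H D) (J : Finset (Fin n → ℤ)) (c : (Fin n → ℤ) → ℂ) {G} (hG : C1c G) :
    Ψ (syn J c) G = ∑ j ∈ J, c j * Ψ (pc j) G := by
  classical
  induction J using Finset.induction_on with
  | empty =>
    rw [syn_eq]; simpa using h.zero hG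
  | insert j J hj ih =>
    rw [syn_eq, Finset.sum_insert hj, ← syn_eq, h.add _ _ _ ((pc_C1c j).smul _) (C1c_syn J c) hG,
      h.smul _ _ _ (pc_C1c j) hG, ih, Finset.sum_insert hj]

lemma test' (h : CZO Ψ H D) {f : Es n → ℂ} {c : Es n} {r M : ℝ} (hr : 0 < r) (hM : 0 < M)
    (hf : ContDiff ℝ 1 f) (hs : tsupport f ⊆ closedBall c r) (h1 : ∀ x, ‖f x‖ ≤ M)
    (h2 : ∀ x, ‖fderiv ℝ f x‖ ≤ M / r) :
    ∃ u : Es n → ℂ, MemLp u 2 volume ∧ ∫ x, ‖u x‖ ^ 2 ≤ M ^ 2 * (D ^ 2 * r ^ n) ∧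
      ∀ G, C1c G → Ψ f G = ∫ x, u x * G x := by
  have hcs : HasCompactSupport f :=
    (isCompact_closedBall c r).of_isClosed_subset (isClosed_tsupport _) hs
  have hC : C1c f := ⟨hf, hcs⟩
  have hMC : (M : ℂ) ≠ 0 := by exact_mod_cast hM.ne'
  have hC' := hC.smul ((M : ℂ)⁻¹)
  have hnM : ‖((M : ℂ)⁻¹)‖ = M⁻¹ := by
    rw [norm_inv, Complex.norm_real, Real.norm_of_nonneg hM.le]
  obtain ⟨u, hu, hu2, hu3⟩ := h.test ((M : ℂ)⁻¹ • f) c r hr hC'.1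
    ((closure_mono (Function.support_const_smul_subset _ f)).trans hs)
    (fun x => by
      rw [Pi.smul_apply, norm_smul, hnM, inv_mul_le_iff₀ hM]; simpa using h1 x)
    (fun x => by
      refine ContinuousLinearMap.opNorm_le_bound _ (by positivity) fun v => ?_
      have hd : fderiv ℝ ((M : ℂ)⁻¹ • f) x v = (M : ℂ)⁻¹ * fderiv ℝ f x v := by
        rw [fderiv_const_smul (hf.differentiable one_ne_zero x)]; rfl
      rw [hd, norm_mul, hnM, inv_mul_le_iff₀ hM]
      refine (ContinuousLinearMap.le_of_opNorm_le _ (h2 x) v).trans (le_of_eq ?_)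
      ring)
  refine ⟨(M : ℂ) • u, hu.const_smul _, ?_, fun G hG => ?_⟩
  · have : ∀ x, ‖((M : ℂ) • u) x‖ ^ 2 = M ^ 2 * ‖u x‖ ^ 2 := fun x => by
      rw [Pi.smul_apply, norm_smul, Complex.norm_real, Real.norm_of_nonneg hM.le, mul_pow]
    simp_rw [this]
    rw [integral_const_mul]
    gcongr
  · have h3 := hu3 G hG
    rw [h.smul _ _ _ hC hG] at h3
    have h4 : ∀ x, ((M : ℂ) • u) x * G x = (M : ℂ) * (u x * G x) := fun x => by
      simp [mul_assoc]
    simp_rw [h4]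
    rw [integral_const_mul, ← h3]
    field_simp

end CZO
end T1

namespace T1

variable {n : ℕ}

lemma vol_haar (n : ℕ) : (volume : Measure (Es n × Es n)).IsAddHaarMeasure :=
  inferInstanceAs (Measure.IsAddHaarMeasure ((volume : Measure (Es n)).prod volume))

lemma nv_attained (hn : 1 ≤ n) (v : Fin n → ℤ) : ∃ t, nv v = (v t).natAbs := by
  have hne : (Finset.univ : Finset (Fin n)).Nonempty := ⟨⟨0, hn⟩, Finset.mem_univ _⟩
  obtain ⟨t, _, ht⟩ := Finset.exists_mem_eq_sup Finset.univ hne (fun t => (v t).natAbs)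
  exact ⟨t, ht⟩

lemma sep (hn : 1 ≤ n) {i j : Fin n → ℤ} {x y : Es n} {a b : ℝ} (hx : ∀ t, |x t - i t| ≤ a)
    (hy : ∀ t, |y t - j t| ≤ b) : (nv (i - j) : ℝ) - a - b ≤ ‖x - y‖ := by
  obtain ⟨t, ht⟩ := nv_attained hn (i - j)
  refine le_trans ?_ (abs_coord_le (x - y) t)
  rw [ht, natAbs_real]
  have h1 := abs_le.1 (hx t)
  have h2 := abs_le.1 (hy t)
  have h3 := abs_le.1 (le_refl |x t - y t|)
  simp only [Pi.sub_apply, Int.cast_sub, PiLp.sub_apply]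
  have : |(i t : ℝ) - j t| ≤ |x t - y t| + a + b := by
    rw [abs_le]; constructor <;> linarith
  linarith

lemma pc_ts {i : Fin n → ℤ} {x : Es n} (hx : x ∈ tsupport (pc i)) : ∀ t, |x t - i t| ≤ 1 :=
  pj_tsupport i (pc_tsupport i hx)

lemma int_norm_pc (j : Fin n → ℤ) : ∫ x, ‖pc j x‖ = ms n := by
  simp_rw [pc_norm]; exact int_pj j

lemma kint_bound {H : Es n → Es n → ℂ} {F G : Es n → ℂ} (hF : C1c F) (hG : C1c G) {B : ℝ}
    (hB : ∀ x ∈ tsupport G, ∀ y ∈ tsupport F, ‖H x y‖ ≤ B) :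
    ‖∫ p : Es n × Es n, H p.1 p.2 * F p.2 * G p.1‖ ≤ B * ((∫ x, ‖G x‖) * ∫ x, ‖F x‖) := by
  have hI : Integrable (fun p : Es n × Es n => ‖G p.1‖ * ‖F p.2‖) (volume.prod volume) :=
    ((memLp_one_iff_integrable.1 (hG.memLp 1)).norm).mul_prod ((memLp_one_iff_integrable.1 (hF.memLp 1)).norm)
  rw [← integral_prod_mul (μ := volume) (ν := volume) (fun x => ‖G x‖) (fun x => ‖F x‖), ← integral_const_mul]
  refine norm_integral_le_of_norm_le (hI.const_mul _) (Filter.Eventually.of_forall fun p => ?_)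
  simp only [norm_mul]
  by_cases h1 : p.1 ∈ tsupport G
  · by_cases h2 : p.2 ∈ tsupport F
    · calc _ ≤ B * ‖F p.2‖ * ‖G p.1‖ := by gcongr; exact hB _ h1 _ h2
        _ = _ := by ring
    · simp [image_eq_zero_of_notMem_tsupport h2]
  · simp [image_eq_zero_of_notMem_tsupport h1]

lemma kint_cont {H : Es n → Es n → ℂ} {F G : Es n → ℂ} (hF : C1c F) (hG : C1c G)
    (hH : ContinuousOn (fun p : Es n × Es n => H p.1 p.2) {p | p.1 ≠ p.2})
    (hd : Disjoint (tsupport F) (tsupport G)) :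
    Continuous (fun p : Es n × Es n => H p.1 p.2 * F p.2 * G p.1) := by
  rw [continuous_iff_continuousAt]
  intro p
  have hF' := hF.1.continuous
  have hG' := hG.1.continuous
  by_cases h1 : p.1 ∈ tsupport G
  · by_cases h2 : p.2 ∈ tsupport F
    · have hne : p.1 ≠ p.2 := fun h => Set.disjoint_left.1 hd h2 (h ▸ h1)
      have ho : IsOpen {p : Es n × Es n | p.1 ≠ p.2} := isOpen_ne_fun continuous_fst continuous_snd
      have := hH.continuousAt (ho.mem_nhds hne)
      exact (this.mul (by fun_prop)).mul (by fun_prop)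
    · have : ∀ᶠ q : Es n × Es n in nhds p, q.2 ∉ tsupport F :=
        continuousAt_snd.eventually ((isClosed_tsupport F).isOpen_compl.mem_nhds h2)
      refine (continuousAt_const (y := (0:ℂ))).congr ?_
      filter_upwards [this] with q hq
      simp [image_eq_zero_of_notMem_tsupport hq]
  · have : ∀ᶠ q : Es n × Es n in nhds p, q.1 ∉ tsupport G :=
      continuousAt_fst.eventually ((isClosed_tsupport G).isOpen_compl.mem_nhds h1)
    refine (continuousAt_const (y := (0:ℂ))).congr ?_
    filter_upwards [this] with q hq
    simp [image_eq_zero_of_notMem_tsupport hq]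

lemma kint_int {H : Es n → Es n → ℂ} {F G : Es n → ℂ} (hF : C1c F) (hG : C1c G)
    (hH : ContinuousOn (fun p : Es n × Es n => H p.1 p.2) {p | p.1 ≠ p.2})
    (hd : Disjoint (tsupport F) (tsupport G)) :
    Integrable (fun p : Es n × Es n => H p.1 p.2 * F p.2 * G p.1) := by
  refine (kint_cont hF hG hH hd).integrable_of_hasCompactSupport ?_
  refine HasCompactSupport.intro (hG.2.isCompact.prod hF.2.isCompact) fun p hp => ?_
  by_cases h1 : p.1 ∈ tsupport G
  · have h2 : p.2 ∉ tsupport F := fun h2 => hp ⟨h1, h2⟩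
    simp [image_eq_zero_of_notMem_tsupport h2]
  · simp [image_eq_zero_of_notMem_tsupport h1]

namespace CZO
variable {Ψ : (Es n → ℂ) → (Es n → ℂ) → ℂ} {H : Es n → Es n → ℂ} {D : ℝ}

lemma pc_disj (hn : 1 ≤ n) {i j : Fin n → ℤ} (h : 3 ≤ nv (i - j)) :
    Disjoint (tsupport (pc j)) (tsupport (pc i)) := by
  rw [Set.disjoint_left]
  intro x hx hx'
  have := sep hn (pc_ts hx') (pc_ts hx)
  have h3 : (3:ℝ) ≤ nv (i - j) := by exact_mod_cast h
  simp at this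
  linarith

lemma far_size (hn : 1 ≤ n) (hD : 0 < D) (h : CZO Ψ H D) {i j : Fin n → ℤ} (hij : 3 ≤ nv (i - j)) :
    ‖Ψ (pc j) (pc i)‖ ≤ (3 ^ n * ms n ^ 2) * D * ((nv (i - j) : ℝ) ^ n)⁻¹ := by
  have h3 : (3:ℝ) ≤ nv (i - j) := by exact_mod_cast hij
  rw [h.kernel _ _ (pc_C1c j) (pc_C1c i) (pc_disj hn hij)]
  refine (kint_bound (pc_C1c j) (pc_C1c i) (B := D * (3 ^ n * ((nv (i - j) : ℝ) ^ n)⁻¹)) ?_).trans (le_of_eq ?_)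
  · intro x hx y hy
    have h1 := sep hn (pc_ts hx) (pc_ts hy)
    have h2 : (nv (i - j) : ℝ) / 3 ≤ ‖x - y‖ := by linarith
    have hne : x ≠ y := by
      rintro rfl
      simp at h2; linarith
    refine (h.size x y hne).trans ?_
    rw [div_eq_mul_inv]
    gcongr
    calc (‖x - y‖ ^ n)⁻¹ ≤ (((nv (i - j) : ℝ) / 3) ^ n)⁻¹ := by gcongr
      _ = _ := by rw [div_pow, inv_div, div_eq_mul_inv]
  · rw [int_norm_pc, int_norm_pc]; ring

lemma far_smooth (hn : 1 ≤ n) (hD : 0 < D) (h : CZO Ψ H D) {i i' j : Fin n → ℤ} (h4 : 4 ≤ nv (i - j))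
    (hs : 4 * nv (i - i') ≤ nv (i - j)) :
    ‖Ψ (pc j) (pc i) - Ψ (pc j) (pc i')‖ ≤
      (n * 4 ^ (n + 1) * ms n ^ 2) * D * (nv (i - i') * ((nv (i - j) : ℝ) ^ (n + 1))⁻¹) := by
  have h4' : (4:ℝ) ≤ nv (i - j) := by exact_mod_cast h4
  have hs' : 4 * (nv (i - i') : ℝ) ≤ nv (i - j) := by exact_mod_cast hs
  have hi'j : 3 ≤ nv (i' - j) := by
    have := nv_sub_le i i' j
    omega
  haveI := vol_haar n
  set v : Es n := io (i' - i) with hv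
  have hdij := pc_disj hn (show 3 ≤ nv (i - j) by omega)
  have hdij' := pc_disj hn hi'j
  have hI := kint_int (pc_C1c j) (pc_C1c i) h.cont hdij
  have hI' := kint_int (pc_C1c j) (pc_C1c i') h.cont hdij'
  have hI'' := hI'.comp_add_right ((v, 0) : Es n × Es n)
  have hpc : ∀ x, pc i' (x + v) = pc i x := by
    intro x
    rw [pc_eq i', pc_eq i]
    simp only [hv, io_sub]
    congr 1; abel
  rw [h.kernel _ _ (pc_C1c j) (pc_C1c i) hdij, h.kernel _ _ (pc_C1c j) (pc_C1c i') hdij']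
  have e1 : ∫ p : Es n × Es n, H p.1 p.2 * pc j p.2 * pc i' p.1 =
      ∫ p : Es n × Es n, H (p.1 + v) p.2 * pc j p.2 * pc i p.1 := by
    rw [← integral_add_right_eq_self _ ((v, 0) : Es n × Es n)]
    simp only [Prod.fst_add, Prod.snd_add, add_zero, hpc]
  simp only [Prod.fst_add, Prod.snd_add, add_zero, hpc] at hI''
  rw [e1, ← integral_sub hI hI'']
  have e2 : ∀ p : Es n × Es n, H p.1 p.2 * pc j p.2 * pc i p.1 - H (p.1 + v) p.2 * pc j p.2 * pc i p.1 =
      (fun x y => H x y - H (x + v) y) p.1 p.2 * pc j p.2 * pc i p.1 := fun p => by simp only []; ring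
  simp_rw [e2]
  refine (kint_bound (H := fun x y => H x y - H (x + v) y) (pc_C1c j) (pc_C1c i)
    (B := D * (4 ^ (n + 1) * ((nv (i - j) : ℝ) ^ (n + 1))⁻¹) * (n * nv (i - i'))) ?_).trans (le_of_eq ?_)
  · intro x hx y hy
    have hseg : ∀ z ∈ segment ℝ x (x + v), (nv (i - j) : ℝ) / 4 ≤ ‖z - y‖ := by
      intro z hz
      rw [segment_eq_image'] at hz
      obtain ⟨θ, hθ, rfl⟩ := hz
      have hz' : ∀ t, |(x + θ • (x + v - x)) t - i t| ≤ 1 + nv (i - i') := by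
        intro t
        have h1 := pc_ts hx t
        have h2 : |v t| ≤ nv (i - i') := by
          rw [hv, io_apply, ← natAbs_real, nv_sub_comm]
          exact Nat.cast_le.2 (natAbs_le_nv _ t)
        have h3 : (x + θ • (x + v - x)) t - i t = (x t - i t) + θ * v t := by
          simp; ring
        rw [h3]
        refine (abs_add_le _ _).trans (add_le_add h1 ?_)
        rw [abs_mul, abs_of_nonneg hθ.1]
        calc θ * |v t| ≤ 1 * |v t| := by gcongr; exact hθ.2
          _ ≤ _ := by rw [one_mul]; exact h2
      have := sep hn hz' (pc_ts hy)
      linarith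
    have hpos : (0:ℝ) < nv (i - j) / 4 := by linarith
    have hbd : ∀ z ∈ segment ℝ x (x + v), DifferentiableAt ℝ (fun x' => H x' y) z ∧
        ‖fderiv ℝ (fun x' => H x' y) z‖ ≤ D * (4 ^ (n + 1) * ((nv (i - j) : ℝ) ^ (n + 1))⁻¹) := by
      intro z hz
      have h1 := hseg z hz
      have hne : z ≠ y := by
        rintro rfl
        simp at h1; linarith
      refine ⟨(h.diff z y hne).1, (h.diff z y hne).2.trans ?_⟩
      rw [div_eq_mul_inv]
      gcongr
      calc (‖z - y‖ ^ (n + 1))⁻¹ ≤ (((nv (i - j) : ℝ) / 4) ^ (n + 1))⁻¹ := by gcongr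
        _ = _ := by rw [div_pow, inv_div, div_eq_mul_inv]
    have := (convex_segment x (x + v)).norm_image_sub_le_of_norm_fderiv_le (𝕜 := ℝ) (f := fun x' => H x' y)
      (fun z hz => (hbd z hz).1) (fun z hz => (hbd z hz).2) (right_mem_segment ℝ x (x + v)) (left_mem_segment ℝ x (x + v))
    refine this.trans ?_
    gcongr
    have h5 : x - (x + v) = -v := by abel
    rw [h5, norm_neg, nv_sub_comm]
    exact norm_io_le _
  · rw [int_norm_pc, int_norm_pc]; ring

lemma testsum (h : CZO Ψ H D) {f : Es n → ℂ} {c : Es n} {r M : ℝ} (hr : 0 < r) (hM : 0 < M)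
    (hf : ContDiff ℝ 1 f) (hs : tsupport f ⊆ closedBall c r) (h1 : ∀ x, ‖f x‖ ≤ M)
    (h2 : ∀ x, ‖fderiv ℝ f x‖ ≤ M / r) (I : Finset (Fin n → ℤ)) :
    ∑ i ∈ I, ‖Ψ f (pc i)‖ ^ 2 ≤ ms n * (M ^ 2 * (D ^ 2 * r ^ n)) := by
  obtain ⟨u, hu, hu2, hu3⟩ := h.test' hr hM hf hs h1 h2
  simp_rw [fun i => hu3 (pc i) (pc_C1c i)]
  exact (bessel hu I).trans (mul_le_mul_of_nonneg_left hu2 (ms_pos n).le)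

lemma near_size (n : ℕ) (hn : 1 ≤ n) : ∃ C : ℝ, 0 < C ∧ ∀ (Ψ : (Es n → ℂ) → (Es n → ℂ) → ℂ) (H : Es n → Es n → ℂ) (D : ℝ),
    0 < D → CZO Ψ H D → ∀ i j, ‖Ψ (pc j) (pc i)‖ ≤ C * D := by
  obtain ⟨G, hG, hG'⟩ := pc_fderiv_bound n
  have hm := ms_pos n
  have hn' : (0:ℝ) < n := by exact_mod_cast hn
  refine ⟨Real.sqrt (ms n * ((1 + G * n) ^ 2 * n ^ n)), by positivity, fun Ψ H D hD h i j => ?_⟩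
  have := h.testsum (f := pc j) (c := io j) (r := n) (M := 1 + G * n) hn' (by positivity) (pc_contDiff j)
    ((pc_tsupport j).trans (pj_tsupport' j))
    (fun x => by rw [pc_norm]; have := pj_le_one j x; nlinarith)
    (fun x => (hG' j x).trans (by rw [le_div_iff₀ hn']; linarith)) {i}
  rw [Finset.sum_singleton] at this
  refine abs_le_of_sq_le_sq' ?_ (by positivity) |>.2
  rw [mul_pow, Real.sq_sqrt (by positivity)]
  linarith

lemma syn_tsupport (J : Finset (Fin n → ℤ)) (c : (Fin n → ℤ) → ℂ) (x0 : Es n) (r : ℝ)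
    (hJ : ∀ j ∈ J, c j ≠ 0 → ‖io j - x0‖ ≤ r) : tsupport (T1.syn J c) ⊆ closedBall x0 (r + n) := by
  refine closure_minimal ?_ isClosed_closedBall
  intro x hx
  obtain ⟨j, hj, hne⟩ := Finset.exists_ne_zero_of_sum_ne_zero hx
  have h1 : c j ≠ 0 := left_ne_zero_of_mul hne
  have h2 : pc j x ≠ 0 := right_ne_zero_of_mul hne
  have h3 := pj_tsupport' j (pc_tsupport j (subset_tsupport _ h2))
  rw [mem_closedBall, dist_eq_norm] at h3 ⊢
  have : x - x0 = (x - io j) + (io j - x0) := by abel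
  rw [this]
  linarith [norm_add_le (x - io j) (io j - x0), hJ j hj h1]

lemma test_syn (n : ℕ) (hn : 1 ≤ n) : ∃ C : ℝ, 0 < C ∧ ∀ (Ψ : (Es n → ℂ) → (Es n → ℂ) → ℂ) (H : Es n → Es n → ℂ) (D : ℝ),
    0 < D → CZO Ψ H D → ∀ (L : ℕ), 0 < L → ∀ (i0 : Fin n → ℤ) (c : (Fin n → ℤ) → ℝ), (∀ j, 0 ≤ c j) → (∀ j, c j ≤ 1) →
    (∀ j j', |c j - c j'| ≤ nv (j - j') / L) → (∀ j, 2 * L ≤ nv (j - i0) → c j = 0) →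
    ∀ I : Finset (Fin n → ℤ), ∑ i ∈ I, ‖∑ j ∈ nb i0 (2 * L), Ψ (pc j) (pc i) * (c j : ℂ)‖ ^ 2 ≤ C * D ^ 2 * (L : ℝ) ^ n := by
  obtain ⟨G, hG, hG'⟩ := syn_fderiv n
  have hm := ms_pos n
  have hn' : (1:ℝ) ≤ n := by exact_mod_cast hn
  refine ⟨ms n * ((1 + 3 * n * G) ^ 2 * (3 * n) ^ n), by positivity, fun Ψ H D hD h L hL i0 c hc0 hc1 hc2 hc3 I => ?_⟩
  have hL' : (1:ℝ) ≤ L := by exact_mod_cast hL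
  set J := nb i0 (2 * L)
  have e1 : ∀ i, ∑ j ∈ J, Ψ (pc j) (pc i) * (c j : ℂ) = Ψ (T1.syn J fun j => (c j : ℂ)) (pc i) := by
    intro i
    rw [h.syn _ _ (pc_C1c i)]
    exact Finset.sum_congr rfl fun j _ => mul_comm _ _
  simp_rw [e1]
  have := h.testsum (f := T1.syn J fun j => (c j : ℂ)) (c := io i0) (r := 3 * n * L) (M := 1 + 3 * n * G) (by positivity)
    (by positivity) (syn_contDiff _ _) ?_ ?_ ?_ I
  · refine this.trans (le_of_eq ?_)
    rw [mul_pow (3 * (n:ℝ))]; ring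
  · refine (syn_tsupport J _ (io i0) (n * (2 * L)) ?_).trans (closedBall_subset_closedBall ?_)
    · intro j hj _
      rw [← io_sub]
      refine (norm_io_le _).trans ?_
      have : (nv (j - i0) : ℝ) ≤ 2 * L := by exact_mod_cast mem_nb.1 hj
      gcongr
    · nlinarith
  · intro x
    refine (syn_le J _ 1 (fun j _ => ?_) zero_le_one x).trans (by nlinarith)
    rw [Complex.norm_real, Real.norm_of_nonneg (hc0 j)]; exact hc1 j
  · intro x
    refine (hG' J (fun j => (c j : ℂ)) (1 / L) (by positivity) ?_ ?_ x).trans ?_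
    · intro j hj
      have : ¬ nv (j - i0) ≤ 2 * L := fun hh => hj (mem_nb.2 hh)
      simp only [hc3 j (by omega)]; simp
    · intro j j'
      rw [← Complex.ofReal_sub, Complex.norm_real, Real.norm_eq_abs]
      refine (hc2 j j').trans (le_of_eq (by ring))
    · rw [le_div_iff₀ (by positivity)]
      field_simp
      nlinarith

lemma toCZ (n : ℕ) (hn : 1 ≤ n) : ∃ C : ℝ, 0 < C ∧ ∀ (Ψ : (Es n → ℂ) → (Es n → ℂ) → ℂ) (H : Es n → Es n → ℂ) (D : ℝ),
    0 < D → CZO Ψ H D → ∀ N : ℕ, (∀ i j, i ∉ Bx n N ∨ j ∉ Bx n N → Ψ (pc j) (pc i) = 0) →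
    CZ n N (fun i j => ((C * D : ℝ) : ℂ)⁻¹ * Ψ (pc j) (pc i)) := by
  obtain ⟨C1, hC1, h1⟩ := near_size n hn
  obtain ⟨C2, hC2, h2⟩ := test_syn n hn
  have hm := ms_pos n
  set C : ℝ := C1 * 2 ^ n + (3 ^ n * ms n ^ 2) + (n * 4 ^ (n + 1) * ms n ^ 2) + (C2 + 1) with hC
  have hCp : 0 < C := by positivity
  refine ⟨C, hCp, fun Ψ H D hD h N hN => ?_⟩
  have hCD : 0 < C * D := by positivity
  have hnorm : ‖((C * D : ℝ) : ℂ)⁻¹‖ = (C * D)⁻¹ := by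
    rw [norm_inv, Complex.norm_real, Real.norm_of_nonneg hCD.le]
  refine ⟨?_, ?_, ?_, ?_⟩
  · intro i j hij
    rw [hN i j hij, mul_zero]
  · intro i j hij
    have hq : 0 < nv (i - j) := nv_pos (sub_ne_zero.2 hij)
    have hq' : (0:ℝ) < nv (i - j) := by exact_mod_cast hq
    rw [norm_mul, hnorm, inv_mul_le_iff₀ hCD]
    by_cases h3 : 3 ≤ nv (i - j)
    · refine (h.far_size hn hD h3).trans ?_
      gcongr
      rw [hC]
      have : 0 ≤ C1 * 2 ^ n + (n * 4 ^ (n + 1) * ms n ^ 2) + (C2 + 1) := by positivity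
      linarith
    · refine (h1 Ψ H D hD h i j).trans ?_
      have hle : (nv (i - j) : ℝ) ≤ 2 := by exact_mod_cast (show nv (i - j) ≤ 2 by omega)
      have h4 : C1 * 2 ^ n ≤ C := by
        rw [hC]
        have : 0 ≤ (3 ^ n * ms n ^ 2) + (n * 4 ^ (n + 1) * ms n ^ 2) + (C2 + 1) := by positivity
        linarith
      rw [← div_eq_mul_inv, le_div_iff₀ (by positivity)]
      calc C1 * D * (nv (i - j) : ℝ) ^ n ≤ C1 * D * 2 ^ n := by gcongr
        _ = C1 * 2 ^ n * D := by ring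
        _ ≤ C * D := by gcongr
  · intro i i' j h0 hs
    rw [← mul_sub, norm_mul, hnorm, inv_mul_le_iff₀ hCD]
    by_cases hii : i = i'
    · subst hii; simp [nv_zero]
    have hq : 0 < nv (i - i') := nv_pos (sub_ne_zero.2 hii)
    have hs' : 4 * nv (i - i') ≤ nv (i - j) := by
      refine le_trans ?_ hs
      gcongr
      omega
    refine (h.far_smooth hn hD (i := i) (i' := i') (j := j) (by omega) hs').trans ?_
    gcongr
    rw [hC]
    have : 0 ≤ C1 * 2 ^ n + (3 ^ n * ms n ^ 2) + (C2 + 1) := by positivity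
    linarith
  · intro L hL i0 c hc0 hc1 hc2 hc3 I
    have e1 : ∀ i, ∑ j ∈ Bx n N, ((C * D : ℝ) : ℂ)⁻¹ * Ψ (pc j) (pc i) * (c j : ℂ) =
        ((C * D : ℝ) : ℂ)⁻¹ * ∑ j ∈ nb i0 (2 * L), Ψ (pc j) (pc i) * (c j : ℂ) := by
      intro i
      classical
      rw [Finset.mul_sum]
      have e2 : ∑ j ∈ Bx n N, ((C * D : ℝ) : ℂ)⁻¹ * Ψ (pc j) (pc i) * (c j : ℂ) =
          ∑ j ∈ Bx n N ∪ nb i0 (2 * L), ((C * D : ℝ) : ℂ)⁻¹ * Ψ (pc j) (pc i) * (c j : ℂ) := by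
        refine Finset.sum_subset Finset.subset_union_left fun j _ hj => ?_
        rw [hN i j (Or.inr hj)]; simp
      have e3 : ∑ j ∈ nb i0 (2 * L), ((C * D : ℝ) : ℂ)⁻¹ * (Ψ (pc j) (pc i) * (c j : ℂ)) =
          ∑ j ∈ Bx n N ∪ nb i0 (2 * L), ((C * D : ℝ) : ℂ)⁻¹ * (Ψ (pc j) (pc i) * (c j : ℂ)) := by
        refine Finset.sum_subset Finset.subset_union_right fun j _ hj => ?_
        have : ¬ nv (j - i0) ≤ 2 * L := fun hh => hj (mem_nb.2 hh)
        rw [hc3 j (by omega)]; simp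
      rw [e2, e3]
      exact Finset.sum_congr rfl fun j _ => mul_assoc _ _ _
    simp_rw [e1, norm_mul, hnorm, mul_pow]
    rw [← Finset.mul_sum, inv_pow, inv_mul_le_iff₀ (by positivity)]
    refine (h2 Ψ H D hD h L hL i0 c hc0 hc1 hc2 hc3 I).trans ?_
    rw [mul_pow]
    gcongr
    have hCge : C2 + 1 ≤ C := by
      rw [hC]
      have : 0 ≤ C1 * 2 ^ n + (3 ^ n * ms n ^ 2) + (n * 4 ^ (n + 1) * ms n ^ 2) := by positivity
      linarith
    nlinarith

end CZO
end T1

namespace T1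

variable {n : ℕ}

lemma vol_ball_le {w : Es n → ℂ} {R B : ℝ} (hR : 0 ≤ R) (hs : tsupport w ⊆ closedBall 0 R)
    (hB : ∀ x, ‖w x‖ ≤ B) : ∫ x, ‖w x‖ ^ 2 ≤ B ^ 2 * (R ^ n * volume.real (closedBall (0 : Es n) 1)) := by
  have h1 : ∫ x, ‖w x‖ ^ 2 = ∫ x in closedBall (0 : Es n) R, ‖w x‖ ^ 2 := by
    rw [setIntegral_eq_integral_of_forall_compl_eq_zero]
    intro x hx
    have : x ∉ tsupport w := fun h => hx (hs h)
    simp [image_eq_zero_of_notMem_tsupport this]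
  have hfin : volume (closedBall (0 : Es n) R) < ⊤ := measure_closedBall_lt_top
  have h2 := norm_setIntegral_le_of_norm_le_const (μ := volume) (f := fun x => ‖w x‖ ^ 2) (C := B ^ 2) hfin
    (fun x _ => by
      rw [Real.norm_of_nonneg (by positivity)]
      exact pow_le_pow_left₀ (norm_nonneg _) (hB x) 2)
  rw [h1]
  refine (le_abs_self _).trans (h2.trans (le_of_eq ?_))
  rw [Measure.real, Measure.addHaar_closedBall' _ _ hR, ENNReal.toReal_mul, ENNReal.toReal_ofReal (by positivity),
    finrank_euclideanSpace_fin]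
  rfl

/-- averaged coefficients -/
def cf (F : Es n → ℂ) (j : Fin n → ℤ) : ℂ := ((ms n : ℝ) : ℂ)⁻¹ * ∫ x, F x * pc j x

lemma norm_ms_inv (n : ℕ) : ‖((ms n : ℝ) : ℂ)⁻¹‖ = (ms n)⁻¹ := by
  rw [norm_inv, Complex.norm_real, Real.norm_of_nonneg (ms_pos n).le]

lemma avg_le {w : Es n → ℂ} {B : ℝ} {j : Fin n → ℤ} (hw : ∀ x ∈ tsupport (pc j), ‖w x‖ ≤ B) :
    ‖((ms n : ℝ) : ℂ)⁻¹ * ∫ x, w x * pc j x‖ ≤ B := by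
  rw [norm_mul, norm_ms_inv, inv_mul_le_iff₀ (ms_pos n)]
  rw [mul_comm, ← int_pj j, ← integral_const_mul]
  refine norm_integral_le_of_norm_le ((pj_int j).const_mul _) (Filter.Eventually.of_forall fun x => ?_)
  rw [norm_mul, pc_norm]
  by_cases h : x ∈ tsupport (pc j)
  · exact mul_le_mul_of_nonneg_right (hw x h) (pj_nonneg _ _)
  · have : pj j x = 0 := by
      rw [← pc_norm, image_eq_zero_of_notMem_tsupport h, norm_zero]
    rw [this]; simp

lemma cf_le {F : Es n → ℂ} {M : ℝ} (hM : ∀ x, ‖F x‖ ≤ M) (j : Fin n → ℤ) : ‖cf F j‖ ≤ M :=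
  avg_le fun x _ => hM x

lemma lip_of {F : Es n → ℂ} {B : ℝ} (hF : ContDiff ℝ 1 F) (hB : ∀ x, ‖fderiv ℝ F x‖ ≤ B) (x y : Es n) :
    ‖F y - F x‖ ≤ B * ‖y - x‖ :=
  (convex_univ).norm_image_sub_le_of_norm_fderiv_le (𝕜 := ℝ) (fun z _ => hF.differentiable one_ne_zero z)
    (fun z _ => hB z) (Set.mem_univ x) (Set.mem_univ y)

lemma int_pc (j : Fin n → ℤ) : ∫ x, pc j x = ((ms n : ℝ) : ℂ) := by
  rw [← int_pj j]
  exact integral_ofReal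

lemma int_mul_pc {F : Es n → ℂ} (hF : Continuous F) (j : Fin n → ℤ) : Integrable (fun x => F x * pc j x) :=
  (hF.mul (pc_contDiff j).continuous).integrable_of_hasCompactSupport ((pc_compact j).mul_left)

lemma cf_close {F : Es n → ℂ} {B : ℝ} (hF : ContDiff ℝ 1 F) (hB : ∀ x, ‖fderiv ℝ F x‖ ≤ B) (hB0 : 0 ≤ B)
    {x : Es n} {j : Fin n → ℤ} (hx : ∀ t, |x t - j t| ≤ 1) : ‖cf F j - F x‖ ≤ B * (n * 2) := by
  have e : cf F j - F x = ((ms n : ℝ) : ℂ)⁻¹ * ∫ y, (F y - F x) * pc j y := by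
    simp_rw [sub_mul]
    rw [integral_sub (int_mul_pc hF.continuous j) (int_mul_pc continuous_const j), integral_const_mul, int_pc, mul_sub, cf]
    have : ((ms n : ℝ) : ℂ) ≠ 0 := by exact_mod_cast (ms_pos n).ne'
    field_simp
  rw [e]
  refine avg_le fun y hy => (lip_of hF hB x y).trans ?_
  gcongr
  refine norm_le_of_coord _ fun t => ?_
  have h1 := abs_le.1 (hx t)
  have h2 := abs_le.1 (pc_ts hy t)
  rw [PiLp.sub_apply, abs_le]; constructor <;> linarith

lemma cf_shift (F : Es n → ℂ) (j : Fin n → ℤ) :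
    cf F j = ((ms n : ℝ) : ℂ)⁻¹ * ∫ y, F (y + io j) * pc 0 y := by
  rw [cf, ← integral_add_right_eq_self _ (io j)]
  congr 2
  ext y
  rw [pc_eq j]
  simp

lemma cf_diff {F : Es n → ℂ} {B : ℝ} (hF : ContDiff ℝ 1 F) (hB : ∀ x, ‖fderiv ℝ F x‖ ≤ B) (hB0 : 0 ≤ B)
    (j j' : Fin n → ℤ) : ‖cf F j - cf F j'‖ ≤ (B * n) * nv (j - j') := by
  have hc : ∀ v : Es n, Continuous fun y => F (y + v) := fun v => hF.continuous.comp (by fun_prop)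
  rw [cf_shift, cf_shift, ← mul_sub, ← integral_sub (int_mul_pc (hc _) 0) (int_mul_pc (hc _) 0)]
  simp_rw [← sub_mul]
  refine avg_le fun y _ => (lip_of hF hB _ _).trans ?_
  have : y + io j - (y + io j') = io (j - j') := by rw [io_sub]; abel
  rw [this, mul_assoc]
  gcongr
  exact norm_io_le _

lemma cf_ne {F : Es n → ℂ} {R : ℝ} (hs : tsupport F ⊆ closedBall 0 R) {j : Fin n → ℤ} (h : cf F j ≠ 0) :
    ‖io j‖ ≤ R + n := by
  by_contra hlt
  push Not at hlt
  apply h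
  have : ∀ x, F x * pc j x = 0 := by
    intro x
    by_contra hne
    have h1 := hs (subset_tsupport _ (left_ne_zero_of_mul hne))
    have h2 := pj_tsupport' j (pc_tsupport j (subset_tsupport _ (right_ne_zero_of_mul hne)))
    rw [mem_closedBall, dist_eq_norm] at h1 h2
    rw [sub_zero] at h1
    have := norm_le_norm_add_norm_sub x (io j)
    rw [norm_sub_rev] at this
    rw [norm_sub_rev] at this
    linarith [norm_sub_rev x (io j)]
  rw [cf]
  simp [this]

lemma cf_sq {F : Es n → ℂ} (hF : C1c F) (I : Finset (Fin n → ℤ)) :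
    ∑ j ∈ I, ‖cf F j‖ ^ 2 ≤ (ms n)⁻¹ * ∫ x, ‖F x‖ ^ 2 := by
  simp_rw [cf, norm_mul, norm_ms_inv, mul_pow]
  rw [← Finset.mul_sum]
  have := bessel (hF.memLp 2) I
  have hm := ms_pos n
  calc _ ≤ (ms n)⁻¹ ^ 2 * (ms n * ∫ x, ‖F x‖ ^ 2) := by gcongr
    _ = _ := by field_simp

/-- hypotheses on unit scale test functions -/
structure Nice (F : Es n → ℂ) (R M : ℝ) : Prop where
  c1 : ContDiff ℝ 1 F
  supp : tsupport F ⊆ closedBall 0 R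
  le : ∀ x, ‖F x‖ ≤ M
  der : ∀ x, ‖fderiv ℝ F x‖ ≤ M / R

lemma Nice.C1c {F : Es n → ℂ} {R M : ℝ} (h : Nice F R M) : C1c F :=
  ⟨h.c1, (isCompact_closedBall 0 R).of_isClosed_subset (isClosed_tsupport _) h.supp⟩

lemma Nice.syn_close {F : Es n → ℂ} {R M : ℝ} (h : Nice F R M) (hR : 1 ≤ R) (hM : 0 < M) {N : ℕ}
    (hN : R ≤ 2 ^ N - 1) (x : Es n) : ‖F x - syn (Bx n N) (cf F) x‖ ≤ M / R * (n * 2) := by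
  have hMR : 0 ≤ M / R := by positivity
  have e : F x = F x * ∑ j ∈ Bx n N, pc j x := by
    by_cases hx : F x = 0
    · simp [hx]
    · have h1 := h.supp (subset_tsupport _ hx)
      rw [mem_closedBall, dist_zero_right] at h1
      have h2 : ∑ j ∈ Bx n N, pj j x = 1 := Bx_sum_one fun t => (abs_coord_le x t).trans (h1.trans hN)
      have h3 : ∑ j ∈ Bx n N, pc j x = 1 := by
        simp only [pc]; exact_mod_cast h2
      rw [h3, mul_one]
  rw [e, syn, Finset.mul_sum, ← Finset.sum_sub_distrib]
  refine (norm_sum_le _ _).trans ?_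
  calc _ ≤ ∑ j ∈ Bx n N, M / R * (n * 2) * pj j x := by
        refine Finset.sum_le_sum fun j _ => ?_
        rw [← sub_mul, norm_mul, pc_norm]
        by_cases hz : pj j x = 0
        · rw [hz]; simp
        · gcongr
          · exact pj_nonneg _ _
          · rw [norm_sub_rev]
            exact cf_close h.c1 h.der hMR (pj_tsupport j (subset_tsupport _ hz))
    _ = M / R * (n * 2) * ∑ j ∈ Bx n N, pj j x := by rw [Finset.mul_sum]
    _ ≤ M / R * (n * 2) * 1 := by gcongr; exact Bx_sum_le _ _
    _ = _ := mul_one _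

lemma Nice.syn_nice (n : ℕ) (hn : 1 ≤ n) : ∃ C : ℝ, 1 ≤ C ∧ ∀ (F : Es n → ℂ) (R M : ℝ), Nice F R M → 1 ≤ R → 0 < M →
    ∀ N : ℕ, (∀ j : Fin n → ℤ, (nv j : ℝ) ≤ R + n → j ∈ Bx n N) →
    Nice (syn (Bx n N) (cf F)) ((1 + 2 * n) * R) (C * M) := by
  obtain ⟨G, hG, hG'⟩ := syn_fderiv n
  have hn' : (1:ℝ) ≤ n := by exact_mod_cast hn
  refine ⟨1 + G * n * (1 + 2 * n), by nlinarith [mul_pos hG (show (0:ℝ) < n * (1 + 2 * n) by positivity)], fun F R M h hR hM N hN => ?_⟩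
  have hz : ∀ j, j ∉ Bx n N → cf F j = 0 := by
    intro j hj
    by_contra hne
    exact hj (hN j ((nv_le_norm_io j).trans (cf_ne h.supp hne)))
  have hGn : 0 ≤ G * n * (1 + 2 * n) := by positivity
  refine ⟨syn_contDiff _ _, ?_, ?_, ?_⟩
  · refine (CZO.syn_tsupport _ _ 0 (R + n) ?_).trans (closedBall_subset_closedBall (by nlinarith))
    intro j _ hne
    rw [sub_zero]; exact cf_ne h.supp hne
  · intro x
    refine (syn_le _ _ M (fun j _ => cf_le h.le j) hM.le x).trans ?_
    nlinarith
  · intro x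
    refine (hG' _ _ (M / R * n) (by positivity) hz (cf_diff h.c1 h.der (by positivity)) x).trans ?_
    rw [le_div_iff₀ (by positivity)]
    have : G * (M / R * n) * ((1 + 2 * n) * R) = G * n * (1 + 2 * n) * M := by field_simp
    rw [this]; nlinarith

lemma Nice.mono {F : Es n → ℂ} {R M R' M' : ℝ} (h : Nice F R M) (hR : R ≤ R') (hM : M ≤ M') (hd : M / R ≤ M' / R') :
    Nice F R' M' :=
  ⟨h.c1, h.supp.trans (closedBall_subset_closedBall hR), fun x => (h.le x).trans hM, fun x => (h.der x).trans hd⟩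

/-- flipped form -/
def flp {α β : Type} (Ψ : α → α → β) : α → α → β := fun F G => Ψ G F

lemma err_bound {Ψ : (Es n → ℂ) → (Es n → ℂ) → ℂ} {H : Es n → Es n → ℂ} {D : ℝ} (hD : 0 < D) (h : CZO Ψ H D)
    {F w : Es n → ℂ} {R M E : ℝ} (hF : Nice F R M) (hR : 0 < R) (hM : 0 < M) (hw : C1c w)
    (hws : tsupport w ⊆ closedBall 0 R) (hE : 0 ≤ E) (hwE : ∀ x, ‖w x‖ ≤ M / R * E) :
    ‖Ψ F w‖ ≤ (1 + E ^ 2 * volume.real (closedBall (0 : Es n) 1)) * D * (M ^ 2 * R ^ n / R) := by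
  obtain ⟨u, hu, hu2, hu3⟩ := h.test' hR hM hF.c1 hF.supp hF.le hF.der
  rw [hu3 w hw]
  refine (amgm hu (hw.memLp 2) (l := (D * R)⁻¹) (by positivity)).trans ?_
  have h1 := vol_ball_le hR.le hws hwE
  calc _ ≤ (D * R)⁻¹ * (M ^ 2 * (D ^ 2 * R ^ n)) + (D * R)⁻¹⁻¹ *
        ((M / R * E) ^ 2 * (R ^ n * volume.real (closedBall (0 : Es n) 1))) := by gcongr
    _ = _ := by
      field_simp

lemma unit_scale (n : ℕ) (hn : 1 ≤ n) : ∃ C : ℝ, 0 < C ∧ ∀ (Ψ : (Es n → ℂ) → (Es n → ℂ) → ℂ) (H : Es n → Es n → ℂ) (D : ℝ),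
    0 < D → CZO Ψ H D → CZO (flp Ψ) (flp H) D → ∀ (F G : Es n → ℂ) (R M : ℝ), 1 ≤ R → 0 < M → Nice F R M → Nice G R M →
    ‖Ψ F G‖ ≤ C * D * ((∫ x, ‖F x‖ ^ 2) + (∫ x, ‖G x‖ ^ 2) + M ^ 2 * R ^ n / R) := by
  obtain ⟨C1, hC1, h1⟩ := discT1 n hn
  obtain ⟨C2, hC2, h2⟩ := CZO.toCZ n hn
  obtain ⟨C3, hC3, h3⟩ := Nice.syn_nice n hn
  have hm := ms_pos n
  have hn' : (1:ℝ) ≤ n := by exact_mod_cast hn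
  set κ : ℝ := 1 + 2 * n with hκ
  have hκ1 : 1 ≤ κ := by rw [hκ]; linarith
  set M3 : ℝ := C3 * κ with hM3
  have hM3' : 1 ≤ M3 := by rw [hM3]; nlinarith
  set V := volume.real (closedBall (0 : Es n) 1) with hV
  set C4 : ℝ := (1 + (n * 2 * κ) ^ 2 * V) * (M3 ^ 2 * κ ^ n / κ) with hC4
  have hC4' : 0 ≤ C4 := by positivity
  refine ⟨C2 * C1 * (ms n)⁻¹ + 2 * C4, by positivity, fun Ψ H D hD h h' F G R M hR hM hF hG => ?_⟩
  obtain ⟨R1, hR1⟩ := h.supp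
  obtain ⟨R2, hR2⟩ := h'.supp
  obtain ⟨N, hN1, hN2⟩ := exists_Bx (n := n) (max (max R1 R2) R + n)
  have hRN : R ≤ 2 ^ N - 1 := by linarith [le_max_right (max R1 R2) R]
  have hbox : ∀ j : Fin n → ℤ, (nv j : ℝ) ≤ R + n → j ∈ Bx n N := fun j hj =>
    hN2 j (by linarith [le_max_right (max R1 R2) R])
  have hvan : ∀ j : Fin n → ℤ, j ∉ Bx n N → ∀ x ∈ closedBall (0 : Es n) (max R1 R2), pc j x = 0 := by
    intro j hj x hx
    by_contra hne
    apply hj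
    apply hN2
    have h3 := pj_tsupport' j (pc_tsupport j (subset_tsupport _ hne))
    rw [mem_closedBall, dist_eq_norm] at h3 hx
    rw [sub_zero] at hx
    refine (nv_le_norm_io j).trans ?_
    have := norm_le_norm_add_norm_sub x (io j)
    linarith [norm_sub_rev x (io j), le_max_left (max R1 R2) R]
  have hz : ∀ i j, i ∉ Bx n N ∨ j ∉ Bx n N → Ψ (pc j) (pc i) = 0 := by
    rintro i j (hi | hj)
    · refine hR2 (pc i) (pc j) (pc_C1c i) (pc_C1c j) fun x hx => hvan i hi x ?_
      exact closedBall_subset_closedBall (le_max_right _ _) hx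
    · refine hR1 (pc j) (pc i) (pc_C1c j) (pc_C1c i) fun x hx => hvan j hj x ?_
      exact closedBall_subset_closedBall (le_max_left _ _) hx
  have hz1 := h2 Ψ H D hD h N hz
  have hz2 := h2 (flp Ψ) (flp H) D hD h' N (fun i j hij => hz j i hij.symm)
  set Fh := syn (Bx n N) (cf F) with hFh
  set Gh := syn (Bx n N) (cf G) with hGh
  have hFhC : C1c Fh := CZO.C1c_syn _ _
  have hGhC : C1c Gh := CZO.C1c_syn _ _
  have cfz : ∀ {F : Es n → ℂ}, Nice F R M → ∀ j, j ∉ Bx n N → cf F j = 0 := by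
    intro F hF j hj
    by_contra hne
    exact hj (hbox j ((nv_le_norm_io j).trans (cf_ne hF.supp hne)))
  -- main term
  have hmain : ‖Ψ Fh Gh‖ ≤ C2 * C1 * (ms n)⁻¹ * D * ((∫ x, ‖F x‖ ^ 2) + ∫ x, ‖G x‖ ^ 2) := by
    have e1 : Ψ Fh Gh = ((C2 * D : ℝ) : ℂ) * ∑ i ∈ Bx n N, ∑ j ∈ Bx n N,
        ((C2 * D : ℝ) : ℂ)⁻¹ * Ψ (pc j) (pc i) * cf F j * cf G i := by
      have e2 : Ψ Fh Gh = ∑ i ∈ Bx n N, cf G i * Ψ Fh (pc i) := h'.syn (Bx n N) (cf G) hFhC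
      have hne : ((C2 * D : ℝ) : ℂ) ≠ 0 := by
        have : C2 * D ≠ 0 := by positivity
        exact_mod_cast this
      rw [e2, Finset.mul_sum]
      refine Finset.sum_congr rfl fun i _ => ?_
      rw [hFh, h.syn _ _ (pc_C1c i), Finset.mul_sum, Finset.mul_sum]
      refine Finset.sum_congr rfl fun j _ => ?_
      field_simp
    rw [e1, norm_mul, Complex.norm_real, Real.norm_of_nonneg (by positivity)]
    have := h1 N _ hz1 hz2 (cf F) (cf G) (cfz hF) (cfz hG)
    have hs1 := cf_sq hF.C1c (Bx n N)
    have hs2 := cf_sq hG.C1c (Bx n N)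
    calc _ ≤ C2 * D * (C1 * ((ms n)⁻¹ * (∫ x, ‖F x‖ ^ 2) + (ms n)⁻¹ * ∫ x, ‖G x‖ ^ 2)) := by
          refine mul_le_mul_of_nonneg_left (this.trans ?_) (by positivity)
          gcongr
      _ = _ := by ring
  -- error terms
  have hR0 : 0 < κ * R := by positivity
  have hM0 : 0 < M3 * M := by positivity
  have niceh : ∀ {F : Es n → ℂ}, Nice F R M → Nice (syn (Bx n N) (cf F)) (κ * R) (M3 * M) := by
    intro F hF
    refine (h3 F R M hF hR hM N hbox).mono le_rfl ?_ ?_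
    · rw [hM3]; gcongr; nlinarith
    · rw [hM3]; gcongr; nlinarith
  have nice0 : ∀ {F : Es n → ℂ}, Nice F R M → Nice F (κ * R) (M3 * M) := by
    intro F hF
    refine hF.mono (by nlinarith) (by nlinarith) ?_
    rw [div_le_div_iff₀ (by positivity) (by positivity), hM3]
    have : κ * (M * R) ≤ C3 * (κ * (M * R)) := le_mul_of_one_le_left (by positivity) hC3
    nlinarith
  have werr : ∀ {F : Es n → ℂ}, Nice F R M → tsupport (F - syn (Bx n N) (cf F)) ⊆ closedBall 0 (κ * R) ∧
      ∀ x, ‖(F - syn (Bx n N) (cf F)) x‖ ≤ M3 * M / (κ * R) * (n * 2 * κ) := by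
    intro F hF
    refine ⟨(tsupport_sub _ _).trans (Set.union_subset (nice0 hF).supp (niceh hF).supp), fun x => ?_⟩
    refine (hF.syn_close hR hM hRN x).trans ?_
    have e : M3 * M / (κ * R) * (n * 2 * κ) = M3 * (M / R * (n * 2)) := by field_simp
    rw [e]
    exact le_mul_of_one_le_left (by positivity) hM3'
  have herr : ∀ {Ψ : (Es n → ℂ) → (Es n → ℂ) → ℂ} {H : Es n → Es n → ℂ}, CZO Ψ H D → ∀ {F G : Es n → ℂ},
      Nice F (κ * R) (M3 * M) → Nice G R M → ‖Ψ F (G - syn (Bx n N) (cf G))‖ ≤ C4 * D * (M ^ 2 * R ^ n / R) := by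
    intro Ψ H h F G hF hG
    refine (err_bound hD h hF hR0 hM0 (hG.C1c.sub (CZO.C1c_syn _ _)) (werr hG).1 (by positivity) (werr hG).2).trans
      (le_of_eq ?_)
    rw [hC4, ← hV, mul_pow κ R]
    field_simp
  have hE1 := herr h (niceh hF) hG
  have hE2 := herr h' (nice0 hG) hF
  have e : Ψ F G = Ψ Fh Gh + Ψ Fh (G - Gh) + flp Ψ G (F - Fh) := by
    have a1 : Ψ Fh (G - Gh) = Ψ Fh G - Ψ Fh Gh := h'.sub hG.C1c hGhC hFhC
    have a2 : flp Ψ G (F - Fh) = Ψ F G - Ψ Fh G := h.sub hF.C1c hFhC hG.C1c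
    rw [a1, a2]; ring
  have i1 : 0 ≤ ∫ x, ‖F x‖ ^ 2 := integral_nonneg fun x => by positivity
  have i2 : 0 ≤ ∫ x, ‖G x‖ ^ 2 := integral_nonneg fun x => by positivity
  have i3 : 0 ≤ M ^ 2 * R ^ n / R := by positivity
  calc ‖Ψ F G‖ ≤ ‖Ψ Fh Gh‖ + ‖Ψ Fh (G - Gh)‖ + ‖flp Ψ G (F - Fh)‖ := by
        rw [e]; exact norm_add₃_le
    _ ≤ C2 * C1 * (ms n)⁻¹ * D * ((∫ x, ‖F x‖ ^ 2) + ∫ x, ‖G x‖ ^ 2) + C4 * D * (M ^ 2 * R ^ n / R)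
        + C4 * D * (M ^ 2 * R ^ n / R) := add_le_add (add_le_add hmain hE1) hE2
    _ ≤ _ := by
      have j1 : 0 ≤ C2 * C1 * (ms n)⁻¹ * D * (M ^ 2 * R ^ n / R) := by positivity
      have j2 : 0 ≤ 2 * C4 * D * ((∫ x, ‖F x‖ ^ 2) + ∫ x, ‖G x‖ ^ 2) := by positivity
      nlinarith

end T1

namespace T1

variable {n : ℕ}

/-- dilation -/
def dil (e : ℝ) (F : Es n → ℂ) : Es n → ℂ := fun x => F (e • x)

lemma dil_tsupport (e : ℝ) (F : Es n → ℂ) : tsupport (dil e F) ⊆ (fun x => e • x) ⁻¹' tsupport F :=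
  tsupport_comp_subset_preimage F (by fun_prop)

lemma dil_contDiff (e : ℝ) {F : Es n → ℂ} (hF : ContDiff ℝ 1 F) : ContDiff ℝ 1 (dil e F) :=
  hF.comp (contDiff_const_smul e)

lemma dil_C1c {e : ℝ} (he : e ≠ 0) {F : Es n → ℂ} (hF : C1c F) : C1c (dil e F) := by
  refine ⟨dil_contDiff e hF.1, ?_⟩
  exact hF.2.comp_homeomorph (Homeomorph.smulOfNeZero e he)

lemma dil_add (e : ℝ) (F G : Es n → ℂ) : dil e (F + G) = dil e F + dil e G := rfl
lemma dil_smul (e : ℝ) (c : ℂ) (F : Es n → ℂ) : dil e (c • F) = c • dil e F := rfl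

lemma dil_dil {e : ℝ} (he : e ≠ 0) (F : Es n → ℂ) : dil e⁻¹ (dil e F) = F := by
  ext x; simp [dil, smul_smul, he]

lemma dil_fderiv (e : ℝ) (F : Es n → ℂ) (x : Es n) : fderiv ℝ (dil e F) x = e • fderiv ℝ F (e • x) := by
  unfold dil
  exact fderiv_comp_smul e

lemma dil_ball {e : ℝ} (he : 0 < e) {F : Es n → ℂ} {c : Es n} {r : ℝ} (h : tsupport F ⊆ closedBall c r) :
    tsupport (dil e F) ⊆ closedBall (e⁻¹ • c) (e⁻¹ * r) := by
  intro x hx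
  have := h (dil_tsupport e F hx)
  rw [mem_closedBall, dist_eq_norm] at this ⊢
  have e1 : x - e⁻¹ • c = e⁻¹ • (e • x - c) := by
    rw [smul_sub, smul_smul, inv_mul_cancel₀ he.ne', one_smul]
  rw [e1, norm_smul, Real.norm_of_nonneg (by positivity)]
  gcongr

/-- rescaled form -/
def sc (e : ℝ) (Ψ : (Es n → ℂ) → (Es n → ℂ) → ℂ) : (Es n → ℂ) → (Es n → ℂ) → ℂ :=
  fun F G => (((e ^ n)⁻¹ : ℝ) : ℂ) * Ψ (dil e⁻¹ F) (dil e⁻¹ G)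

/-- rescaled kernel -/
def sk (e : ℝ) (H : Es n → Es n → ℂ) : Es n → Es n → ℂ := fun x y => ((e ^ n : ℝ) : ℂ) * H (e • x) (e • y)

lemma int_dil {E : Type*} [NormedAddCommGroup E] [NormedSpace ℝ E] {e : ℝ} (he : 0 < e) (f : Es n → E) :
    ∫ x, f (e • x) = (e ^ n)⁻¹ • ∫ x, f x := by
  rw [Measure.integral_comp_smul, finrank_euclideanSpace_fin, abs_of_pos (by positivity)]

lemma CZO.scale {Ψ : (Es n → ℂ) → (Es n → ℂ) → ℂ} {H : Es n → Es n → ℂ} {D : ℝ} (h : CZO Ψ H D) {e : ℝ} (he : 0 < e) :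
    CZO (sc e Ψ) (sk e H) D := by
  have he' : e⁻¹ ≠ 0 := by positivity
  have hei : 0 < e⁻¹ := by positivity
  have heC : (e : ℂ) ≠ 0 := by exact_mod_cast he.ne'
  have hsub : ∀ x y : Es n, x ≠ y → e • x ≠ e • y := fun x y hxy hh => hxy (smul_right_injective _ he.ne' hh)
  have hnrm : ∀ x y : Es n, ‖e • x - e • y‖ = e * ‖x - y‖ := fun x y => by
    rw [← smul_sub, norm_smul, Real.norm_of_nonneg he.le]
  have hen : ‖((e ^ n : ℝ) : ℂ)‖ = e ^ n := by
    rw [Complex.norm_real, Real.norm_of_nonneg (by positivity)]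
  refine ⟨?_, ?_, ?_, ?_, ?_, ?_, ?_, ?_⟩
  · intro F F' G hF hF' hG
    simp only [sc, dil_add]
    rw [h.add _ _ _ (dil_C1c he' hF) (dil_C1c he' hF') (dil_C1c he' hG)]; ring
  · intro c F G hF hG
    simp only [sc, dil_smul]
    rw [h.smul _ _ _ (dil_C1c he' hF) (dil_C1c he' hG)]; ring
  · intro F G hF hG hd
    have hd' : Disjoint (tsupport (dil e⁻¹ F)) (tsupport (dil e⁻¹ G)) := by
      rw [Set.disjoint_left] at hd ⊢
      intro x hx hx'
      exact hd (dil_tsupport _ _ hx) (dil_tsupport _ _ hx')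
    have := vol_haar n
    have e1 := Measure.integral_comp_smul (volume : Measure (Es n × Es n))
      (fun p => H p.1 p.2 * dil e⁻¹ F p.2 * dil e⁻¹ G p.1) e
    simp only [Prod.smul_fst, Prod.smul_snd, dil, smul_smul, inv_mul_cancel₀ he.ne', one_smul] at e1
    simp only [sc]
    rw [h.kernel _ _ (dil_C1c he' hF) (dil_C1c he' hG) hd']
    simp only [sk, dil]
    have e2 : ∀ p : Es n × Es n, ((e ^ n : ℝ) : ℂ) * H (e • p.1) (e • p.2) * F p.2 * G p.1 =
      ((e ^ n : ℝ) : ℂ) * (H (e • p.1) (e • p.2) * F p.2 * G p.1) := fun p => by ring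
    simp_rw [e2]
    rw [integral_const_mul, e1, Module.finrank_prod, finrank_euclideanSpace_fin, abs_of_pos (by positivity),
      Complex.real_smul, ← mul_assoc]
    congr 1
    push_cast
    rw [pow_add]
    field_simp
  · have hc : ContinuousOn (fun p : Es n × Es n => H (e • p.1) (e • p.2)) {p | p.1 ≠ p.2} :=
      h.cont.comp (f := fun p : Es n × Es n => (e • p.1, e • p.2)) (by fun_prop) (fun p hp => hsub _ _ hp)
    exact continuousOn_const.mul hc
  · intro x y hxy
    simp only [sk]
    rw [norm_mul, hen]
    calc _ ≤ e ^ n * (D / ‖e • x - e • y‖ ^ n) := by gcongr; exact h.size _ _ (hsub _ _ hxy)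
      _ = _ := by
        rw [hnrm, mul_pow]; field_simp
  · intro x y hxy
    obtain ⟨h1, h2⟩ := h.diff _ _ (hsub _ _ hxy)
    have hd : DifferentiableAt ℝ (fun x' => H (e • x') (e • y)) x :=
      DifferentiableAt.comp x (g := fun z => H z (e • y)) h1 (by fun_prop)
    refine ⟨hd.const_mul _, ?_⟩
    have hxy' : 0 < ‖x - y‖ := norm_pos_iff.2 (sub_ne_zero.2 hxy)
    have hnn : 0 ≤ D / ‖x - y‖ ^ (n + 1) := by
      have h3 := (norm_nonneg _).trans h2
      rw [hnrm, mul_pow] at h3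
      have h4 := mul_nonneg (show 0 ≤ e ^ (n + 1) by positivity) h3
      have h5 : e ^ (n + 1) * (D / (e ^ (n + 1) * ‖x - y‖ ^ (n + 1))) = D / ‖x - y‖ ^ (n + 1) := by
        field_simp
      rw [h5] at h4
      exact h4
    refine ContinuousLinearMap.opNorm_le_bound _ hnn fun v => ?_
    have e1 : fderiv ℝ (fun x' => sk e H x' y) x v = ((e ^ n : ℝ) : ℂ) * (e • fderiv ℝ (fun z => H z (e • y)) (e • x) v) := by
      simp only [sk]
      rw [fderiv_const_mul hd]
      have := dil_fderiv e (fun z => H z (e • y)) x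
      unfold dil at this
      rw [this]; rfl
    rw [e1, norm_mul, hen, norm_smul, Real.norm_of_nonneg he.le]
    calc _ ≤ e ^ n * (e * (D / ‖e • x - e • y‖ ^ (n + 1) * ‖v‖)) := by
          gcongr; exact ContinuousLinearMap.le_of_opNorm_le _ h2 v
      _ = _ := by
        rw [hnrm, mul_pow]; field_simp; ring
  · intro f c r hr hf hs hf1 hf2
    have hs' := dil_ball hei hs
    rw [inv_inv] at hs'
    obtain ⟨u, hu, hu2, hu3⟩ := h.test (dil e⁻¹ f) (e • c) (e * r) (by positivity) (dil_contDiff _ hf) hs'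
      (fun x => hf1 _) (fun x => by
        rw [dil_fderiv, norm_smul, Real.norm_of_nonneg hei.le]
        calc _ ≤ e⁻¹ * (1 / r) := by gcongr; exact hf2 _
          _ = _ := by field_simp)
    set u' := hu.1.mk u with hu'
    have hae : u =ᵐ[volume] u' := hu.1.ae_eq_mk
    have hum : StronglyMeasurable u' := hu.1.stronglyMeasurable_mk
    have huL : MemLp u' 2 volume := hu.ae_eq hae
    have hsq : ∫ x, ‖u x‖ ^ 2 = ∫ x, ‖u' x‖ ^ 2 := by
      refine integral_congr_ae ?_
      filter_upwards [hae] with x hx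
      rw [hx]
    refine ⟨fun x => u' (e • x), ?_, ?_, ?_⟩
    · rw [memLp_two_iff_integrable_sq_norm]
      · exact (sq_int huL).comp_smul he.ne'
      · exact (hum.comp_measurable (measurable_const_smul e)).aestronglyMeasurable
    · rw [int_dil he (fun x => ‖u' x‖ ^ 2), ← hsq, smul_eq_mul, inv_mul_le_iff₀ (by positivity)]
      rw [mul_pow] at hu2
      linarith
    · intro G hG
      simp only [sc]
      rw [hu3 _ (dil_C1c he' hG)]
      have e1 := int_dil he (fun x => u' x * dil e⁻¹ G x)
      simp only [dil, smul_smul, inv_mul_cancel₀ he.ne', one_smul] at e1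
      rw [e1, Complex.real_smul]
      congr 1
      refine integral_congr_ae ?_
      filter_upwards [hae] with x hx
      rw [hx]; rfl
  · obtain ⟨R, hR⟩ := h.supp
    refine ⟨e⁻¹ * R, fun F G hF hG hz => ?_⟩
    simp only [sc]
    rw [hR _ _ (dil_C1c he' hF) (dil_C1c he' hG), mul_zero]
    intro x hx
    apply hz
    rw [mem_closedBall, dist_zero_right] at hx ⊢
    rw [norm_smul, Real.norm_of_nonneg hei.le]
    gcongr

lemma C1c.nice {f : Es n → ℂ} (hf : C1c f) : ∃ R M : ℝ, 1 ≤ R ∧ 0 < M ∧ ∀ M', M ≤ M' → ∀ R', R ≤ R' → tsupport f ⊆ closedBall 0 R' ∧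
    (∀ x, ‖f x‖ ≤ M') ∧ ∀ x, ‖fderiv ℝ f x‖ ≤ M' := by
  obtain ⟨R, hR⟩ := (hf.2.isCompact.isBounded).subset_closedBall 0
  obtain ⟨M1, hM1⟩ := hf.1.continuous.bounded_above_of_compact_support hf.2
  obtain ⟨M2, hM2⟩ := (hf.1.continuous_fderiv one_ne_zero).bounded_above_of_compact_support (hf.2.fderiv ℝ)
  refine ⟨max R 1, |M1| + |M2| + 1, le_max_right _ _, by positivity, fun M' hM' R' hR' => ⟨?_, ?_, ?_⟩⟩
  · exact hR.trans (closedBall_subset_closedBall ((le_max_left _ _).trans hR'))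
  · intro x; exact (hM1 x).trans (by linarith [le_abs_self M1, abs_nonneg M2])
  · intro x; exact (hM2 x).trans (by linarith [le_abs_self M2, abs_nonneg M1])

theorem contT1 (n : ℕ) (hn : 1 ≤ n) : ∃ C : ℝ, 0 < C ∧ ∀ (Ψ : (Es n → ℂ) → (Es n → ℂ) → ℂ) (H : Es n → Es n → ℂ) (D : ℝ),
    0 < D → CZO Ψ H D → CZO (flp Ψ) (flp H) D → ∀ (f g : Es n → ℂ), C1c f → C1c g →
    ‖Ψ f g‖ ≤ C * D * ((∫ x, ‖f x‖ ^ 2) + (∫ x, ‖g x‖ ^ 2)) := by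
  obtain ⟨C, hC, hmain⟩ := unit_scale n hn
  refine ⟨C, hC, fun Ψ H D hD h h' f g hf hg => ?_⟩
  obtain ⟨R1, M1, hR1, hM1, h1⟩ := hf.nice
  obtain ⟨R2, M2, hR2, hM2, h2⟩ := hg.nice
  set R := max R1 R2
  have hR : 1 ≤ R := hR1.trans (le_max_left _ _)
  set M := max M1 M2 * R with hMdef
  have hMm : 0 < max M1 M2 := hM1.trans_le (le_max_left _ _)
  have hM : 0 < M := by positivity
  have key : ∀ e : ℝ, 0 < e → e ≤ 1 → ‖Ψ f g‖ ≤ C * D * ((∫ x, ‖f x‖ ^ 2) + (∫ x, ‖g x‖ ^ 2)) + e * (C * D * (M ^ 2 * R ^ n / R)) := by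
    intro e he he1
    have nice : ∀ {f : Es n → ℂ}, C1c f → tsupport f ⊆ closedBall 0 R → (∀ x, ‖f x‖ ≤ max M1 M2) →
        (∀ x, ‖fderiv ℝ f x‖ ≤ max M1 M2) → Nice (dil e f) (e⁻¹ * R) M := by
      intro f hf a1 a2 a3
      refine ⟨dil_contDiff e hf.1, ?_, ?_, ?_⟩
      · have := dil_ball he a1
        rwa [smul_zero] at this
      · intro x
        exact (a2 _).trans (le_mul_of_one_le_right hMm.le hR)
      · intro x
        rw [dil_fderiv, norm_smul, Real.norm_of_nonneg he.le]
        calc _ ≤ e * max M1 M2 := by gcongr; exact a3 _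
          _ = _ := by rw [hMdef]; field_simp
    obtain ⟨a1, a2, a3⟩ := h1 _ (le_max_left M1 M2) _ (le_max_left R1 R2)
    obtain ⟨b1, b2, b3⟩ := h2 _ (le_max_right M1 M2) _ (le_max_right R1 R2)
    have hR' : 1 ≤ e⁻¹ * R := by
      have : 1 ≤ e⁻¹ := (one_le_inv₀ he).2 he1
      nlinarith
    have := hmain (sc e Ψ) (sk e H) D hD (h.scale he) (h'.scale he) (dil e f) (dil e g) (e⁻¹ * R) M hR' hM
      (nice hf a1 a2 a3) (nice hg b1 b2 b3)
    simp only [sc, dil_dil he.ne'] at this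
    rw [norm_mul, Complex.norm_real, Real.norm_of_nonneg (by positivity), inv_mul_le_iff₀ (by positivity)] at this
    have i1 : ∀ f : Es n → ℂ, ∫ x, ‖dil e f x‖ ^ 2 = (e ^ n)⁻¹ * ∫ x, ‖f x‖ ^ 2 := fun f => by
      simp only [dil]
      rw [int_dil he (fun x => ‖f x‖ ^ 2), smul_eq_mul]
    rw [i1, i1] at this
    refine this.trans (le_of_eq ?_)
    rw [mul_pow e⁻¹ R n, inv_pow]
    field_simp
  refine le_of_forall_pos_le_add fun δ hδ => ?_
  set K := C * D * (M ^ 2 * R ^ n / R)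
  have hK : 0 < K := by positivity
  have hmin : 0 < min 1 (δ / K) := lt_min one_pos (by positivity)
  refine (key (min 1 (δ / K)) hmin (min_le_left _ _)).trans ?_
  have : min 1 (δ / K) * K ≤ δ := by
    calc _ ≤ δ / K * K := by gcongr; exact min_le_right _ _
      _ = δ := by field_simp
  linarith

end T1

namespace T1
variable {n : ℕ}

/-- cutoff data -/
structure Cut (K : Set (Es n)) (c : Es n) (r : ℝ) (χ : Es n → ℂ) (M : ℝ) : Prop where
  cd : ContDiff ℝ 1 χ
  cs : HasCompactSupport χ
  ts : tsupport χ ⊆ ball c r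
  le : ∀ x, ‖χ x‖ ≤ 1
  M0 : 0 ≤ M
  der : ∀ x, ‖fderiv ℝ χ x‖ ≤ M
  one : ∃ U, IsOpen U ∧ K ⊆ U ∧ ∀ x ∈ U, χ x = 1
  re : ∀ x, (starRingEnd ℂ) (χ x) = χ x

lemma exists_cut {K : Set (Es n)} {c : Es n} {r : ℝ} (hr : 0 < r) (hK : IsCompact K) (hKB : K ⊆ ball c r) :
    ∃ χ M, Cut K c r χ M := by
  obtain ⟨ρ, ⟨h0, h1⟩, h2⟩ := exists_pos_lt_subset_ball hr hK.isClosed hKB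
  let b : ContDiffBump c := ⟨ρ, (ρ + r) / 2, h0, by linarith⟩
  have hb : ContDiff ℝ 1 (fun x => (b x : ℂ)) := Complex.ofRealCLM.contDiff.comp b.contDiff
  have hts : tsupport (fun x => (b x : ℂ)) ⊆ closedBall c ((ρ + r) / 2) := by
    refine closure_minimal ?_ isClosed_closedBall
    intro x hx
    have : b x ≠ 0 := by
      intro h; exact hx (by simp [h])
    have h3 : x ∈ Function.support b := this
    rw [b.support_eq] at h3
    exact ball_subset_closedBall h3
  have hcs : HasCompactSupport (fun x => (b x : ℂ)) :=
    HasCompactSupport.of_support_subset_isCompact (isCompact_closedBall c ((ρ + r) / 2))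
      ((subset_tsupport _).trans hts)
  obtain ⟨M, hM⟩ := (hb.continuous_fderiv one_ne_zero).bounded_above_of_compact_support (hcs.fderiv ℝ)
  refine ⟨fun x => (b x : ℂ), M, hb, hcs, hts.trans (closedBall_subset_ball (by linarith)), ?_, ?_, hM,
    ⟨ball c ρ, isOpen_ball, h2, ?_⟩, ?_⟩
  · intro x
    rw [Complex.norm_real, Real.norm_of_nonneg b.nonneg]
    exact b.le_one
  · exact (norm_nonneg _).trans (hM 0)
  · intro x hx
    rw [b.one_of_mem_closedBall (ball_subset_closedBall hx)]; simp
  · intro x; exact Complex.conj_ofReal _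

lemma mul_ts_left (χ F : Es n → ℂ) : tsupport (χ * F) ⊆ tsupport χ := tsupport_mul_subset_left
lemma mul_ts_right (χ F : Es n → ℂ) : tsupport (χ * F) ⊆ tsupport F := tsupport_mul_subset_right

lemma opnorm_le_coord (l : Es n →L[ℝ] ℂ) {B : ℝ} (hB0 : 0 ≤ B) (h : ∀ i, ‖l (EuclideanSpace.single i 1)‖ ≤ B) :
    ‖l‖ ≤ n * B := by
  refine l.opNorm_le_bound (by positivity) fun v => ?_
  have hv : v = ∑ i, v i • EuclideanSpace.single i (1:ℝ) := by
    ext t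
    simp [Pi.single_apply]
  calc ‖l v‖ = ‖∑ i, v i • l (EuclideanSpace.single i 1)‖ := by
        conv_lhs => rw [hv]
        simp [map_sum]
    _ ≤ ∑ i, ‖v i • l (EuclideanSpace.single i 1)‖ := norm_sum_le _ _
    _ ≤ ∑ i : Fin n, ‖v‖ * B := by
        refine Finset.sum_le_sum fun i _ => ?_
        rw [norm_smul]
        gcongr
        · exact abs_coord_le v i
        · exact h i
    _ = _ := by simp; ring

lemma cut_mul_fderiv {K : Set (Es n)} {c : Es n} {r M : ℝ} {χ : Es n → ℂ} (hχ : Cut K c r χ M) {h : Es n → ℂ} {x : Es n} {a b : ℝ}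
    (hd : DifferentiableAt ℝ h x) (ha : ‖h x‖ ≤ a) (hb : ‖fderiv ℝ h x‖ ≤ b) :
    ‖fderiv ℝ (fun z => χ z * h z) x‖ ≤ b + M * a := by
  rw [fderiv_fun_mul (hχ.cd.differentiable one_ne_zero x) hd]
  refine (norm_add_le _ _).trans ?_
  rw [norm_smul, norm_smul]
  have h1 := hχ.le x
  have h2 := hχ.der x
  have h3 := hχ.M0
  have ha0 := (norm_nonneg _).trans ha
  have hb0 := (norm_nonneg _).trans hb
  calc _ ≤ 1 * b + a * M := by gcongr
    _ = _ := by ring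

lemma test_aux {K : Set (Es n)} {c : Es n} {r₁ M : ℝ} {χ : Es n → ℂ} (hχ : Cut K c r₁ χ M) (hr₁ : 0 < r₁)
    {N : (Es n → ℂ) → ℝ} {A : ℝ} (hA : 0 < A) (hN : ∀ (a : ℂ) F, N (a • F) = ‖a‖ * N F)
    (hb : ∀ r : ℝ, 0 < r → r ≤ r₁ → ∀ ω, IsBump n r ω → tsupport ω ⊆ ball c r₁ → N ω ≤ A * r ^ ((n : ℝ) / 2))
    {h : Es n → ℂ} {z : Es n} {r : ℝ} (hr : 0 < r) (hh : ContDiff ℝ 1 h) (hs : tsupport h ⊆ closedBall z r)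
    (h1 : ∀ x, ‖h x‖ ≤ 1) (h2 : ∀ x, ‖fderiv ℝ h x‖ ≤ 1 / r) :
    N (χ * h) ≤ (1 + M * r₁) * A * r ^ ((n : ℝ) / 2) := by
  have hM := hχ.M0
  set B := 1 + M * r₁ with hB
  have hB1 : 1 ≤ B := by have : 0 ≤ M * r₁ := by positivity
                         linarith
  have hB0 : 0 < B := by linarith
  set s := min r r₁
  have hs0 : 0 < s := lt_min hr hr₁
  have hBn : ‖((B⁻¹ : ℝ) : ℂ)‖ = B⁻¹ := by
    rw [Complex.norm_real, Real.norm_of_nonneg (by positivity)]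
  have hcd : ContDiff ℝ 1 (χ * h) := hχ.cd.mul hh
  have hbump : IsBump n s (((B⁻¹ : ℝ) : ℂ) • (χ * h)) := by
    refine ⟨contDiff_const.smul hcd, ?_, ?_, ?_⟩
    · have hsub : tsupport (((B⁻¹ : ℝ) : ℂ) • (χ * h)) ⊆ tsupport (χ * h) :=
        closure_mono (Function.support_const_smul_subset _ _)
      rcases le_total r r₁ with hle | hle
      · refine ⟨z, ?_⟩
        rw [show s = r from min_eq_left hle]
        exact hsub.trans ((mul_ts_right _ _).trans hs)
      · refine ⟨c, ?_⟩
        rw [show s = r₁ from min_eq_right hle]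
        exact hsub.trans ((mul_ts_left _ _).trans (hχ.ts.trans ball_subset_closedBall))
    · intro x
      rw [Pi.smul_apply, norm_smul, hBn, Pi.mul_apply, norm_mul]
      have := hχ.le x
      have := h1 x
      have h0 : B⁻¹ ≤ 1 := inv_le_one_of_one_le₀ hB1
      calc B⁻¹ * (‖χ x‖ * ‖h x‖) ≤ 1 * (1 * 1) := by gcongr
        _ = 1 := by norm_num
    · intro i x
      rw [fderiv_const_smul (hcd.differentiable one_ne_zero x)]
      have h3 : ‖fderiv ℝ (χ * h) x‖ ≤ 1 / r + M * 1 :=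
        cut_mul_fderiv hχ (hh.differentiable one_ne_zero x) (h1 x) (h2 x)
      have h4 : 1 / r + M * 1 ≤ B / s := by
        have e1 : 1 / r ≤ 1 / s := one_div_le_one_div_of_le hs0 (min_le_left _ _)
        have e2 : M ≤ M * r₁ / s := by
          rw [le_div_iff₀ hs0]
          gcongr
          exact min_le_right _ _
        rw [hB, add_div]; linarith
      rw [ContinuousLinearMap.smul_apply, norm_smul, hBn]
      have h5 : ‖fderiv ℝ (χ * h) x (EuclideanSpace.single i 1)‖ ≤ B / s := by
        refine ((fderiv ℝ (χ * h) x).le_opNorm _).trans ?_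
        simp only [EuclideanSpace.norm_single, norm_one, mul_one]
        linarith
      calc _ ≤ B⁻¹ * (B / s) := by gcongr
        _ = 1 / s := by field_simp
  have hmain := hb s hs0 (min_le_right _ _) _ hbump
    ((closure_mono (Function.support_const_smul_subset _ _)).trans ((mul_ts_left _ _).trans hχ.ts))
  rw [hN, hBn] at hmain
  have h6 : N (χ * h) ≤ B * (A * s ^ ((n : ℝ) / 2)) := by
    rwa [inv_mul_le_iff₀ hB0] at hmain
  have h7 : s ^ ((n : ℝ) / 2) ≤ r ^ ((n : ℝ) / 2) :=
    Real.rpow_le_rpow hs0.le (min_le_left _ _) (by positivity)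
  refine h6.trans ?_
  rw [mul_assoc]
  gcongr

lemma ext_aux {K : Set (Es n)} {c : Es n} {r M : ℝ} {χ : Es n → ℂ} (hχ : Cut K c r χ M)
    {v : Es n → ℂ} (hv : MemLp v 2 (volume.restrict (ball c r))) :
    MemLp ((ball c r).indicator (fun x => χ x * v x)) 2 volume ∧
    ∫ x, ‖(ball c r).indicator (fun x => χ x * v x) x‖ ^ 2 ≤ ∫ x in ball c r, ‖v x‖ ^ 2 ∧
    ∀ G : Es n → ℂ, ∫ x in ball c r, v x * (χ x * G x) = ∫ x, (ball c r).indicator (fun x => χ x * v x) x * G x := by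
  have hm : MemLp (fun x => χ x * v x) 2 (volume.restrict (ball c r)) := by
    refine hv.mono (hχ.cd.continuous.aestronglyMeasurable.mul hv.1) (Filter.Eventually.of_forall fun x => ?_)
    rw [norm_mul]
    exact mul_le_of_le_one_left (norm_nonneg _) (hχ.le x)
  have hsq : ∀ {w : Es n → ℂ}, MemLp w 2 (volume.restrict (ball c r)) → Integrable (fun x => ‖w x‖ ^ 2) (volume.restrict (ball c r)) := by
    intro w hw
    have := hw.integrable_norm_pow (p := 2) (by norm_num)
    simpa using this
  refine ⟨(memLp_indicator_iff_restrict measurableSet_ball).2 hm, ?_, ?_⟩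
  · have e1 : (fun x => ‖(ball c r).indicator (fun x => χ x * v x) x‖ ^ 2) = (ball c r).indicator (fun x => ‖χ x * v x‖ ^ 2) := by
      ext x
      by_cases hx : x ∈ ball c r <;> simp [hx]
    rw [e1, integral_indicator measurableSet_ball]
    refine integral_mono (hsq hm) (hsq hv) fun x => ?_
    simp only [norm_mul]
    have := hχ.le x
    gcongr
    exact mul_le_of_le_one_left (norm_nonneg _) (hχ.le x)
  · intro G
    rw [← integral_indicator measurableSet_ball]
    congr 1
    ext x
    by_cases hx : x ∈ ball c r
    · simp [hx]; ring
    · simp [hx]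

lemma kdiff {Kx Ky : Set (Es n)} {c₁ c₂ : Es n} {r₁ r₂ M₁ M₂ : ℝ} {χ₁ χ₂ : Es n → ℂ} (h₁ : Cut Kx c₁ r₁ χ₁ M₁)
    (h₂ : Cut Ky c₂ r₂ χ₂ M₂) {K : Es n → Es n → ℂ} {A L : ℝ} (hA : 0 < A) (hL : ∀ x ∈ ball c₂ r₂, ∀ y ∈ ball c₁ r₁, ‖x - y‖ ≤ L)
    (hd : ∀ x y, x ≠ y → DifferentiableAt ℝ (fun x' => K x' y) x)
    (hs : ∀ x ∈ ball c₂ r₂, ∀ y ∈ ball c₁ r₁, x ≠ y → ‖K x y‖ ≤ A / ‖x - y‖ ^ n)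
    (hs' : ∀ i : Fin n, ∀ x ∈ ball c₂ r₂, ∀ y ∈ ball c₁ r₁, x ≠ y →
      ‖fderiv ℝ (fun x' => K x' y) x (EuclideanSpace.single i 1)‖ ≤ A / ‖x - y‖ ^ (n + 1))
    {D : ℝ} (hD1 : A ≤ D) (hD2 : (n + M₂ * L) * A ≤ D) :
    (∀ x y, x ≠ y → ‖χ₂ x * K x y * χ₁ y‖ ≤ D / ‖x - y‖ ^ n) ∧
    (∀ x y, x ≠ y → DifferentiableAt ℝ (fun x' => χ₂ x' * K x' y * χ₁ y) x ∧
      ‖fderiv ℝ (fun x' => χ₂ x' * K x' y * χ₁ y) x‖ ≤ D / ‖x - y‖ ^ (n + 1)) := by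
  have hD0 : 0 ≤ D := hA.le.trans hD1
  constructor
  · intro x y hxy
    by_cases hx : x ∈ tsupport χ₂
    · by_cases hy : y ∈ tsupport χ₁
      · have := hs x (h₂.ts hx) y (h₁.ts hy) hxy
        rw [norm_mul, norm_mul]
        have a1 := h₁.le y
        have a2 := h₂.le x
        calc _ ≤ 1 * (A / ‖x - y‖ ^ n) * 1 := by gcongr
          _ ≤ _ := by rw [one_mul, mul_one]; gcongr
      · rw [image_eq_zero_of_notMem_tsupport hy]; simp; positivity
    · rw [image_eq_zero_of_notMem_tsupport hx]; simp; positivity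
  · intro x y hxy
    have hdd : DifferentiableAt ℝ (fun x' => χ₂ x' * K x' y) x :=
      (h₂.cd.differentiable one_ne_zero x).mul (hd x y hxy)
    refine ⟨hdd.mul_const _, ?_⟩
    by_cases hx : x ∈ tsupport χ₂
    · by_cases hy : y ∈ tsupport χ₁
      · have b1 := hs x (h₂.ts hx) y (h₁.ts hy) hxy
        have hpos : 0 < ‖x - y‖ := norm_pos_iff.2 (sub_ne_zero.2 hxy)
        have b2 := opnorm_le_coord (fderiv ℝ (fun x' => K x' y) x) (B := A / ‖x - y‖ ^ (n + 1)) (by positivity)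
          (fun i => hs' i x (h₂.ts hx) y (h₁.ts hy) hxy)
        have b3 := cut_mul_fderiv h₂ (hd x y hxy) b1 b2
        rw [fderiv_mul_const hdd, norm_smul]
        have b4 : A / ‖x - y‖ ^ n ≤ L * (A / ‖x - y‖ ^ (n + 1)) := by
          have e : A / ‖x - y‖ ^ n = ‖x - y‖ * (A / ‖x - y‖ ^ (n + 1)) := by
            rw [pow_succ]; field_simp
          rw [e]
          gcongr
          exact hL x (h₂.ts hx) y (h₁.ts hy)
        have a1 := h₁.le y
        have := h₂.M0
        calc _ ≤ 1 * (n * (A / ‖x - y‖ ^ (n + 1)) + M₂ * (L * (A / ‖x - y‖ ^ (n + 1)))) := by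
              gcongr
              exact b3.trans (by gcongr)
          _ = ((n + M₂ * L) * A) / ‖x - y‖ ^ (n + 1) := by ring
          _ ≤ _ := by gcongr
      · rw [image_eq_zero_of_notMem_tsupport hy]; simp; positivity
    · have : (fun x' => χ₂ x' * K x' y * χ₁ y) =ᶠ[nhds x] fun _ => 0 := by
        filter_upwards [notMem_tsupport_iff_eventuallyEq.1 hx] with z hz
        rw [hz]; simp
      rw [this.fderiv_eq]; simp; positivity

end T1

namespace T1
variable {n : ℕ}

lemma Lp_norm_sq {α : Type*} [MeasurableSpace α] {μ : Measure α} (v : Lp ℂ 2 μ) : ‖v‖ ^ 2 = ∫ x, ‖v x‖ ^ 2 ∂μ := by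
  have h := L2.inner_def (𝕜 := ℂ) v v
  rw [inner_self_eq_norm_sq_to_K] at h
  have h2 : ∀ x, inner ℂ (v x) (v x) = ((‖v x‖ ^ 2 : ℝ) : ℂ) := fun x => by
    rw [inner_self_eq_norm_sq_to_K]; simp
  simp only [h2] at h
  rw [integral_complex_ofReal] at h
  have h3 : ((‖v‖ ^ 2 : ℝ) : ℂ) = ((∫ x, ‖v x‖ ^ 2 ∂μ : ℝ) : ℂ) := by
    rw [← h]; simp
  exact Complex.ofReal_injective h3

lemma sq_rpow_half {r : ℝ} (hr : 0 < r) : (r ^ ((n : ℝ) / 2)) ^ 2 = r ^ n := by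
  rw [← Real.rpow_natCast, ← Real.rpow_mul hr.le, ← Real.rpow_natCast]
  congr 1
  push_cast; ring

/-- hypotheses package -/
structure Hyp (c₁ c₂ : Es n) (r₁ r₂ : ℝ) 
    (T : (Es n → ℂ) →ₗ[ℂ] Lp ℂ 2 ((volume : Measure (Es n)).restrict (ball c₂ r₂)))
    (S : (Es n → ℂ) →ₗ[ℂ] Lp ℂ 2 ((volume : Measure (Es n)).restrict (ball c₁ r₁)))
    (A : ℝ) (K : Es n → Es n → ℂ) : Prop where
  adj : ∀ f g : Es n → ℂ, ContDiff ℝ 1 f → HasCompactSupport f → tsupport f ⊆ ball c₁ r₁ →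
        ContDiff ℝ 1 g → HasCompactSupport g → tsupport g ⊆ ball c₂ r₂ →
        ∫ x in ball c₂ r₂, (T f : Es n → ℂ) x * (starRingEnd ℂ) (g x) =
          ∫ x in ball c₁ r₁, f x * (starRingEnd ℂ) ((S g : Es n → ℂ) x)
  bT : ∀ r : ℝ, 0 < r → r ≤ r₁ → ∀ ω, IsBump n r ω → tsupport ω ⊆ ball c₁ r₁ → ‖T ω‖ ≤ A * r ^ ((n : ℝ) / 2)
  bS : ∀ r : ℝ, 0 < r → r ≤ r₂ → ∀ ω, IsBump n r ω → tsupport ω ⊆ ball c₂ r₂ → ‖S ω‖ ≤ A * r ^ ((n : ℝ) / 2)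
  cK : ContDiffOn ℝ 1 (fun p : Es n × Es n => K p.1 p.2) {p | p.1 ≠ p.2}
  rep : ∀ F, ContDiff ℝ 1 F → HasCompactSupport F → tsupport F ⊆ ball c₁ r₁ →
          ∀ᵐ x ∂((volume : Measure (Es n)).restrict (ball c₂ r₂)),
            x ∉ tsupport F → (T F : Es n → ℂ) x = ∫ y, K x y * F y
  size : ∀ x ∈ ball c₂ r₂, ∀ y ∈ ball c₁ r₁, x ≠ y → ‖K x y‖ ≤ A / ‖x - y‖ ^ n
  der : ∀ i : Fin n, ∀ x ∈ ball c₂ r₂, ∀ y ∈ ball c₁ r₁, x ≠ y →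
          ‖fderiv ℝ (fun x' => K x' y) x (EuclideanSpace.single i 1)‖ ≤ A / ‖x - y‖ ^ (n + 1) ∧
          ‖fderiv ℝ (fun y' => K x y') y (EuclideanSpace.single i 1)‖ ≤ A / ‖x - y‖ ^ (n + 1)

lemma cs_ball {χ : Es n → ℂ} (h : HasCompactSupport χ) : ∃ R : ℝ, ∀ F : Es n → ℂ, (∀ x ∈ closedBall 0 R, F x = 0) → χ * F = 0 := by
  obtain ⟨R, hR⟩ := h.isCompact.isBounded.subset_closedBall 0
  refine ⟨R, fun F hF => ?_⟩
  ext x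
  by_cases hx : x ∈ tsupport χ
  · simp [hF x (hR hx)]
  · simp [image_eq_zero_of_notMem_tsupport hx]

lemma C1c.cmul {K : Set (Es n)} {c : Es n} {r M : ℝ} {χ F : Es n → ℂ} (hχ : Cut K c r χ M) (hF : ContDiff ℝ 1 F) :
    C1c (χ * F) := ⟨hχ.cd.mul hF, hχ.cs.mul_right⟩

section
variable {K₁ K₂ : Set (Es n)} {c₁ c₂ : Es n} {r₁ r₂ M₁ M₂ : ℝ} {χ₁ χ₂ : Es n → ℂ}
  {T : (Es n → ℂ) →ₗ[ℂ] Lp ℂ 2 ((volume : Measure (Es n)).restrict (ball c₂ r₂))}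
  {S : (Es n → ℂ) →ₗ[ℂ] Lp ℂ 2 ((volume : Measure (Es n)).restrict (ball c₁ r₁))} {A : ℝ} {K : Es n → Es n → ℂ}

/-- the localized form -/
def loc (χ₁ χ₂ : Es n → ℂ) (T : (Es n → ℂ) →ₗ[ℂ] Lp ℂ 2 ((volume : Measure (Es n)).restrict (ball c₂ r₂)))
    (F G : Es n → ℂ) : ℂ := ∫ x in ball c₂ r₂, (T (χ₁ * F) : Es n → ℂ) x * (χ₂ x * G x)

lemma loc_int (h₂ : Cut K₂ c₂ r₂ χ₂ M₂) (v : Lp ℂ 2 ((volume : Measure (Es n)).restrict (ball c₂ r₂))) {G : Es n → ℂ} (hG : C1c G) :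
    Integrable (fun x => v x * (χ₂ x * G x)) (volume.restrict (ball c₂ r₂)) :=
  (Lp.memLp v).integrable_mul (((C1c.cmul h₂ hG.1).memLp 2).restrict _)

lemma loc_add_left (h₂ : Cut K₂ c₂ r₂ χ₂ M₂) (F F' G : Es n → ℂ) (hG : C1c G) :
    loc χ₁ χ₂ T (F + F') G = loc χ₁ χ₂ T F G + loc χ₁ χ₂ T F' G := by
  unfold loc
  rw [mul_add, map_add, ← integral_add (loc_int h₂ _ hG) (loc_int h₂ _ hG)]
  refine integral_congr_ae ?_
  filter_upwards [Lp.coeFn_add (T (χ₁ * F)) (T (χ₁ * F'))] with x hx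
  rw [hx, Pi.add_apply]; ring

lemma loc_add_right (h₂ : Cut K₂ c₂ r₂ χ₂ M₂) (F G G' : Es n → ℂ) (hG : C1c G) (hG' : C1c G') :
    loc χ₁ χ₂ T F (G + G') = loc χ₁ χ₂ T F G + loc χ₁ χ₂ T F G' := by
  unfold loc
  rw [← integral_add (loc_int h₂ _ hG) (loc_int h₂ _ hG')]
  congr 1
  ext x
  simp only [Pi.add_apply]; ring

lemma loc_smul_left (c : ℂ) (F G : Es n → ℂ) :
    loc χ₁ χ₂ T (c • F) G = c * loc χ₁ χ₂ T F G := by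
  unfold loc
  rw [mul_smul_comm, map_smul, ← integral_const_mul]
  refine integral_congr_ae ?_
  filter_upwards [Lp.coeFn_smul c (T (χ₁ * F))] with x hx
  rw [hx, Pi.smul_apply, smul_eq_mul]; ring

lemma loc_smul_right (c : ℂ) (F G : Es n → ℂ) :
    loc χ₁ χ₂ T F (c • G) = c * loc χ₁ χ₂ T F G := by
  unfold loc
  rw [← integral_const_mul]
  congr 1
  ext x
  simp only [Pi.smul_apply, smul_eq_mul]; ring

lemma loc_adj (H : Hyp c₁ c₂ r₁ r₂ T S A K) (h₁ : Cut K₁ c₁ r₁ χ₁ M₁) (h₂ : Cut K₂ c₂ r₂ χ₂ M₂) {F G : Es n → ℂ} (hF : C1c F) (hG : ContDiff ℝ 1 G) :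
    loc χ₁ χ₂ T F G = ∫ x in ball c₁ r₁, (starRingEnd ℂ) ((S (χ₂ * fun x => (starRingEnd ℂ) (G x)) : Es n → ℂ) x) * (χ₁ x * F x) := by
  have hG' : ContDiff ℝ 1 (fun x => (starRingEnd ℂ) (G x)) := Complex.conjCLE.contDiff.comp hG
  have e := H.adj (χ₁ * F) (χ₂ * fun x => (starRingEnd ℂ) (G x)) (C1c.cmul h₁ hF.1).1 (C1c.cmul h₁ hF.1).2
    ((mul_ts_left _ _).trans h₁.ts) (C1c.cmul h₂ hG').1 (C1c.cmul h₂ hG').2 ((mul_ts_left _ _).trans h₂.ts)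
  unfold loc
  have e2 : ∀ x, (starRingEnd ℂ) ((χ₂ * fun x => (starRingEnd ℂ) (G x)) x) = χ₂ x * G x := fun x => by
    simp [h₂.re]
  simp only [e2] at e
  rw [e]
  congr 1
  ext x
  simp only [Pi.mul_apply]; ring

lemma loc_kernel (H : Hyp c₁ c₂ r₁ r₂ T S A K) (h₁ : Cut K₁ c₁ r₁ χ₁ M₁) (h₂ : Cut K₂ c₂ r₂ χ₂ M₂)
    (hc : ContinuousOn (fun p : Es n × Es n => χ₂ p.1 * K p.1 p.2 * χ₁ p.2) {p | p.1 ≠ p.2}) {F G : Es n → ℂ} (hF : C1c F) (hG : C1c G)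
    (hd : Disjoint (tsupport F) (tsupport G)) :
    loc χ₁ χ₂ T F G = ∫ p : Es n × Es n, (χ₂ p.1 * K p.1 p.2 * χ₁ p.2) * F p.2 * G p.1 := by
  have hI := kint_int (H := fun x y => χ₂ x * K x y * χ₁ y) hF hG hc hd
  have hI' : Integrable (fun p : Es n × Es n => χ₂ p.1 * K p.1 p.2 * χ₁ p.2 * F p.2 * G p.1) (volume.prod volume) := hI
  have e0 : ∫ p : Es n × Es n, (χ₂ p.1 * K p.1 p.2 * χ₁ p.2) * F p.2 * G p.1 =
      ∫ x, ∫ y, (χ₂ x * K x y * χ₁ y) * F y * G x := integral_prod _ hI'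
  rw [e0]
  have e1 : ∫ x, ∫ y, (χ₂ x * K x y * χ₁ y) * F y * G x = ∫ x in ball c₂ r₂, ∫ y, (χ₂ x * K x y * χ₁ y) * F y * G x := by
    rw [← integral_indicator measurableSet_ball]
    congr 1
    ext x
    by_cases hx : x ∈ ball c₂ r₂
    · simp [hx]
    · have : χ₂ x = 0 := image_eq_zero_of_notMem_tsupport fun h => hx (h₂.ts h)
      simp [hx, this]
  rw [e1]
  unfold loc
  refine integral_congr_ae ?_
  filter_upwards [H.rep (χ₁ * F) (C1c.cmul h₁ hF.1).1 (C1c.cmul h₁ hF.1).2 ((mul_ts_left _ _).trans h₁.ts)] with x hx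
  by_cases hxG : x ∈ tsupport G
  · have hxF : x ∉ tsupport (χ₁ * F) := fun h => Set.disjoint_left.1 hd (mul_ts_right _ _ h) hxG
    rw [hx hxF, ← integral_mul_const]
    congr 1
    ext y
    simp only [Pi.mul_apply]; ring
  · simp [image_eq_zero_of_notMem_tsupport hxG]

lemma diff_left {x y : Es n} (h : ContDiffOn ℝ 1 (fun p : Es n × Es n => K p.1 p.2) {p | p.1 ≠ p.2}) (hxy : x ≠ y) :
    DifferentiableAt ℝ (fun x' => K x' y) x ∧ DifferentiableAt ℝ (fun y' => K x y') y := by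
  have ho : IsOpen {p : Es n × Es n | p.1 ≠ p.2} := isOpen_ne_fun continuous_fst continuous_snd
  have hd : DifferentiableAt ℝ (fun p : Es n × Es n => K p.1 p.2) (x, y) :=
    (h.differentiableOn one_ne_zero).differentiableAt (ho.mem_nhds hxy)
  constructor
  · exact DifferentiableAt.comp x (g := fun p : Es n × Es n => K p.1 p.2) (f := fun x' => (x', y)) hd (by fun_prop)
  · exact DifferentiableAt.comp y (g := fun p : Es n × Es n => K p.1 p.2) (f := fun y' => (x, y')) hd (by fun_prop)

lemma loc_czo (H : Hyp c₁ c₂ r₁ r₂ T S A K) (hA : 0 < A) (hr₁ : 0 < r₁) (hr₂ : 0 < r₂) (h₁ : Cut K₁ c₁ r₁ χ₁ M₁) (h₂ : Cut K₂ c₂ r₂ χ₂ M₂) {L D : ℝ}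
    (hL : ∀ x ∈ ball c₂ r₂, ∀ y ∈ ball c₁ r₁, ‖x - y‖ ≤ L)
    (hD1 : A ≤ D) (hD2 : (n + M₂ * L) * A ≤ D) (hD3 : (n + M₁ * L) * A ≤ D) (hD4 : (1 + M₁ * r₁) * A ≤ D) (hD5 : (1 + M₂ * r₂) * A ≤ D) :
    CZO (loc χ₁ χ₂ T) (fun x y => χ₂ x * K x y * χ₁ y) D ∧ CZO (flp (loc χ₁ χ₂ T)) (flp (fun x y => χ₂ x * K x y * χ₁ y)) D := by
  have hD0 : 0 < D := hA.trans_le hD1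
  have hcont : ContinuousOn (fun p : Es n × Es n => χ₂ p.1 * K p.1 p.2 * χ₁ p.2) {p | p.1 ≠ p.2} :=
    ((h₂.cd.continuous.comp continuous_fst).continuousOn.mul H.cK.continuousOn).mul (h₁.cd.continuous.comp continuous_snd).continuousOn
  obtain ⟨k1, k2⟩ := kdiff h₁ h₂ hA hL (fun x y hxy => (diff_left H.cK hxy).1) H.size (fun i x hx y hy hxy => (H.der i x hx y hy hxy).1) hD1 hD2
  obtain ⟨k3, k4⟩ := kdiff h₂ h₁ (K := fun y x => K x y) hA (fun x hx y hy => by rw [norm_sub_rev]; exact hL y hy x hx)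
    (fun x y hxy => (diff_left H.cK hxy.symm).2)
    (fun x hx y hy hxy => by rw [norm_sub_rev]; exact H.size y hy x hx hxy.symm)
    (fun i x hx y hy hxy => by rw [norm_sub_rev]; exact (H.der i y hy x hx hxy.symm).2) hD1 hD3
  have hfl : ∀ x y, flp (fun x y => χ₂ x * K x y * χ₁ y) x y = χ₁ x * K y x * χ₂ y := fun x y => by
    simp only [flp]; ring
  have sqb : ∀ {B r X : ℝ}, 0 < r → 0 ≤ X → 0 ≤ B → B * A ≤ D → X ≤ B * A * r ^ ((n : ℝ) / 2) → X ^ 2 ≤ D ^ 2 * r ^ n := by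
    intro B r X hr hX hB0 hB hXB
    have hp : 0 ≤ r ^ ((n : ℝ) / 2) := by positivity
    calc X ^ 2 ≤ (B * A * r ^ ((n : ℝ) / 2)) ^ 2 := by gcongr
      _ = (B * A) ^ 2 * r ^ n := by rw [mul_pow, sq_rpow_half hr]
      _ ≤ _ := by gcongr
  have m1 := h₁.M0
  have m2 := h₂.M0
  constructor
  · refine ⟨fun F F' G _ _ hG => loc_add_left h₂ F F' G hG, fun c F G _ _ => loc_smul_left c F G,
      fun F G hF hG hd => loc_kernel H h₁ h₂ hcont hF hG hd, hcont, k1, k2, ?_, ?_⟩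
    · intro h c r hr hh hs b1 b2
      have hN := test_aux h₁ hr₁ (N := fun F => ‖T F‖) hA (fun a F => by rw [map_smul, norm_smul]) H.bT hr hh hs b1 b2
      obtain ⟨u1, u2, u3⟩ := ext_aux h₂ (Lp.memLp (T (χ₁ * h)))
      refine ⟨_, u1, u2.trans ?_, fun G hG => u3 G⟩
      rw [← Lp_norm_sq]
      exact sqb hr (norm_nonneg _) (by positivity) hD4 hN
    · obtain ⟨R, hR⟩ := cs_ball h₁.cs
      refine ⟨R, fun F G _ _ hF => ?_⟩
      unfold loc
      rw [hR F hF, map_zero]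
      rw [integral_congr_ae (g := fun _ => 0), integral_zero]
      filter_upwards [Lp.coeFn_zero ℂ 2 (volume.restrict (ball c₂ r₂))] with x hx
      rw [hx]; simp
  · refine ⟨fun F F' G hF hF' hG => loc_add_right h₂ G F F' hF hF', fun c F G _ _ => loc_smul_right c G F,
      ?_, ?_, ?_, ?_, ?_, ?_⟩
    · intro F G hF hG hd
      have e1 : flp (loc χ₁ χ₂ T) F G = _ := loc_kernel H h₁ h₂ hcont hG hF hd.symm
      rw [e1]
      have e2 := integral_prod_swap (μ := (volume : Measure (Es n))) (ν := (volume : Measure (Es n)))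
        (fun p : Es n × Es n => χ₂ p.1 * K p.1 p.2 * χ₁ p.2 * G p.2 * F p.1)
      refine e2.symm.trans ?_
      congr 1
      ext p
      simp only [flp, Prod.fst_swap, Prod.snd_swap]; ring
    · have : Set.MapsTo (Prod.swap : Es n × Es n → Es n × Es n) {p | p.1 ≠ p.2} {p | p.1 ≠ p.2} := fun p hp => Ne.symm hp
      exact hcont.comp continuous_swap.continuousOn this
    · intro x y hxy
      rw [hfl]; exact k3 x y hxy
    · intro x y hxy
      simp only [hfl]; exact k4 x y hxy
    · intro h c r hr hh hs b1 b2
      have hh' : ContDiff ℝ 1 (fun x => (starRingEnd ℂ) (h x)) := Complex.conjCLE.contDiff.comp hh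
      have hN := test_aux h₂ hr₂ (N := fun F => ‖S F‖) hA (fun a F => by rw [map_smul, norm_smul]) H.bS hr hh'
        (z := c) (by
          refine (closure_mono ?_).trans hs
          intro x hx h0
          exact hx (by simp [h0])) (fun x => by simpa using b1 x) (fun x => by
          refine le_trans ?_ (b2 x)
          have : fderiv ℝ (fun x => (starRingEnd ℂ) (h x)) x = (Complex.conjCLE : ℂ →L[ℝ] ℂ).comp (fderiv ℝ h x) :=
            (Complex.conjCLE : ℂ →L[ℝ] ℂ).hasFDerivAt.comp x (hh.differentiable one_ne_zero x).hasFDerivAt |>.fderiv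
          rw [this]
          refine ContinuousLinearMap.opNorm_le_bound _ (norm_nonneg _) fun v => ?_
          have := (fderiv ℝ h x).le_opNorm v
          simpa using this)
      set w := S (χ₂ * fun x => (starRingEnd ℂ) (h x)) with hw
      have hwm : MemLp (fun x => (starRingEnd ℂ) ((w : Es n → ℂ) x)) 2 (volume.restrict (ball c₁ r₁)) := by
        refine (Lp.memLp w).congr_norm (Complex.continuous_conj.comp_aestronglyMeasurable (Lp.memLp w).1) ?_
        exact Filter.Eventually.of_forall fun x => by simp
      obtain ⟨u1, u2, u3⟩ := ext_aux h₁ hwm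
      refine ⟨_, u1, u2.trans ?_, fun G hG => ?_⟩
      · have : ∀ x, ‖(starRingEnd ℂ) ((w : Es n → ℂ) x)‖ = ‖(w : Es n → ℂ) x‖ := fun x => by simp
        simp only [this]
        rw [← Lp_norm_sq]
        exact sqb hr (norm_nonneg _) (by positivity) hD5 hN
      · rw [← u3 G]
        exact loc_adj H h₁ h₂ hG hh
    · obtain ⟨R, hR⟩ := cs_ball h₂.cs
      refine ⟨R, fun F G _ _ hF => ?_⟩
      simp only [flp]
      unfold loc
      have : ∀ x, χ₂ x * F x = 0 := fun x => congrFun (hR F hF) x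
      simp [this]

end
end T1

namespace T1
variable {n : ℕ}

lemma exists_dist (c₁ c₂ : Es n) {r₁ r₂ : ℝ} (hr₁ : 0 < r₁) (hr₂ : 0 < r₂) :
    ∃ L : ℝ, 0 ≤ L ∧ ∀ x ∈ ball c₂ r₂, ∀ y ∈ ball c₁ r₁, ‖x - y‖ ≤ L := by
  refine ⟨r₂ + dist c₂ c₁ + r₁, by positivity, fun x hx y hy => ?_⟩
  rw [← dist_eq_norm]
  have a1 := dist_triangle x c₂ y
  have a2 := dist_triangle c₂ c₁ y
  rw [mem_ball] at hx hy
  rw [dist_comm] at hy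
  linarith

/-- test functions in a ball -/
def W (c : Es n) (r : ℝ) : Submodule ℂ (Es n → ℂ) where
  carrier := {f | C1c f ∧ tsupport f ⊆ ball c r}
  add_mem' := by
    rintro f g ⟨h1, h2⟩ ⟨h3, h4⟩
    exact ⟨h1.add h3, (tsupport_add f g).trans (Set.union_subset h2 h4)⟩
  zero_mem' := ⟨C1c.zero, by
    have : tsupport (0 : Es n → ℂ) = ∅ := tsupport_eq_empty_iff.2 rfl
    rw [this]; exact Set.empty_subset _⟩
  smul_mem' := by
    rintro a f ⟨h1, h2⟩
    exact ⟨h1.smul a, (closure_mono (Function.support_const_smul_subset _ _)).trans h2⟩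

/-- inclusion into `L²` -/
def ee (c : Es n) (r : ℝ) : W c r →ₗ[ℂ] Lp ℂ 2 ((volume : Measure (Es n)).restrict (ball c r)) where
  toFun f := ((f.2.1.memLp 2).restrict (ball c r)).toLp f
  map_add' f g := rfl
  map_smul' a f := rfl

lemma ee_coe {c : Es n} {r : ℝ} (f : W c r) : (ee c r f : Es n → ℂ) =ᵐ[volume.restrict (ball c r)] (f : Es n → ℂ) :=
  MemLp.coeFn_toLp ((f.2.1.memLp 2).restrict (ball c r))

lemma ee_norm {c : Es n} {r : ℝ} (f : W c r) : ‖ee c r f‖ ^ 2 = ∫ x, ‖(f : Es n → ℂ) x‖ ^ 2 := by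
  rw [Lp_norm_sq]
  have : ∫ x in ball c r, ‖(ee c r f : Es n → ℂ) x‖ ^ 2 = ∫ x in ball c r, ‖(f : Es n → ℂ) x‖ ^ 2 := by
    refine integral_congr_ae ?_
    filter_upwards [ee_coe f] with x hx
    rw [hx]
  rw [this]
  refine setIntegral_eq_integral_of_forall_compl_eq_zero fun x hx => ?_
  rw [image_eq_zero_of_notMem_tsupport fun h => hx (f.2.2 h)]; simp

lemma ee_dense (c : Es n) (r : ℝ) : DenseRange (ee c r) := by
  have h0 : (LinearMap.range (ee c r))ᗮ = ⊥ := by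
    rw [eq_bot_iff]
    intro v hv
    rw [Submodule.mem_orthogonal] at hv
    rw [Submodule.mem_bot]
    have hli : LocallyIntegrableOn (v : Es n → ℂ) (ball c r) volume := by
      have : IntegrableOn (v : Es n → ℂ) (ball c r) volume := by
        have : IsFiniteMeasure ((volume : Measure (Es n)).restrict (ball c r)) :=
          ⟨by rw [Measure.restrict_apply_univ]; exact measure_ball_lt_top⟩
        exact (Lp.memLp v).integrable (by norm_num)
      exact this.locallyIntegrableOn
    have := isOpen_ball.ae_eq_zero_of_integral_contDiff_smul_eq_zero hli ?_
    · refine Lp.ext ?_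
      have h2 := (ae_restrict_iff' (μ := (volume : Measure (Es n))) (s := ball c r) (p := fun x => (v : Es n → ℂ) x = 0) measurableSet_ball).2 this
      filter_upwards [h2, Lp.coeFn_zero ℂ 2 (volume.restrict (ball c r))] with x hx hx0
      rw [hx, hx0]; rfl
    · intro g hg hgc hgs
      have hsub : tsupport (fun x => (g x : ℂ)) ⊆ tsupport g := by
        refine closure_mono fun x hx h => hx (by simp [h])
      have hcd : ContDiff ℝ 1 (fun x => (g x : ℂ)) :=
        Complex.ofRealCLM.contDiff.comp (hg.of_le (by exact_mod_cast le_top))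
      let f : W c r := ⟨fun x => (g x : ℂ), ⟨hcd, hgc.mono' ((subset_tsupport _).trans hsub)⟩, hsub.trans hgs⟩
      have h3 := hv (ee c r f) ⟨f, rfl⟩
      rw [L2.inner_def] at h3
      have h4 : ∫ x in ball c r, inner ℂ ((ee c r f : Es n → ℂ) x) ((v : Es n → ℂ) x) = ∫ x in ball c r, g x • (v : Es n → ℂ) x := by
        refine integral_congr_ae ?_
        filter_upwards [ee_coe f] with x hx
        rw [hx]
        simp [f, mul_comm]
      rw [h4] at h3
      rw [← h3]
      refine (setIntegral_eq_integral_of_forall_compl_eq_zero fun x hx => ?_).symm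
      rw [image_eq_zero_of_notMem_tsupport fun h => hx (hgs h)]; simp
  have h1 := (Submodule.topologicalClosure_eq_top_iff (K := LinearMap.range (ee c r))).2 h0
  have h2 := Submodule.dense_iff_topologicalClosure_eq_top.2 h1
  exact h2

lemma finish {K₁ K₂ : Set (Es n)} {c₁ c₂ : Es n} {r₁ r₂ M₁ M₂ : ℝ} {χ₁ χ₂ : Es n → ℂ} (h₁ : Cut K₁ c₁ r₁ χ₁ M₁) (h₂ : Cut K₂ c₂ r₂ χ₂ M₂)
    {T : (Es n → ℂ) →ₗ[ℂ] Lp ℂ 2 ((volume : Measure (Es n)).restrict (ball c₂ r₂))} {B B' : ℝ} (hB : 0 < B) (hB' : B' = 2 * B)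
    (hloc : ∀ f : Es n → ℂ,
        ContDiff ℝ 1 f → HasCompactSupport f → tsupport f ⊆ ball c₁ r₁ →
        (∀ᵐ x ∂((volume : Measure (Es n)).restrict (ball c₂ r₂)),
          x ∉ K₂ → (T f : Es n → ℂ) x = 0) ∧
        (Disjoint (tsupport f) K₁ → T f = 0))
    (hb : ∀ f g, C1c f → C1c g → ‖loc χ₁ χ₂ T f g‖ ≤ B * ((∫ x, ‖f x‖ ^ 2) + ∫ x, ‖g x‖ ^ 2)) :
    ∃ Tbar : Lp ℂ 2 ((volume : Measure (Es n)).restrict (ball c₁ r₁)) →L[ℂ]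
          Lp ℂ 2 ((volume : Measure (Es n)).restrict (ball c₂ r₂)),
        ‖Tbar‖ ≤ B' ∧
        ∀ f, ContDiff ℝ 1 f → HasCompactSupport f → tsupport f ⊆ ball c₁ r₁ →
          ∀ hm : MemLp f 2 ((volume : Measure (Es n)).restrict (ball c₁ r₁)),
            Tbar (hm.toLp f) = T f := by
  have hT : ∀ f : W c₁ r₁, T (χ₁ * (f : Es n → ℂ)) = T f := by
    rintro ⟨f, hf, hfs⟩
    have hm := C1c.cmul h₁ hf.1
    have hs : tsupport (f - χ₁ * f) ⊆ tsupport f := by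
      refine closure_mono fun x hx h => hx (by simp [h])
    have := (hloc (f - χ₁ * f) (hf.sub hm).1 (hf.sub hm).2 (hs.trans hfs)).2 ?_
    · rw [map_sub, sub_eq_zero] at this
      exact this.symm
    · obtain ⟨U, hU, hKU, hU1⟩ := h₁.one
      rw [Set.disjoint_right]
      intro x hx
      rw [notMem_tsupport_iff_eventuallyEq]
      filter_upwards [hU.mem_nhds (hKU hx)] with z hz
      simp [hU1 z hz]
  have key : ∀ (f : W c₁ r₁) (w : Lp ℂ 2 ((volume : Measure (Es n)).restrict (ball c₂ r₂))),
      ‖inner ℂ w (T f)‖ ≤ B * (‖ee c₁ r₁ f‖ ^ 2 + ‖w‖ ^ 2) := by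
    intro f w
    refine (ee_dense c₂ r₂).induction (P := fun w => ‖inner ℂ w (T f)‖ ≤ B * (‖ee c₁ r₁ f‖ ^ 2 + ‖w‖ ^ 2)) ?_ ?_ w
    · rintro _ ⟨g, rfl⟩
      rw [ee_norm, ee_norm]
      have hg' : C1c (fun x => (starRingEnd ℂ) ((g : Es n → ℂ) x)) :=
        ⟨Complex.conjCLE.contDiff.comp g.2.1.1, g.2.1.2.mono fun x hx h => hx (by simp [h])⟩
      have e := hb f _ f.2.1 hg'
      simp only [RCLike.norm_conj] at e
      refine le_trans (le_of_eq ?_) e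
      congr 1
      rw [L2.inner_def]
      unfold loc
      rw [hT]
      refine integral_congr_ae ?_
      filter_upwards [ee_coe g, (hloc f f.2.1.1 f.2.1.2 f.2.2).1] with x hx hx2
      rw [hx]
      by_cases hxK : x ∈ K₂
      · obtain ⟨U, hU, hKU, hU1⟩ := h₂.one
        rw [hU1 x (hKU hxK)]
        simp
      · rw [hx2 hxK]; simp
    · exact isClosed_le (by fun_prop) (by fun_prop)
  have bound : ∀ f : W c₁ r₁, ‖(T.comp (W c₁ r₁).subtype) f‖ ≤ B' * ‖ee c₁ r₁ f‖ := by
    intro f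
    simp only [LinearMap.comp_apply, Submodule.subtype_apply]
    have k := key f (((1 / (2 * B) : ℝ) : ℂ) • T f)
    rw [inner_smul_left, norm_mul, norm_smul, inner_self_eq_norm_sq_to_K] at k
    have q0 : 0 ≤ 1 / (2 * B) := by positivity
    simp only [Complex.conj_ofReal, Complex.norm_real, Real.norm_of_nonneg q0, norm_pow] at k
    have q1 : ‖((‖T f‖ : ℝ) : ℂ)‖ = ‖T f‖ := by simp
    have k' : 1 / (2 * B) * ‖T f‖ ^ 2 ≤ B * (‖ee c₁ r₁ f‖ ^ 2 + (1 / (2 * B) * ‖T f‖) ^ 2) := by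
      simpa using k
    have k2 : ‖T f‖ ^ 2 ≤ (B' * ‖ee c₁ r₁ f‖) ^ 2 := by
      have h3 : B * (1 / (2 * B) * ‖T f‖) ^ 2 = 1 / (4 * B) * ‖T f‖ ^ 2 := by field_simp; ring
      have h4 : 1 / (2 * B) * ‖T f‖ ^ 2 = 2 * (1 / (4 * B) * ‖T f‖ ^ 2) := by field_simp; ring
      have h5 : 1 / (4 * B) * ‖T f‖ ^ 2 ≤ B * ‖ee c₁ r₁ f‖ ^ 2 := by linarith
      have h6 : ‖T f‖ ^ 2 = (4 * B) * (1 / (4 * B) * ‖T f‖ ^ 2) := by field_simp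
      rw [h6, hB']
      calc _ ≤ 4 * B * (B * ‖ee c₁ r₁ f‖ ^ 2) := by gcongr
        _ = _ := by ring
    exact le_of_sq_le_sq k2 (by rw [hB']; positivity)
  refine ⟨(T.comp (W c₁ r₁).subtype).extendOfNorm (ee c₁ r₁), ?_, ?_⟩
  · exact ContinuousLinearMap.opNorm_le_bound _ (by rw [hB']; positivity)
      (LinearMap.norm_extendOfNorm_apply_le (ee_dense c₁ r₁) B' bound)
  · intro f h1 h2 h3 hm
    exact LinearMap.extendOfNorm_eq (ee_dense c₁ r₁) ⟨B', bound⟩ ⟨f, ⟨h1, h2⟩, h3⟩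

end T1

/-- **A localized `T(1)` theorem on balls in `ℝⁿ` (L² bump hypotheses).**
Given open balls `B₁, B₂ ⊆ ℝⁿ` and compacts `K₁ ⊆ B₁`, `K₂ ⊆ B₂`, there is `C₀ > 0`
such that any linear `T : C¹_c(B₁) → L²(B₂)` with formal adjoint, localized to
`K₁, K₂`, satisfying the `L²` bump estimates and represented off supports by a kernel
with Calderón–Zygmund estimates (constant `A`), extends to a bounded operator
`L²(B₁) → L²(B₂)` of norm at most `C₀ A`. -/
theorem statement_1 (n : ℕ) (hn : 1 ≤ n)
    (c₁ c₂ : EuclideanSpace ℝ (Fin n)) (r₁ r₂ : ℝ) (hr₁ : 0 < r₁) (hr₂ : 0 < r₂)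
    (K₁ K₂ : Set (EuclideanSpace ℝ (Fin n)))
    (hK₁ : IsCompact K₁) (hK₂ : IsCompact K₂)
    (hK₁B : K₁ ⊆ ball c₁ r₁) (hK₂B : K₂ ⊆ ball c₂ r₂) :
    ∃ C₀ : ℝ, 0 < C₀ ∧
    ∀ (T : (EuclideanSpace ℝ (Fin n) → ℂ) →ₗ[ℂ]
        Lp ℂ 2 ((volume : Measure (EuclideanSpace ℝ (Fin n))).restrict (ball c₂ r₂)))
      (Tstar : (EuclideanSpace ℝ (Fin n) → ℂ) →ₗ[ℂ]
        Lp ℂ 2 ((volume : Measure (EuclideanSpace ℝ (Fin n))).restrict (ball c₁ r₁)))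
      (A : ℝ), 0 < A →
      -- `T*` is a formal adjoint of `T`
      (∀ f g : EuclideanSpace ℝ (Fin n) → ℂ,
        ContDiff ℝ 1 f → HasCompactSupport f → tsupport f ⊆ ball c₁ r₁ →
        ContDiff ℝ 1 g → HasCompactSupport g → tsupport g ⊆ ball c₂ r₂ →
        ∫ x in ball c₂ r₂,
            (T f : EuclideanSpace ℝ (Fin n) → ℂ) x * (starRingEnd ℂ) (g x) =
          ∫ x in ball c₁ r₁,
            f x * (starRingEnd ℂ) ((Tstar g : EuclideanSpace ℝ (Fin n) → ℂ) x)) →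
      -- (a) localization
      (∀ f : EuclideanSpace ℝ (Fin n) → ℂ,
        ContDiff ℝ 1 f → HasCompactSupport f → tsupport f ⊆ ball c₁ r₁ →
        (∀ᵐ x ∂((volume : Measure (EuclideanSpace ℝ (Fin n))).restrict (ball c₂ r₂)),
          x ∉ K₂ → (T f : EuclideanSpace ℝ (Fin n) → ℂ) x = 0) ∧
        (Disjoint (tsupport f) K₁ → T f = 0)) →
      -- (i) bump estimates
      (∀ r : ℝ, 0 < r → r ≤ r₁ → ∀ ω, IsBump n r ω → tsupport ω ⊆ ball c₁ r₁ →
        ‖T ω‖ ≤ A * r ^ ((n : ℝ) / 2)) →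
      (∀ r : ℝ, 0 < r → r ≤ r₂ → ∀ ω, IsBump n r ω → tsupport ω ⊆ ball c₂ r₂ →
        ‖Tstar ω‖ ≤ A * r ^ ((n : ℝ) / 2)) →
      -- (ii), (iii) kernel representation and Calderón–Zygmund estimates
      (∃ K : EuclideanSpace ℝ (Fin n) → EuclideanSpace ℝ (Fin n) → ℂ,
        ContDiffOn ℝ 1 (fun p : EuclideanSpace ℝ (Fin n) × EuclideanSpace ℝ (Fin n) =>
          K p.1 p.2) {p | p.1 ≠ p.2} ∧
        (∀ F, ContDiff ℝ 1 F → HasCompactSupport F → tsupport F ⊆ ball c₁ r₁ →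
          ∀ᵐ x ∂((volume : Measure (EuclideanSpace ℝ (Fin n))).restrict (ball c₂ r₂)),
            x ∉ tsupport F → (T F : EuclideanSpace ℝ (Fin n) → ℂ) x = ∫ y, K x y * F y) ∧
        (∀ x ∈ ball c₂ r₂, ∀ y ∈ ball c₁ r₁, x ≠ y → ‖K x y‖ ≤ A / ‖x - y‖ ^ n) ∧
        (∀ i : Fin n, ∀ x ∈ ball c₂ r₂, ∀ y ∈ ball c₁ r₁, x ≠ y →
          ‖fderiv ℝ (fun x' => K x' y) x (EuclideanSpace.single i 1)‖ ≤ A / ‖x - y‖ ^ (n + 1) ∧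
          ‖fderiv ℝ (fun y' => K x y') y (EuclideanSpace.single i 1)‖ ≤ A / ‖x - y‖ ^ (n + 1))) →
      ∃ Tbar : Lp ℂ 2 ((volume : Measure (EuclideanSpace ℝ (Fin n))).restrict (ball c₁ r₁)) →L[ℂ]
          Lp ℂ 2 ((volume : Measure (EuclideanSpace ℝ (Fin n))).restrict (ball c₂ r₂)),
        ‖Tbar‖ ≤ C₀ * A ∧
        ∀ f, ContDiff ℝ 1 f → HasCompactSupport f → tsupport f ⊆ ball c₁ r₁ →
          ∀ hm : MemLp f 2 ((volume : Measure (EuclideanSpace ℝ (Fin n))).restrict (ball c₁ r₁)),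
            Tbar (hm.toLp f) = T f := by
  obtain ⟨χ₁, M₁, h₁⟩ := T1.exists_cut hr₁ hK₁ hK₁B
  obtain ⟨χ₂, M₂, h₂⟩ := T1.exists_cut hr₂ hK₂ hK₂B
  obtain ⟨C, hC, hmain⟩ := T1.contT1 n hn
  obtain ⟨L, hL0, hL⟩ := T1.exists_dist c₁ c₂ hr₁ hr₂
  have m1 := h₁.M0
  have m2 := h₂.M0
  set E : ℝ := 1 + (n + M₂ * L) + (n + M₁ * L) + (1 + M₁ * r₁) + (1 + M₂ * r₂) with hE
  have p1 : 0 ≤ M₂ * L := by positivity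
  have p2 : 0 ≤ M₁ * L := by positivity
  have p3 : 0 ≤ M₁ * r₁ := by positivity
  have p4 : 0 ≤ M₂ * r₂ := by positivity
  have p5 : (0 : ℝ) ≤ n := by positivity
  have hE0 : 0 < E := by rw [hE]; linarith
  refine ⟨2 * C * E, by positivity, ?_⟩
  intro T S A hA hadj hloc hbT hbS ⟨K, hK, hrep, hsize, hder⟩
  have H : T1.Hyp c₁ c₂ r₁ r₂ T S A K := ⟨hadj, hbT, hbS, hK, hrep, hsize, hder⟩
  have hDle : ∀ a : ℝ, a ≤ E → a * A ≤ E * A := fun a ha => mul_le_mul_of_nonneg_right ha hA.le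
  obtain ⟨z1, z2⟩ := T1.loc_czo H hA hr₁ hr₂ h₁ h₂ hL (D := E * A) (by linarith [hDle 1 (by rw [hE]; linarith)])
    (hDle _ (by rw [hE]; linarith)) (hDle _ (by rw [hE]; linarith)) (hDle _ (by rw [hE]; linarith)) (hDle _ (by rw [hE]; linarith))
  have hf := hmain _ _ _ (mul_pos hE0 hA) z1 z2
  exact T1.finish h₁ h₂ (B := C * (E * A)) (by positivity) (by ring) hloc hf
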